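/- arXiv:1011.0038 — 18 statements merged into one kernel-verified Lean document; each statement's English description precedes it below -/
import Mathlib

section
/- Let R → S be a faithfully flat ring map and let M be an R-module. If the S-module M ⊗_R S is projective, then M is a projective R-module. -/
open TensorProduct

universe u

/-- A module is projective if it is the union of the images of a sequence of projective modules
`F n` whose transition maps satisfy a strong form of the Mittag-Leffler condition. -/
theorem Module.Projective.of_stabilizing_seq {R M : Type*} [CommRing R] [AddCommGroup M]
    [Module R M] {F : ℕ → Type*} [∀ n, AddCommGroup (F n)] [∀ n, Module R (F n)]
    [∀ n, Module.Projective R (F n)] (v : ∀ n, F n →ₗ[R] M) (u : ∀ n, F n →ₗ[R] F (n + 1))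
    (w : ∀ n, F (n + 2) →ₗ[R] F (n + 1)) (hv : ∀ n z, v (n + 1) (u n z) = v n z)
    (hw : ∀ n z, w n (u (n + 1) (u n z)) = u n z) (hker : ∀ n z, v n z = 0 → u n z = 0)
    (htop : ∀ m, ∃ n z, v n z = m) : Module.Projective R M := by
  let π : (M →₀ R) →ₗ[R] M := Finsupp.linearCombination R id
  have hπ : Function.Surjective π := Finsupp.linearCombination_surjective _ Function.surjective_id
  have step (n : ℕ) (t : F (n + 1) →ₗ[R] (M →₀ R)) (ht : π ∘ₗ t = v (n + 1)) :
      ∃ t' : F (n + 2) →ₗ[R] (M →₀ R), π ∘ₗ t' = v (n + 2) ∧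
        ∀ z, t' (u (n + 1) (u n z)) = t (u n z) := by
    obtain ⟨t', ht'⟩ := Module.projective_lifting_property π (v (n + 2)) hπ
    refine ⟨t' + (t - t' ∘ₗ u (n + 1)) ∘ₗ w n, ?_, fun z ↦ ?_⟩
    · ext z
      have h1 (x) : π (t x) = v (n + 1) x := LinearMap.congr_fun ht x
      have h2 (x) : π (t' x) = v (n + 2) x := congr($ht' x)
      simp [h1, h2, hv]
    · simp [hw]
  let T (n : ℕ) : {t : F (n + 1) →ₗ[R] (M →₀ R) // π ∘ₗ t = v (n + 1)} :=
    Nat.rec ⟨_, (Module.projective_lifting_property π (v 1) hπ).choose_spec⟩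
      (fun n t ↦ ⟨_, (step n t.1 t.2).choose_spec.1⟩) n
  have hT (n : ℕ) (z : F n) : (T (n + 1)).1 (u (n + 1) (u n z)) = (T n).1 (u n z) :=
    (step n (T n).1 (T n).2).choose_spec.2 z
  let s (n : ℕ) : F n →ₗ[R] (M →₀ R) := (T n).1 ∘ₗ u n
  have hs (n : ℕ) (z : F n) : s (n + 1) (u n z) = s n z := hT n z
  have hπs (n : ℕ) (z : F n) : π (s n z) = v n z := by
    rw [← hv n z]
    exact congr($((T n).2) (u n z))
  have push {n k : ℕ} (hnk : n ≤ k) (z : F n) : ∃ z' : F k, v k z' = v n z ∧ s k z' = s n z := by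
    induction k, hnk using Nat.le_induction with
    | base => exact ⟨z, rfl, rfl⟩
    | succ k _ ih =>
      obtain ⟨z', h1, h2⟩ := ih
      exact ⟨u k z', by rw [hv, h1], by rw [hs, h2]⟩
  have key {n k : ℕ} (z : F n) (z' : F k) (h : v n z = v k z') : s n z = s k z' := by
    obtain ⟨y, hy1, hy2⟩ := push (le_max_left n k) z
    obtain ⟨y', hy1', hy2'⟩ := push (le_max_right n k) z'
    rw [← hy2, ← hy2', ← sub_eq_zero, ← map_sub]
    have : u _ (y - y') = 0 := hker _ _ (by rw [map_sub, hy1, hy1', h, sub_self])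
    simp [s, this]
  choose N Z hZ using htop
  let σ : M →ₗ[R] (M →₀ R) :=
    { toFun m := s (N m) (Z m)
      map_add' a b := by
        obtain ⟨y, hy1, hy2⟩ := push (le_max_left (N a) (N b)) (Z a)
        obtain ⟨y', hy1', hy2'⟩ := push (le_max_right (N a) (N b)) (Z b)
        rw [← hy2, ← hy2', ← map_add]
        exact key _ _ (by rw [hZ, map_add, hy1, hy1', hZ, hZ])
      map_smul' r a := by
        rw [RingHom.id_apply, ← map_smul]
        exact key _ _ (by rw [hZ, map_smul, hZ]) }
  exact ⟨σ, fun m ↦ (hπs _ _).trans (hZ m)⟩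

/-- Finitely many elements of a projective base change `S ⊗[R] M` of a module `M`
are reproduced by finitely many elements of `M` and functionals on `S ⊗[R] M`. -/
theorem exists_dual_reproducing {R S M : Type*} [CommRing R] [CommRing S] [Algebra R S]
    [AddCommGroup M] [Module R M] [Module.Projective S (S ⊗[R] M)] {k : ℕ}
    (p : Fin k → S ⊗[R] M) :
    ∃ (T : Finset M) (γ : M → Module.Dual S (S ⊗[R] M)), ∀ i, p i = ∑ m ∈ T, γ m (p i) ⊗ₜ m := by
  classical
  obtain ⟨s, hs⟩ := Module.projective_def.mp ‹Module.Projective S (S ⊗[R] M)›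
  have hfin (q : S ⊗[R] M) : ∃ c : M →₀ S, q = c.sum fun m a ↦ a ⊗ₜ m := by
    induction q using TensorProduct.induction_on with
    | zero => exact ⟨0, by simp⟩
    | tmul a m => exact ⟨Finsupp.single m a, by simp⟩
    | add x y hx hy =>
      obtain ⟨c, rfl⟩ := hx
      obtain ⟨d, rfl⟩ := hy
      exact ⟨c + d, by rw [Finsupp.sum_add_index'] <;> simp [add_tmul]⟩
  choose c hc using hfin
  let Q : Finset (S ⊗[R] M) := Finset.univ.biUnion fun i ↦ (s (p i)).support
  refine ⟨Q.biUnion fun q ↦ (c q).support,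
    fun m ↦ ∑ q ∈ Q, c q m • (Finsupp.lapply q ∘ₗ s), fun i ↦ ?_⟩
  have h1 : p i = ∑ q ∈ Q, s (p i) q • q := by
    conv_lhs => rw [← hs (p i), Finsupp.linearCombination_apply]
    exact Finsupp.sum_of_support_subset _
      (Finset.subset_biUnion_of_mem (fun i ↦ (s (p i)).support) (Finset.mem_univ i)) _ (by simp)
  have h2 (q) (hq : q ∈ Q) : q = ∑ m ∈ Q.biUnion fun q ↦ (c q).support, c q m ⊗ₜ[R] m := by
    conv_lhs => rw [hc q]
    exact Finsupp.sum_of_support_subset _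
      (Finset.subset_biUnion_of_mem (fun q ↦ (c q).support) hq) _ (by simp)
  conv_lhs => rw [h1]
  simp only [LinearMap.sum_apply, sum_tmul]
  rw [Finset.sum_comm]
  refine Finset.sum_congr rfl fun q hq ↦ ?_
  conv_lhs => enter [2]; rw [h2 q hq]
  rw [Finset.smul_sum]
  refine Finset.sum_congr rfl fun m _ ↦ ?_
  simp [smul_tmul', mul_comm]

/-- If `S ⊗[R] M` is projective and `M` is flat, then every finite family `x` in `M` factors
through a finite family `y` by a matrix `A` whose base change to `S` is given by functionals
evaluated at `x`. -/
theorem exists_factorization_dual {R S M : Type*} [CommRing R] [CommRing S] [Algebra R S]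
    [AddCommGroup M] [Module R M] [Module.Flat R M] [Module.Projective S (S ⊗[R] M)] {k : ℕ}
    (x : Fin k → M) :
    ∃ (n : ℕ) (y : Fin n → M) (A : Fin k → Fin n → R) (β : Fin n → Module.Dual S (S ⊗[R] M)),
      (∀ i, x i = ∑ j, A i j • y j) ∧ ∀ i j, algebraMap R S (A i j) = β j (1 ⊗ₜ x i) := by
  classical
  obtain ⟨T, γ, hγ⟩ := exists_dual_reproducing fun i ↦ (1 : S) ⊗ₜ[R] x i
  let V : Fin k ⊕ T → (Fin k → S) :=
    Sum.elim (fun i ↦ Pi.single i 1) fun t i ↦ -γ t (1 ⊗ₜ x i)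
  let X : Fin k ⊕ T → M := Sum.elim x fun t ↦ t
  have hrel : ∑ a, V a ⊗ₜ[R] X a = 0 := by
    have h (i : Fin k) : Pi.single i (1 : S) ⊗ₜ[R] x i
        = ∑ t : T, (Pi.single i (γ t (1 ⊗ₜ x i)) : Fin k → S) ⊗ₜ[R] (t : M) := by
      have := congr(((LinearMap.single R (fun _ : Fin k ↦ S) i).rTensor M) $(hγ i))
      rw [map_sum, ← Finset.sum_coe_sort] at this
      simpa using this
    have h' (t : T) : (fun i ↦ -γ t (1 ⊗ₜ x i))
        = -∑ i, (Pi.single i (γ t ((1 : S) ⊗ₜ[R] x i)) : Fin k → S) := by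
      ext i
      simp [Finset.sum_apply, Pi.single_apply]
    simp only [Fintype.sum_sum_type, V, X, Sum.elim_inl, Sum.elim_inr, h, h', neg_tmul, sum_tmul,
      Finset.sum_neg_distrib]
    rw [Finset.sum_comm, add_neg_cancel]
  obtain ⟨n, a, y, h1, h2⟩ :=
    vanishesTrivially_of_sum_tmul_eq_zero_of_rTensor_injective R
      (Module.Flat.rTensor_preserves_injective_linearMap _ (Submodule.subtype_injective _)) hrel
  refine ⟨n, y, fun i j ↦ a (.inl i) j, fun j ↦ ∑ t : T, algebraMap R S (a (.inr t) j) • γ t,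
    fun i ↦ h1 (.inl i), fun i j ↦ ?_⟩
  simpa [Fintype.sum_sum_type, V, Pi.single_apply, Algebra.smul_def, LinearMap.sum_apply,
    ← sub_eq_add_neg, sub_eq_zero] using congrFun (h2 j) i

/-- Solvability of a finite system of linear equations descends along faithfully flat maps. -/
theorem exists_sum_mul_eq_of_faithfullyFlat {R S : Type*} [CommRing R] [CommRing S] [Algebra R S]
    [Module.FaithfullyFlat R S] {k n : ℕ} (a : Fin k → R) (B : Fin k → Fin n → R) (w : Fin n → S)
    (h : ∀ i, algebraMap R S (a i) = ∑ l, algebraMap R S (B i l) * w l) :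
    ∃ w' : Fin n → R, ∀ i, a i = ∑ l, B i l * w' l := by
  classical
  let p : Submodule R (Fin k → R) := Submodule.span R (Set.range fun l i ↦ B i l)
  have hz : (1 : S) ⊗ₜ[R] p.mkQ a = 0 := by
    have ha : p.mkQ a = ∑ i, a i • p.mkQ (Pi.single i 1) := by
      conv_lhs => rw [pi_eq_sum_univ' a]
      simp [map_sum]
    have hB (l : Fin n) : ∑ i, B i l • p.mkQ (Pi.single i 1) = 0 := by
      have : (fun i ↦ B i l) ∈ p := Submodule.subset_span ⟨l, rfl⟩
      rw [← (Submodule.Quotient.mk_eq_zero p)] at this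
      rw [← this, pi_eq_sum_univ' fun i ↦ B i l]
      simp [← Submodule.mkQ_apply, map_sum]
    calc (1 : S) ⊗ₜ[R] p.mkQ a = ∑ i, ∑ l, w l ⊗ₜ[R] (B i l • p.mkQ (Pi.single i 1)) := by
          rw [ha, tmul_sum]
          refine Finset.sum_congr rfl fun i _ ↦ ?_
          rw [← smul_tmul, Algebra.smul_def, mul_one, h, sum_tmul]
          exact Finset.sum_congr rfl fun l _ ↦ by rw [← Algebra.smul_def, smul_tmul]
      _ = 0 := by
          rw [Finset.sum_comm]
          exact Finset.sum_eq_zero fun l _ ↦ by rw [← tmul_sum, hB, tmul_zero]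
  rw [Module.FaithfullyFlat.one_tmul_eq_zero_iff, Submodule.mkQ_apply,
    Submodule.Quotient.mk_eq_zero, Submodule.mem_span_range_iff_exists_fun] at hz
  obtain ⟨c, hc⟩ := hz
  exact ⟨c, fun i ↦ by simpa [mul_comm, eq_comm] using congrFun hc i⟩

/-- Descent of projectivity for countably generated modules. -/
theorem Module.Projective.of_faithfullyFlat_of_countable (R S : Type*) {M : Type*} [CommRing R]
    [CommRing S] [Algebra R S] [Module.FaithfullyFlat R S] [AddCommGroup M] [Module R M]
    [Module.Projective S (S ⊗[R] M)] {G : Set M} (hG : G.Countable)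
    (hspan : Submodule.span R G = ⊤) : Module.Projective R M := by
  classical
  have : Module.Flat R M := Module.Flat.of_flat_tensorProduct R M S
  obtain ⟨g, hg⟩ : ∃ g : ℕ → M, insert 0 G = Set.range g :=
    (hG.insert 0).exists_eq_range (Set.insert_nonempty _ _)
  have step (a : Σ k, Fin k → M) (m : M) :
      ∃ (b : Σ k, Fin k → M) (A : Fin a.1 → Fin b.1 → R)
        (β : Fin b.1 → Module.Dual S (S ⊗[R] M)),
        (∀ i, a.2 i = ∑ j, A i j • b.2 j) ∧
        (∀ i j, algebraMap R S (A i j) = β j (1 ⊗ₜ a.2 i)) ∧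
        m ∈ Submodule.span R (Set.range b.2) := by
    obtain ⟨n, y, A, β, h1, h2⟩ :=
      exists_factorization_dual (R := R) (S := S) (Fin.cons m a.2 : Fin (a.1 + 1) → M)
    refine ⟨⟨n, y⟩, fun i ↦ A i.succ, β, fun i ↦ by simpa using h1 i.succ,
      fun i j ↦ by simpa using h2 i.succ j, ?_⟩
    rw [Submodule.mem_span_range_iff_exists_fun]
    exact ⟨A 0, by simpa using (h1 0).symm⟩
  choose next A β hA hβ hmem using step
  let X (n : ℕ) : Σ k, Fin k → M := Nat.rec ⟨0, Fin.elim0⟩ (fun n a ↦ next a (g n)) n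
  let u (n : ℕ) : (Fin (X n).1 → R) →ₗ[R] (Fin (X (n + 1)).1 → R) :=
    Fintype.linearCombination R (A (X n) (g n))
  let v (n : ℕ) : (Fin (X n).1 → R) →ₗ[R] M := Fintype.linearCombination R (X n).2
  let b (n : ℕ) : Fin (X (n + 1)).1 → Module.Dual S (S ⊗[R] M) := β (X n) (g n)
  have hv (n : ℕ) (z : Fin (X n).1 → R) : v (n + 1) (u n z) = v n z := by
    suffices v (n + 1) ∘ₗ u n = v n from LinearMap.congr_fun this z
    refine (Pi.basisFun R _).ext fun i ↦ ?_
    simpa [v, u, Fintype.linearCombination_apply] using (hA (X n) (g n) i).symm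
  have hb (n : ℕ) (z : Fin (X n).1 → R) (j : Fin (X (n + 1)).1) :
      algebraMap R S (u n z j) = b n j (1 ⊗ₜ v n z) := by
    simp only [u, v, b, Fintype.linearCombination_apply, Finset.sum_apply, Pi.smul_apply,
      smul_eq_mul, map_sum, map_mul, hβ, tmul_sum, tmul_smul]
    refine Finset.sum_congr rfl fun i _ ↦ ?_
    rw [← algebraMap_smul S, map_smul, smul_eq_mul]
  have hw (n : ℕ) : ∃ w : (Fin (X (n + 2)).1 → R) →ₗ[R] (Fin (X (n + 1)).1 → R),
      ∀ z, w (u (n + 1) (u n z)) = u n z := by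
    have (j : Fin (X (n + 1)).1) := exists_sum_mul_eq_of_faithfullyFlat
      (fun i ↦ u n (Pi.single i 1) j) (fun i ↦ u (n + 1) (u n (Pi.single i 1)))
      (fun l ↦ b n j (1 ⊗ₜ v (n + 2) (Pi.single l 1))) fun i ↦ by
        rw [hb, ← hv n, ← hv (n + 1)]
        conv_lhs => rw [pi_eq_sum_univ' (u (n + 1) (u n (Pi.single i 1)))]
        simp only [map_sum, map_smul, tmul_sum, tmul_smul]
        refine Finset.sum_congr rfl fun l _ ↦ ?_
        rw [← algebraMap_smul S, map_smul, smul_eq_mul]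
    choose W hW using this
    refine ⟨Fintype.linearCombination R fun l j ↦ W j l, fun z ↦ ?_⟩
    suffices Fintype.linearCombination R (fun l j ↦ W j l) ∘ₗ u (n + 1) ∘ₗ u n = u n from
      LinearMap.congr_fun this z
    refine (Pi.basisFun R _).ext fun i ↦ ?_
    ext j
    simp [Fintype.linearCombination_apply, Finset.sum_apply, hW]
  choose w hw using hw
  refine .of_stabilizing_seq v u w hv hw (fun n z hz ↦ ?_) fun m ↦ ?_
  · ext j
    apply FaithfulSMul.algebraMap_injective R S
    simp [hb, hz]
  · have hmono : Monotone fun n ↦ LinearMap.range (v n) := by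
      refine monotone_nat_of_le_succ fun n ↦ ?_
      rintro _ ⟨z, rfl⟩
      exact ⟨u n z, hv n z⟩
    have hm : m ∈ ⨆ n, LinearMap.range (v n) := by
      suffices (⊤ : Submodule R M) ≤ ⨆ n, LinearMap.range (v n) from this trivial
      rw [← hspan, Submodule.span_le]
      intro x hx
      obtain ⟨n, rfl⟩ : x ∈ Set.range g := hg ▸ Set.mem_insert_of_mem _ hx
      refine Submodule.mem_iSup_of_mem (n + 1) ?_
      rw [Fintype.range_linearCombination]
      exact hmem (X n) (g n)
    rw [Submodule.mem_iSup_of_directed _ hmono.directed_le] at hm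
    exact hm

/-- A quotient of submodules admitting compatible retractions from a projective module is
projective. -/
theorem Module.Projective.of_retractions {S P X Y : Type*} [Ring S] [AddCommGroup P] [Module S P]
    [AddCommGroup X] [Module S X] [AddCommGroup Y] [Module S Y] [Module.Projective S P]
    {ι : X →ₗ[S] P} (hι : Function.Injective ι) {g : X →ₗ[S] Y} (hg : Function.Surjective g)
    {ρ ρ' : P →ₗ[S] P} (hρ : ∀ x, ∃ z, g z = 0 ∧ ι z = ρ x)
    (hρι : ∀ z, g z = 0 → ρ (ι z) = ι z) (hρ' : ∀ x, ρ' x ∈ LinearMap.range ι)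
    (hρι' : ∀ z, ρ' (ι z) = ι z) : Module.Projective S Y := by
  let e := LinearEquiv.ofInjective ι hι
  let r : P →ₗ[S] Y := g ∘ₗ e.symm.toLinearMap ∘ₗ ρ'.codRestrict (LinearMap.range ι) hρ'
  have hr (z : X) : r (ι z) = g z := by
    have : e z = ρ'.codRestrict (LinearMap.range ι) hρ' (ι z) := Subtype.ext (hρι' z).symm
    simp [r, ← this]
  let i : Y →ₗ[S] P := (LinearMap.ker g).liftQ (ι - ρ ∘ₗ ι)
    (fun z hz ↦ by simp [hρι z hz]) ∘ₗ (g.quotKerEquivOfSurjective hg).symm.toLinearMap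
  have hi (z : X) : i (g z) = ι z - ρ (ι z) := by
    have : (g.quotKerEquivOfSurjective hg).symm (g z) = (LinearMap.ker g).mkQ z := by
      rw [LinearEquiv.symm_apply_eq]
      rfl
    simp [i, this]
  refine .of_split i r ?_
  ext y
  obtain ⟨z, rfl⟩ := hg y
  obtain ⟨z₀, h₀, h₁⟩ := hρ (ι z)
  simp [hi, ← h₁, hr, h₀]

/-- Let `s` be a section of the tautological surjection onto `P` from a free module, and let
`J ⊆ P` be such that `s` maps `J` into the free module on `J`. Then the span of `J` is a retract
of `P`. -/
theorem exists_retraction_span {S P : Type*} [Ring S] [AddCommGroup P] [Module S P]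
    {s : P →ₗ[S] (P →₀ S)} (hs : Function.LeftInverse (Finsupp.linearCombination S id) s)
    {J : Set P} (hJ : ∀ q ∈ J, ↑(s q).support ⊆ J) :
    ∃ ρ : P →ₗ[S] P, (∀ x, ρ x ∈ Submodule.span S J) ∧ ∀ x ∈ Submodule.span S J, ρ x = x := by
  classical
  refine ⟨Finsupp.linearCombination S id ∘ₗ (Finsupp.supported S S J).subtype ∘ₗ
    Finsupp.restrictDom S S J ∘ₗ s, fun x ↦ ?_, fun x hx ↦ ?_⟩
  · have := Submodule.mem_map_of_mem (f := Finsupp.linearCombination S id)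
      (Finsupp.restrictDom S S J (s x)).2
    rwa [← Finsupp.span_image_eq_map_linearCombination, Set.image_id] at this
  · refine LinearMap.eqOn_span (g := LinearMap.id) (fun q hq ↦ ?_) hx
    have : ((s q).filter (· ∈ J)) = s q :=
      Finsupp.filter_eq_self_iff _ _ |>.mpr fun x hx ↦ hJ q hq (Finsupp.mem_support_iff.mpr hx)
    simp [this, hs q]

theorem Set.exists_countable_closed {α : Type*} (c : α → Set α) (hc : ∀ a, (c a).Countable)
    (a : α) : ∃ K : Set α, K.Countable ∧ a ∈ K ∧ ∀ b ∈ K, c b ⊆ K := by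
  let K (n : ℕ) : Set α := Nat.rec {a} (fun _ T ↦ ⋃ b ∈ T, c b) n
  have hK (n : ℕ) : (K n).Countable := by
    induction n with
    | zero => exact Set.countable_singleton a
    | succ n ih => exact ih.biUnion fun b _ ↦ hc b
  refine ⟨⋃ n, K n, Set.countable_iUnion hK, Set.mem_iUnion.mpr ⟨0, rfl⟩, fun b hb ↦ ?_⟩
  obtain ⟨n, hn⟩ := Set.mem_iUnion.mp hb
  exact (Set.subset_biUnion_of_mem (u := c) hn).trans (Set.subset_iUnion K (n + 1))

section Devissage

variable {R S M : Type*} [CommRing R] [CommRing S] [Algebra R S] [AddCommGroup M] [Module R M]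
  {s : S ⊗[R] M →ₗ[S] (S ⊗[R] M →₀ S)}

/-- Let `s` be a section of the tautological surjection onto `S ⊗[R] M` from a free module.
A submodule `N` of `M` is adapted to `s` if its base change is spanned by a set `J` such that
`s` maps `J` into the free module on `J`. -/
def IsAdapted (s : S ⊗[R] M →ₗ[S] (S ⊗[R] M →₀ S)) (N : Submodule R M) (J : Set (S ⊗[R] M)) :
    Prop :=
  (∀ q ∈ J, ↑(s q).support ⊆ J) ∧ Submodule.span S J = N.baseChange S

theorem IsAdapted.projective_quotient [Module.Flat R S] [Module.Projective S (S ⊗[R] M)]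
    (hs : Function.LeftInverse (Finsupp.linearCombination S id) s) {N N' : Submodule R M}
    {J J' : Set (S ⊗[R] M)} (h : IsAdapted s N J) (h' : IsAdapted s N' J') (hN : N ≤ N') :
    Module.Projective S (S ⊗[R] (N' ⧸ N.submoduleOf N')) := by
  obtain ⟨ρ, hρ, hρJ⟩ := exists_retraction_span hs h.1
  obtain ⟨ρ', hρ', hρJ'⟩ := exists_retraction_span hs h'.1
  rw [h.2] at hρ hρJ
  rw [h'.2] at hρ' hρJ'
  refine .of_retractions (ι := N'.subtype.baseChange S)
    (g := (N.submoduleOf N').mkQ.baseChange S)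
    (Module.Flat.lTensor_preserves_injective_linearMap _ (Submodule.subtype_injective _))
    (LinearMap.lTensor_surjective _ (Submodule.mkQ_surjective _))
    (ρ := ρ) (ρ' := ρ') (fun x ↦ ?_) (fun z hz ↦ ?_) hρ' (fun z ↦ hρJ' _ ⟨z, rfl⟩)
  · obtain ⟨y, hy⟩ := hρ x
    refine ⟨(Submodule.inclusion hN).baseChange S y, ?_, ?_⟩
    · rw [← LinearMap.comp_apply, ← LinearMap.baseChange_comp]
      have : (N.submoduleOf N').mkQ ∘ₗ Submodule.inclusion hN = 0 := by
        ext y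
        exact (Submodule.Quotient.mk_eq_zero _).mpr y.2
      simp [this]
    · rw [← LinearMap.comp_apply, ← LinearMap.baseChange_comp, Submodule.subtype_comp_inclusion,
        hy]
  · refine hρJ _ ?_
    obtain ⟨y, rfl⟩ := (lTensor_exact S (LinearMap.exact_subtype_mkQ (N.submoduleOf N'))
      (Submodule.mkQ_surjective _) z).mp hz
    clear hz
    induction y using TensorProduct.induction_on with
    | zero => simp
    | tmul a y => exact Submodule.tmul_mem_baseChange_of_mem a (show ((y : N') : M) ∈ N from y.2)
    | add x y hx hy => simpa using add_mem hx hy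

theorem IsAdapted.exists_le {N : Submodule R M} {J : Set (S ⊗[R] M)} (h : IsAdapted s N J)
    (x : M) : ∃ (G : Set M) (J' : Set (S ⊗[R] M)), G.Countable ∧ x ∈ G ∧
      IsAdapted s (N ⊔ Submodule.span R G) J' := by
  classical
  have hfin (q : S ⊗[R] M) : ∃ G : Finset M, q ∈ (Submodule.span R (G : Set M)).baseChange S := by
    induction q using TensorProduct.induction_on with
    | zero => exact ⟨∅, zero_mem _⟩
    | tmul a m =>
      exact ⟨{m}, Submodule.tmul_mem_baseChange_of_mem a (Submodule.subset_span (by simp))⟩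
    | add x y hx hy =>
      obtain ⟨G, hG⟩ := hx
      obtain ⟨H, hH⟩ := hy
      refine ⟨G ∪ H, add_mem
        (Submodule.baseChange_mono S (Submodule.span_mono (by simp)) hG)
        (Submodule.baseChange_mono S (Submodule.span_mono (by simp)) hH)⟩
  choose F hF using hfin
  obtain ⟨K, hK, hxK, hcl⟩ := Set.exists_countable_closed
    (fun q ↦ (↑(s q).support ∪ TensorProduct.mk R S M 1 '' F q : Set (S ⊗[R] M)))
    (fun q ↦ ((s q).support.countable_toSet).union ((F q).countable_toSet.image _))
    ((1 : S) ⊗ₜ[R] x)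
  have hG : ∀ m ∈ insert x (⋃ q ∈ K, (F q : Set M)), (1 : S) ⊗ₜ[R] m ∈ K := by
    rintro m (rfl | hm)
    · exact hxK
    · obtain ⟨q, hq, hm⟩ := Set.mem_iUnion₂.mp hm
      exact hcl q hq (Or.inr ⟨m, hm, rfl⟩)
  refine ⟨insert x (⋃ q ∈ K, (F q : Set M)), J ∪ K,
    (hK.biUnion fun q _ ↦ (F q).countable_toSet).insert x, Set.mem_insert _ _, ?_, ?_⟩
  · rintro q (hq | hq)
    · exact (h.1 q hq).trans Set.subset_union_left
    · exact (Set.subset_union_left.trans (hcl q hq)).trans Set.subset_union_right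
  · apply le_antisymm
    · rw [Submodule.span_union, h.2]
      refine sup_le (Submodule.baseChange_mono S le_sup_left) (Submodule.span_le.mpr fun q hq ↦ ?_)
      exact Submodule.baseChange_mono S (le_sup_of_le_right (Submodule.span_mono
        ((Set.subset_biUnion_of_mem (u := fun q ↦ (F q : Set M)) hq).trans
          (Set.subset_insert _ _)))) (hF q)
    · rw [Submodule.baseChange_eq_span, Submodule.span_le]
      rintro _ ⟨_, hnm, rfl⟩
      obtain ⟨n, hn, m, hm, rfl⟩ := Submodule.mem_sup.mp hnm
      rw [map_add]
      refine add_mem (Submodule.span_mono Set.subset_union_left ?_)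
        (Submodule.span_mono (Set.image_subset_iff.mpr hG |>.trans Set.subset_union_right) ?_)
      · exact h.2 ▸ Submodule.tmul_mem_baseChange_of_mem 1 hn
      · have := Submodule.tmul_mem_baseChange_of_mem (1 : S) hm
        rwa [Submodule.baseChange_span] at this

theorem IsAdapted.exists_sSup (c : Set (Submodule R M)) (h : ∀ N ∈ c, ∃ J, IsAdapted s N J) :
    ∃ J, IsAdapted s (sSup c) J := by
  choose! J hJ using h
  refine ⟨⋃ N ∈ c, J N, fun q hq ↦ ?_, ?_⟩
  · obtain ⟨N, hN, hq⟩ := Set.mem_iUnion₂.mp hq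
    exact ((hJ N hN).1 q hq).trans (Set.subset_biUnion_of_mem hN)
  · apply le_antisymm
    · refine Submodule.span_le.mpr (Set.iUnion₂_subset fun N hN ↦ ?_)
      rw [← Submodule.span_le, (hJ N hN).2]
      exact Submodule.baseChange_mono S (le_sSup hN)
    · have key : sSup c ≤ ((Submodule.span S (⋃ N ∈ c, J N)).restrictScalars R).comap
          (TensorProduct.mk R S M 1) := sSup_le fun N hN m hm ↦
        Submodule.span_mono (Set.subset_biUnion_of_mem hN)
          ((hJ N hN).2 ▸ Submodule.tmul_mem_baseChange_of_mem 1 hm)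
      rw [Submodule.baseChange_eq_span, Submodule.span_le]
      rintro _ ⟨m, hm, rfl⟩
      exact key hm

/-- A partial section of a surjection onto `M` extends along a projective quotient. -/
theorem LinearPMap.exists_extend_section {L : Type*} [AddCommGroup L] [Module R L] {π : L →ₗ[R] M}
    (hπ : Function.Surjective π) (f : M →ₗ.[R] L) (hf : ∀ z, π (f z) = z) {N' : Submodule R M}
    (hN : f.domain ≤ N') [Module.Projective R (N' ⧸ f.domain.submoduleOf N')] :
    ∃ f' : M →ₗ.[R] L, f ≤ f' ∧ f'.domain = N' ∧ ∀ z, π (f' z) = z := by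
  let q := (f.domain.submoduleOf N').mkQ
  obtain ⟨τ, hτ⟩ := q.exists_rightInverse_of_surjective (Submodule.range_mkQ _)
  obtain ⟨σ, hσ⟩ := Module.projective_lifting_property π (N'.subtype ∘ₗ τ) hπ
  let δ : N' →ₗ[R] N' := LinearMap.id - τ ∘ₗ q
  have hmem (z : N') : N'.subtype (δ z) ∈ f.domain := by
    have : q (δ z) = 0 := by
      have : q (τ (q z)) = q z := congr($hτ (q z))
      simp [δ, this]
    exact (Submodule.Quotient.mk_eq_zero (f.domain.submoduleOf N')).mp this
  let κ : N' →ₗ[R] f.domain :=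
    (N'.subtype ∘ₗ δ).codRestrict f.domain hmem
  refine ⟨⟨N', f.toFun ∘ₗ κ + σ ∘ₗ q⟩, ⟨hN, fun x y hxy ↦ ?_⟩, rfl, fun z ↦ ?_⟩
  · have hq : q y = 0 := (Submodule.Quotient.mk_eq_zero _).mpr (show (y : M) ∈ _ from hxy ▸ x.2)
    have hκ : κ y = x := Subtype.ext (by simp [κ, δ, hq, hxy])
    change f x = f (κ y) + σ (q y)
    simp [hq, hκ]
  · have h1 : π (σ (q z)) = τ (q z) := congr($hσ (q z))
    change π (f (κ z) + σ (q z)) = z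
    rw [LinearMap.map_add π, hf, h1]
    simp [κ, δ]

end Devissage

/-- **Faithfully flat descent of projectivity.** Let `R → S` be a faithfully flat map of
commutative rings and let `M` be an `R`-module.  If the `S`-module `S ⊗[R] M` is projective,
then `M` is a projective `R`-module. -/
theorem ffdescent_projectivity (R S : Type u) [CommRing R] [CommRing S] [Algebra R S]
    [Module.FaithfullyFlat R S] (M : Type u) [AddCommGroup M] [Module R M]
    (h : Module.Projective S (S ⊗[R] M)) : Module.Projective R M := by
  obtain ⟨s, hs⟩ := Module.projective_def.mp h
  let π : (M →₀ R) →ₗ[R] M := Finsupp.linearCombination R id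
  have hπ : Function.Surjective π := Finsupp.linearCombination_surjective _ Function.surjective_id
  obtain ⟨f, hf⟩ := zorn_le₀
    {f : M →ₗ.[R] (M →₀ R) | (∀ z, π (f z) = z) ∧ ∃ J, IsAdapted s f.domain J} fun c hc hchain ↦ by
      refine ⟨LinearPMap.sSup c hchain.directedOn, ⟨fun z ↦ ?_, ?_⟩,
        fun f hf ↦ LinearPMap.le_sSup _ hf⟩
      · rcases c.eq_empty_or_nonempty with rfl | hne
        · have hz : z = 0 := Subtype.ext (by simpa [LinearPMap.domain_sSup] using z.2)
          simp [hz]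
        · obtain ⟨f, hf, hz⟩ := (LinearPMap.mem_domain_sSup_iff hne hchain.directedOn).mp z.2
          rw [← (LinearPMap.le_sSup hchain.directedOn hf).2 (x := ⟨z, hz⟩) rfl]
          exact (hc hf).1 _
      · rw [LinearPMap.domain_sSup]
        exact IsAdapted.exists_sSup _ (Set.forall_mem_image.mpr fun f hf ↦ (hc hf).2)
  obtain ⟨⟨hfπ, J, hJ⟩, hmax⟩ := hf
  have htop (x : M) : x ∈ f.domain := by
    obtain ⟨G, J', hG, hxG, hJ'⟩ := hJ.exists_le x
    let N' := f.domain ⊔ Submodule.span R G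
    have hN : f.domain ≤ N' := le_sup_left
    have hGN : G ⊆ N' := Submodule.subset_span.trans (SetLike.coe_subset_coe.mpr le_sup_right)
    have := hJ.projective_quotient hs hJ' hN
    let q := (f.domain.submoduleOf N').mkQ
    have : Module.Projective R (N' ⧸ f.domain.submoduleOf N') := by
      refine .of_faithfullyFlat_of_countable R S
        (G := q '' (Subtype.val ⁻¹' G)) ((hG.preimage Subtype.val_injective).image _) ?_
      rw [eq_top_iff, ← Submodule.range_mkQ, LinearMap.range_eq_map, ← Submodule.map_span,
        Submodule.map_le_iff_le_comap, Submodule.comap_map_mkQ]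
      rintro ⟨z, hz⟩ -
      obtain ⟨a, ha, b, hb, rfl⟩ := Submodule.mem_sup.mp hz
      have hG' : N'.subtype '' (Subtype.val ⁻¹' G) = G :=
        Set.image_preimage_eq_of_subset (by simpa using hGN)
      have hb' : b ∈ (Submodule.span R (Subtype.val ⁻¹' G)).map N'.subtype := by
        rwa [Submodule.map_span, hG']
      obtain ⟨y, hy, rfl⟩ := hb'
      exact Submodule.mem_sup.mpr ⟨⟨a, hN ha⟩, ha, y, hy, rfl⟩
    obtain ⟨f', hff', hdom, hf'⟩ := f.exists_extend_section hπ hfπ hN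
    refine (hmax ⟨hf', J', by rwa [hdom]⟩ hff').1 ?_
    rw [hdom]
    exact hGN hxG
  exact ⟨f.toFun ∘ₗ LinearMap.id.codRestrict f.domain htop, fun x ↦ hfπ ⟨x, htop x⟩⟩
end

section
/- Let M be an R-module. Then M is projective if and only if the following three conditions hold: (1) M is flat; (2) M is Mittag-Leffler, i.e., for every family (Q_α)_{α∈A} of R-modules the canonical map M ⊗_R (∏_α Q_α) → ∏_α (M ⊗_R Q_α) is injective; (3) M is a direct sum of countably generated R-modules. -/
open TensorProduct

universe u

/-- An `R`-module `M` is *Mittag-Leffler* if for every family `(Q a)` of `R`-modules the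
canonical map `M ⊗[R] (∀ a, Q a) → ∀ a, M ⊗[R] Q a` is injective. -/
def Module.IsMittagLeffler (R M : Type u) [CommRing R] [AddCommGroup M] [Module R M] : Prop :=
  ∀ (A : Type u) (Q : A → Type u) [∀ a, AddCommGroup (Q a)] [∀ a, Module R (Q a)],
    Function.Injective (TensorProduct.piRightHom R R M Q)

theorem sSupIndep.insert {α : Type*} [CompleteLattice α] [IsModularLattice α] {s : Set α} {a : α}
    (hs : sSupIndep s) (ha : Disjoint (sSup s) a) : sSupIndep (insert a s) := by
  intro x hx
  by_cases hxa : x = a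
  · subst hxa
    refine ha.symm.mono_right (sSup_le_sSup ?_)
    rintro y ⟨rfl | hy, hne⟩
    · exact (hne rfl).elim
    · exact hy
  · have hxs : x ∈ s := hx.resolve_left hxa
    have hle : sSup (Insert.insert a s \ {x}) ≤ sSup (s \ {x}) ⊔ a := by
      refine sSup_le ?_
      rintro y ⟨rfl | hy, hne⟩
      · exact le_sup_right
      · exact le_sup_of_le_left (le_sSup ⟨hy, hne⟩)
    refine Disjoint.mono_right hle ?_
    refine Disjoint.disjoint_sup_right_of_disjoint_sup_left (hs hxs) (ha.mono_left ?_)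
    exact sup_le (le_sSup hxs) (sSup_le_sSup Set.sdiff_subset)

theorem Set.exists_countable_superset_forall_subset {α : Type*} (f : α → Set α)
    (hf : ∀ a, (f a).Countable) (x : α) :
    ∃ t : Set α, t.Countable ∧ x ∈ t ∧ ∀ a ∈ t, f a ⊆ t := by
  let T : ℕ → Set α := fun n ↦ Nat.rec {x} (fun _ s ↦ ⋃ a ∈ s, f a) n
  have hT : ∀ n, (T n).Countable := by
    intro n
    induction n with
    | zero => exact Set.countable_singleton x
    | succ n ih => exact ih.biUnion fun a _ ↦ hf a
  refine ⟨⋃ n, T n, Set.countable_iUnion hT, Set.mem_iUnion.2 ⟨0, rfl⟩, fun a ha ↦ ?_⟩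
  obtain ⟨n, hn⟩ := Set.mem_iUnion.1 ha
  exact (Set.subset_biUnion_of_mem (u := f) hn).trans (Set.subset_iUnion T (n + 1))

section SectionInvariant

variable {R M : Type*} [CommRing R] [AddCommGroup M] [Module R M]

/-- The span of a set `S` of elements whose images under a section of the canonical map
`(M →₀ R) → M` are supported in `S` is the image of an idempotent endomorphism. -/
theorem exists_projection_span_of_support_subset (s : M →ₗ[R] M →₀ R)
    (hs : Function.LeftInverse (Finsupp.linearCombination R id) s) {S : Set M}
    (hS : ∀ x ∈ S, ((s x).support : Set M) ⊆ S) :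
    ∃ q : M →ₗ[R] M, (∀ m, q m ∈ Submodule.span R S) ∧ ∀ m ∈ Submodule.span R S, q m = m := by
  classical
  have hspan : ∀ m ∈ Submodule.span R S, s m ∈ Finsupp.supported R R S := by
    intro m hm
    have : Submodule.span R S ≤ (Finsupp.supported R R S).comap s :=
      Submodule.span_le.2 fun x hx ↦ (Finsupp.mem_supported R (s x)).2 (hS x hx)
    exact this hm
  refine ⟨Finsupp.linearCombination R id ∘ₗ (Finsupp.supported R R S).subtype ∘ₗ
    Finsupp.restrictDom R R S ∘ₗ s, fun m ↦ ?_, fun m hm ↦ ?_⟩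
  · have := Finsupp.span_image_eq_map_linearCombination R (v := (id : M → M)) S
    rw [Set.image_id] at this
    rw [this]
    exact ⟨_, (Finsupp.restrictDom R R S (s m)).2, rfl⟩
  · have := LinearMap.congr_fun (Finsupp.restrictDom_comp_subtype (M := R) (R := R) S)
      ⟨s m, hspan m hm⟩
    have h2 : Finsupp.restrictDom R R S (s m) = ⟨s m, hspan m hm⟩ := this
    simp only [LinearMap.comp_apply, h2]
    exact hs m

end SectionInvariant

/-- **Kaplansky's theorem**: a projective module is a direct sum of countably generated
submodules. -/
theorem Module.Projective.exists_sSupIndep_countably_generated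
    (R M : Type*) [CommRing R] [AddCommGroup M] [Module R M] [Module.Projective R M] :
    ∃ C : Set (Submodule R M), sSupIndep C ∧ sSup C = ⊤ ∧
      ∀ N ∈ C, ∃ t : Set M, t.Countable ∧ Submodule.span R t = N := by
  obtain ⟨s, hs⟩ := Module.projective_def.1 ‹Module.Projective R M›
  let good : Set (Set M × Set (Submodule R M)) := {p | (∀ x ∈ p.1, ((s x).support : Set M) ⊆ p.1) ∧
    sSupIndep p.2 ∧ sSup p.2 = Submodule.span R p.1 ∧
      ∀ N ∈ p.2, ∃ t : Set M, t.Countable ∧ Submodule.span R t = N}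
  obtain ⟨⟨S, C⟩, ⟨hS, hC, hCS, hcount⟩, hmax⟩ : ∃ p, Maximal (· ∈ good) p := by
    refine zorn_le₀ good fun c hc hchain ↦ ?_
    refine ⟨(⋃ p : c, p.1.1, ⋃ p : c, p.1.2), ⟨?_, ?_, ?_, ?_⟩, fun z hz ↦ ⟨?_, ?_⟩⟩
    · intro x hx
      obtain ⟨p, hp⟩ := Set.mem_iUnion.1 hx
      exact ((hc p.2).1 x hp).trans (Set.subset_iUnion (fun p : c ↦ p.1.1) p)
    · refine sSupIndep_iUnion_of_directed ?_ fun p ↦ (hc p.2).2.1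
      intro p q
      rcases hchain.total p.2 q.2 with h | h
      · exact ⟨q, h.2, subset_rfl⟩
      · exact ⟨p, subset_rfl, h.2⟩
    · rw [sSup_iUnion, Submodule.span_iUnion]
      exact iSup_congr fun p ↦ (hc p.2).2.2.1
    · intro N hN
      obtain ⟨p, hp⟩ := Set.mem_iUnion.1 hN
      exact (hc p.2).2.2.2 N hp
    · exact Set.subset_iUnion (fun p : c ↦ p.1.1) ⟨z, hz⟩
    · exact Set.subset_iUnion (fun p : c ↦ p.1.2) ⟨z, hz⟩
  suffices hSuniv : S = Set.univ from
    ⟨C, hC, by rw [hCS, hSuniv, Submodule.span_univ], hcount⟩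
  refine Set.eq_univ_of_forall fun x ↦ ?_
  obtain ⟨T, hTc, hxT, hT⟩ := Set.exists_countable_superset_forall_subset
    (fun y ↦ ((s y).support : Set M)) (fun y ↦ (s y).support.countable_toSet) x
  obtain ⟨q, hq, hq'⟩ := exists_projection_span_of_support_subset s hs hS
  let D : Submodule R M := (Submodule.span R T).map (LinearMap.id - q)
  have hdisj : Disjoint (sSup C) D := by
    rw [hCS, Submodule.disjoint_def]
    rintro _ hd ⟨m, -, rfl⟩
    rw [← hq' _ hd]
    simp [hq' _ (hq m)]
  have hsup : sSup (insert D C) = Submodule.span R (S ∪ T) := by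
    rw [sSup_insert, hCS, Submodule.span_union]
    refine le_antisymm (sup_le ?_ le_sup_left) (sup_le le_sup_right fun m hm ↦ ?_)
    · rintro _ ⟨m, hm, rfl⟩
      exact sub_mem (Submodule.mem_sup_right hm) (Submodule.mem_sup_left (hq m))
    · rw [← sub_add_cancel m (q m)]
      exact add_mem (Submodule.mem_sup_left ⟨m, hm, rfl⟩) (Submodule.mem_sup_right (hq m))
  have hgood : (S ∪ T, insert D C) ∈ good := by
    refine ⟨?_, hC.insert hdisj, hsup, ?_⟩
    · rintro y (hy | hy)
      · exact (hS y hy).trans Set.subset_union_left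
      · exact (hT y hy).trans Set.subset_union_right
    · rintro N (rfl | hN)
      · exact ⟨_, hTc.image _, Submodule.span_image _⟩
      · exact hcount N hN
  exact (hmax hgood ⟨Set.subset_union_left, Set.subset_insert D C⟩).1 (Or.inr hxT)

namespace Module.IsMittagLeffler

variable {R M N : Type u} [CommRing R] [AddCommGroup M] [Module R M] [AddCommGroup N] [Module R N]

theorem of_retract (h : IsMittagLeffler R M) (i : N →ₗ[R] M) (r : M →ₗ[R] N)
    (hri : r ∘ₗ i = LinearMap.id) : IsMittagLeffler R N := by
  intro A Q _ _
  have hnat : ∀ z : N ⊗[R] (∀ a, Q a), ∀ a,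
      piRightHom R R M Q (i.rTensor _ z) a = i.rTensor _ (piRightHom R R N Q z a) := by
    intro z a
    induction z with
    | zero => simp
    | tmul x f => simp
    | add x y hx hy => simp [hx, hy]
  have hinj : Function.Injective (i.rTensor (∀ a, Q a)) := by
    refine Function.LeftInverse.injective (g := r.rTensor _) fun z ↦ ?_
    rw [← LinearMap.comp_apply, ← LinearMap.rTensor_comp, hri, LinearMap.rTensor_id,
      LinearMap.id_apply]
  intro z w hzw
  refine hinj (h A Q (funext fun a ↦ ?_))
  rw [hnat, hnat, hzw]

theorem finsupp (R X : Type u) [CommRing R] : IsMittagLeffler R (X →₀ R) := by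
  classical
  intro A Q _ _
  have hnat : ∀ z : (X →₀ R) ⊗[R] (∀ a, Q a), ∀ a x,
      finsuppScalarLeft R (Q a) X (piRightHom R R (X →₀ R) Q z a) x =
        finsuppScalarLeft R (∀ a, Q a) X z x a := by
    intro z a x
    induction z with
    | zero => simp
    | tmul p f => simp
    | add z w hz hw => simp [hz, hw]
  intro z w hzw
  refine (finsuppScalarLeft R (∀ a, Q a) X).injective (Finsupp.ext fun x ↦ funext fun a ↦ ?_)
  rw [← hnat, ← hnat, hzw]

theorem of_projective [Module.Projective R M] : IsMittagLeffler R M := by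
  obtain ⟨s, hs⟩ := Module.projective_def'.1 ‹Module.Projective R M›
  exact (finsupp R M).of_retract s _ hs

/-- A map `t` from a finite free module, through which a map `u` to a flat Mittag-Leffler module
factors, can be chosen to factor through every other map through finite free modules with this
property. -/
theorem exists_stable_factorization [Module.Flat R M] (h : IsMittagLeffler R M) {n : ℕ}
    (u : (Fin n → R) →ₗ[R] M) :
    ∃ (k : ℕ) (t : (Fin n → R) →ₗ[R] (Fin k → R)) (v : (Fin k → R) →ₗ[R] M), v ∘ₗ t = u ∧
      ∀ (l : ℕ) (a : (Fin n → R) →ₗ[R] (Fin l → R)) (y : (Fin l → R) →ₗ[R] M), y ∘ₗ a = u →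
        ∃ c : (Fin l → R) →ₗ[R] (Fin k → R), c ∘ₗ a = t := by
  classical
  let A : Type u := Σ l : ℕ, {a : (Fin n → R) →ₗ[R] (Fin l → R) //
    ∃ y : (Fin l → R) →ₗ[R] M, y ∘ₗ a = u}
  let col : ∀ α : A, Fin α.1 → Fin n → R := fun α j i ↦ α.2.1 (Pi.single i 1) j
  let W : ∀ α : A, Submodule R (Fin n → R) := fun α ↦ Submodule.span R (Set.range (col α))
  let Q : A → Type u := fun α ↦ (Fin n → R) ⧸ W α
  let q : Fin n → ∀ α, Q α := fun i α ↦ (W α).mkQ (Pi.single i 1)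
  let x : Fin n → M := fun i ↦ u (Pi.single i 1)
  have hcomb : ∀ (α : A) (w : Fin n → R), ∑ i, w i • q i α = (W α).mkQ w := by
    intro α w
    simp only [q, ← map_smul, ← map_sum]
    congr 1
    exact (pi_eq_sum_univ' w).symm
  have hzero : ∀ α, ∑ i, x i ⊗ₜ[R] q i α = 0 := by
    intro α
    obtain ⟨y, hy⟩ := α.2.2
    have hx : ∀ i, x i = ∑ j, col α j i • y (Pi.single j 1) := by
      intro i
      simp only [x, ← hy, LinearMap.comp_apply, col, ← map_smul, ← map_sum]
      congr 1
      exact pi_eq_sum_univ' _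
    simp_rw [hx, sum_tmul, smul_tmul]
    rw [Finset.sum_comm]
    simp_rw [← tmul_sum, hcomb]
    refine Finset.sum_eq_zero fun j _ ↦ ?_
    have : (W α).mkQ (col α j) = 0 := by
      simpa using (Submodule.subset_span ⟨j, rfl⟩ : col α j ∈ W α)
    rw [this, tmul_zero]
  have hsum : ∑ i, x i ⊗ₜ[R] q i = 0 := by
    refine h A Q ?_
    rw [map_sum, map_zero]
    ext α
    simpa using hzero α
  have hsum' : ∑ i, q i ⊗ₜ[R] x i = 0 := by
    simpa using congrArg (TensorProduct.comm R M (∀ α, Q α)) hsum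
  obtain ⟨k, b, z, hxz, hbq⟩ := vanishesTrivially_of_sum_tmul_eq_zero_of_rTensor_injective R
    (Module.Flat.rTensor_preserves_injective_linearMap _ (Submodule.subtype_injective _)) hsum'
  refine ⟨k, Fintype.linearCombination R b, Fintype.linearCombination R z, ?_, ?_⟩
  · refine LinearMap.pi_ext' fun i ↦ LinearMap.ext_ring ?_
    simp only [LinearMap.comp_apply, LinearMap.single_apply]
    rw [Fintype.linearCombination_apply_single, one_smul, Fintype.linearCombination_apply]
    exact (hxz i).symm
  · intro l a y hy
    have hmem : ∀ j, (fun i ↦ b i j) ∈ W ⟨l, a, y, hy⟩ := by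
      intro j
      have := congrFun (hbq j) ⟨l, a, y, hy⟩
      rw [Finset.sum_apply] at this
      simp only [Pi.smul_apply, hcomb, Pi.zero_apply] at this
      exact (Submodule.Quotient.mk_eq_zero _).1 this
    choose c hc using fun j ↦ (Submodule.mem_span_range_iff_exists_fun R).1 (hmem j)
    refine ⟨Fintype.linearCombination R fun m j ↦ c j m, ?_⟩
    refine LinearMap.pi_ext' fun i ↦ LinearMap.ext_ring (funext fun j ↦ ?_)
    have := congrFun (hc j) i
    simp only [Finset.sum_apply, Pi.smul_apply, smul_eq_mul, col] at this
    simp only [LinearMap.comp_apply, LinearMap.single_apply]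
    rw [Fintype.linearCombination_apply_single, one_smul, Fintype.linearCombination_apply, ← this]
    simp only [Finset.sum_apply, Pi.smul_apply, smul_eq_mul, mul_comm]

end Module.IsMittagLeffler

/-- A compatible family of maps from a sequence `F n` extends to a module `M` that is exhausted by
compatible maps `u n` from `F n`, provided each of them kills the kernel of `u n`. -/
theorem LinearMap.exists_comp_eq_of_sequence {R M L : Type*} [CommRing R] [AddCommGroup M]
    [Module R M] [AddCommGroup L] [Module R L] {F : ℕ → Type*} [∀ n, AddCommGroup (F n)]
    [∀ n, Module R (F n)] (u : ∀ n, F n →ₗ[R] M) (w : ∀ n, F n →ₗ[R] L)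
    (t : ∀ n, F n →ₗ[R] F (n + 1)) (hu : ∀ n, u (n + 1) ∘ₗ t n = u n)
    (hw : ∀ n, w (n + 1) ∘ₗ t n = w n) (hker : ∀ n f, u n f = 0 → w n f = 0)
    (hsurj : ∀ m, ∃ n, m ∈ LinearMap.range (u n)) :
    ∃ s : M →ₗ[R] L, ∀ n, s ∘ₗ u n = w n := by
  let g : ∀ n, Submodule R (M × L) := fun n ↦ LinearMap.range ((u n).prod (w n))
  have hg : Monotone g := by
    refine monotone_nat_of_le_succ fun n ↦ ?_
    rintro _ ⟨f, rfl⟩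
    exact ⟨t n f, Prod.ext (LinearMap.congr_fun (hu n) f) (LinearMap.congr_fun (hw n) f)⟩
  let G : Submodule R (M × L) := ⨆ n, g n
  have hG : ∀ z, z ∈ G ↔ ∃ n, z ∈ g n := fun z ↦
    Submodule.mem_iSup_of_directed g hg.directed_le
  have hmem : ∀ n f, (u n f, w n f) ∈ G := fun n f ↦ (hG _).2 ⟨n, f, rfl⟩
  let p : G →ₗ[R] M := LinearMap.fst R M L ∘ₗ G.subtype
  have hp : Function.Bijective p := by
    constructor
    · refine (injective_iff_map_eq_zero p).2 ?_
      rintro ⟨z, hz⟩ h0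
      obtain ⟨n, f, rfl⟩ := (hG z).1 hz
      have h0 : u n f = 0 := h0
      exact Subtype.ext (Prod.ext h0 (hker n f h0))
    · intro m
      obtain ⟨n, f, rfl⟩ := hsurj m
      exact ⟨⟨_, hmem n f⟩, rfl⟩
  let e := LinearEquiv.ofBijective p hp
  refine ⟨LinearMap.snd R M L ∘ₗ G.subtype ∘ₗ e.symm.toLinearMap, fun n ↦ LinearMap.ext fun f ↦ ?_⟩
  have : e.symm (u n f) = ⟨_, hmem n f⟩ := e.symm_apply_eq.2 rfl
  simp [this]

/-- A flat Mittag-Leffler module generated by a sequence is the colimit of a sequence of finite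
free modules in which each map factors through every factorization, through finite free modules,
of the corresponding structure map. -/
theorem Module.IsMittagLeffler.exists_stable_sequence {R M : Type u} [CommRing R] [AddCommGroup M]
    [Module R M] [Module.Flat R M] (h : Module.IsMittagLeffler R M) (x : ℕ → M) :
    ∃ (k : ℕ → ℕ) (u : ∀ n, (Fin (k n) → R) →ₗ[R] M)
      (t : ∀ n, (Fin (k n) → R) →ₗ[R] (Fin (k (n + 1)) → R)),
      (∀ n, u (n + 1) ∘ₗ t n = u n) ∧ (∀ n, x n ∈ LinearMap.range (u (n + 1))) ∧
      ∀ n l (a : (Fin (k n) → R) →ₗ[R] (Fin l → R)) (y : (Fin l → R) →ₗ[R] M), y ∘ₗ a = u n →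
        ∃ c : (Fin l → R) →ₗ[R] (Fin (k (n + 1)) → R), c ∘ₗ a = t n := by
  have step : ∀ (m : M) (U : Σ k : ℕ, (Fin k → R) →ₗ[R] M),
      ∃ (V : Σ k : ℕ, (Fin k → R) →ₗ[R] M) (t : (Fin U.1 → R) →ₗ[R] (Fin V.1 → R)),
        V.2 ∘ₗ t = U.2 ∧ m ∈ LinearMap.range V.2 ∧
        ∀ l (a : (Fin U.1 → R) →ₗ[R] (Fin l → R)) (y : (Fin l → R) →ₗ[R] M), y ∘ₗ a = U.2 →
          ∃ c : (Fin l → R) →ₗ[R] (Fin V.1 → R), c ∘ₗ a = t := by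
    rintro m ⟨k, u⟩
    let e : ∀ l, ((Fin l → R) × (Fin 1 → R)) ≃ₗ[R] (Fin (l + 1) → R) := fun l ↦
      (LinearEquiv.sumArrowLequivProdArrow (Fin l) (Fin 1) R R).symm ≪≫ₗ
        LinearEquiv.funCongrLeft R R finSumFinEquiv.symm
    let g : (Fin 1 → R) →ₗ[R] M := Fintype.linearCombination R fun _ ↦ m
    obtain ⟨k', t, v, hvt, ht⟩ :=
      h.exists_stable_factorization (u.coprod g ∘ₗ (e k).symm.toLinearMap)
    have hvt' : ∀ z, v (t (e k z)) = u z.1 + g z.2 := fun z ↦ by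
      simpa using LinearMap.congr_fun hvt (e k z)
    refine ⟨⟨k', v⟩, t ∘ₗ (e k).toLinearMap ∘ₗ LinearMap.inl R _ _, ?_, ?_, ?_⟩
    · refine LinearMap.ext fun f ↦ ?_
      simpa using hvt' (f, 0)
    · refine ⟨t (e k (0, 1)), ?_⟩
      simp [hvt', g, Fintype.linearCombination_apply]
    · intro l a y hy
      obtain ⟨c, hc⟩ := ht (l + 1)
        ((e l).toLinearMap ∘ₗ a.prodMap LinearMap.id ∘ₗ (e k).symm.toLinearMap)
        (y.coprod g ∘ₗ (e l).symm.toLinearMap) (by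
          refine LinearMap.ext fun f ↦ ?_
          simpa using LinearMap.congr_fun hy ((e k).symm f).1)
      refine ⟨c ∘ₗ (e l).toLinearMap ∘ₗ LinearMap.inl R _ _, LinearMap.ext fun f ↦ ?_⟩
      simpa using LinearMap.congr_fun hc (e k (f, 0))
  choose V t hVt hmem hstab using step
  let U : ℕ → Σ k : ℕ, (Fin k → R) →ₗ[R] M := fun n ↦ Nat.rec ⟨0, 0⟩ (fun n W ↦ V (x n) W) n
  exact ⟨fun n ↦ (U n).1, fun n ↦ (U n).2, fun n ↦ t (x n) (U n), fun n ↦ hVt (x n) (U n),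
    fun n ↦ hmem (x n) (U n), fun n ↦ hstab (x n) (U n)⟩

theorem Module.IsMittagLeffler.projective_of_countable {R M : Type u} [CommRing R] [AddCommGroup M]
    [Module R M] [Module.Flat R M] (h : Module.IsMittagLeffler R M)
    (hM : ∃ s : Set M, s.Countable ∧ Submodule.span R s = ⊤) : Module.Projective R M := by
  obtain ⟨s, hs, hspan⟩ := hM
  obtain ⟨x, hx⟩ : ∃ x : ℕ → M, s ⊆ Set.range x := Set.countable_iff_exists_subset_range.1 hs
  obtain ⟨k, u, t, hut, hxu, hstab⟩ := h.exists_stable_sequence x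
  have hmono : Monotone fun n ↦ LinearMap.range (u n) :=
    monotone_nat_of_le_succ fun n ↦ by
      rw [← hut n]
      exact LinearMap.range_comp_le_range _ _
  have hsurj : ∀ m, ∃ n, m ∈ LinearMap.range (u n) := by
    intro m
    rw [← Submodule.mem_iSup_of_directed _ hmono.directed_le]
    have : (⊤ : Submodule R M) ≤ ⨆ n, LinearMap.range (u n) := by
      rw [← hspan, Submodule.span_le]
      intro y hy
      obtain ⟨n, rfl⟩ := hx hy
      exact Submodule.mem_iSup_of_mem (n + 1) (hxu n)
    exact this trivial
  have htker : ∀ n f, u n f = 0 → t n f = 0 := by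
    intro n f hf
    obtain ⟨l, a, y, hya, haf⟩ := Module.Flat.exists_factorization_of_apply_eq_zero_of_free hf
    let e := Finsupp.linearEquivFunOnFinite R R (Fin l)
    obtain ⟨c, hc⟩ := hstab n l (e.toLinearMap ∘ₗ a) (y ∘ₗ e.symm.toLinearMap) (by
      rw [hya]; ext; simp)
    rw [← hc]
    simp [haf]
  let p : (M →₀ R) →ₗ[R] M := Finsupp.linearCombination R id
  have hp : Function.Surjective p := Finsupp.linearCombination_id_surjective R M
  have hlift : ∀ n, ∃ v : (Fin (k n) → R) →ₗ[R] (M →₀ R), p ∘ₗ v = u n := fun n ↦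
    Module.projective_lifting_property p (u n) hp
  have hnext : ∀ n (w : {v : (Fin (k (n + 1)) → R) →ₗ[R] (M →₀ R) // p ∘ₗ v = u (n + 1)}),
      ∃ w' : {v : (Fin (k (n + 2)) → R) →ₗ[R] (M →₀ R) // p ∘ₗ v = u (n + 2)},
        w'.1 ∘ₗ t (n + 1) ∘ₗ t n = w.1 ∘ₗ t n := by
    rintro n ⟨w, hw⟩
    obtain ⟨v, hv⟩ := hlift (n + 2)
    obtain ⟨c, hc⟩ := hstab n _ (t (n + 1) ∘ₗ t n) (u (n + 2)) (by
      rw [← LinearMap.comp_assoc, hut, hut])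
    refine ⟨⟨v + (w - v ∘ₗ t (n + 1)) ∘ₗ c, ?_⟩, ?_⟩
    · rw [LinearMap.comp_add, ← LinearMap.comp_assoc, LinearMap.comp_sub, ← LinearMap.comp_assoc,
        hv, hw, hut, sub_self, LinearMap.zero_comp, add_zero]
    · rw [LinearMap.add_comp, LinearMap.comp_assoc, hc, LinearMap.sub_comp, LinearMap.comp_assoc]
      exact add_sub_cancel (v ∘ₗ t (n + 1) ∘ₗ t n) (w ∘ₗ t n)
  choose next hnext using hnext
  obtain ⟨w₀, hw₀⟩ := hlift 1
  let w : ∀ n, {v : (Fin (k (n + 1)) → R) →ₗ[R] (M →₀ R) // p ∘ₗ v = u (n + 1)} := fun n ↦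
    Nat.rec ⟨w₀, hw₀⟩ (fun n v ↦ next n v) n
  obtain ⟨σ, hσ⟩ := LinearMap.exists_comp_eq_of_sequence u (fun n ↦ (w n).1 ∘ₗ t n) t hut
    (fun n ↦ hnext n (w n)) (fun n f hf ↦ by simp [htker n f hf]) hsurj
  refine Module.Projective.of_split σ p (LinearMap.ext fun m ↦ ?_)
  obtain ⟨n, f, rfl⟩ := hsurj m
  have h1 := LinearMap.congr_fun (hσ n) f
  have h2 := LinearMap.congr_fun (w n).2 (t n f)
  have h3 := LinearMap.congr_fun (hut n) f
  simp only [LinearMap.comp_apply] at h1 h2 h3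
  simp only [LinearMap.comp_apply, LinearMap.id_apply, h1, h2, h3]

/-- **Characterization of projective modules.** An `R`-module `M` is projective if and only if
it is flat, Mittag-Leffler, and an (internal) direct sum of countably generated submodules. -/
theorem projective_iff_flat_mittagLeffler_directSum_countablyGenerated
    (R M : Type u) [CommRing R] [AddCommGroup M] [Module R M] :
    Module.Projective R M ↔
      Module.Flat R M ∧ Module.IsMittagLeffler R M ∧
        ∃ (ι : Type u) (_ : DecidableEq ι) (N : ι → Submodule R M),
          DirectSum.IsInternal N ∧
          ∀ i, ∃ s : Set M, s.Countable ∧ Submodule.span R s = N i := by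
  classical
  constructor
  · intro hM
    obtain ⟨C, hC, hsup, hcount⟩ := Module.Projective.exists_sSupIndep_countably_generated R M
    refine ⟨inferInstance, Module.IsMittagLeffler.of_projective, C, inferInstance, Subtype.val,
      ?_, fun i ↦ hcount i i.2⟩
    exact DirectSum.isInternal_submodule_of_iSupIndep_of_iSup_eq_top ((sSupIndep_iff C).1 hC)
      (by rw [← sSup_eq_iSup', hsup])
  · rintro ⟨hflat, hML, ι, _, N, hN, hcount⟩
    let e : (DirectSum ι fun i ↦ N i) ≃ₗ[R] M :=
      LinearEquiv.ofBijective (DirectSum.coeLinearMap N) hN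
    have hproj : ∀ i, Module.Projective R (N i) := by
      intro i
      have hretract : (DirectSum.component R ι (fun i ↦ N i) i ∘ₗ e.symm.toLinearMap) ∘ₗ
          (N i).subtype = LinearMap.id := by
        refine LinearMap.ext fun x ↦ ?_
        have : e.symm x = DirectSum.lof R ι (fun i ↦ N i) i x :=
          e.symm_apply_eq.2 (DirectSum.coeLinearMap_lof N i x).symm
        simp [this, DirectSum.component.lof_self]
      have := Module.Flat.of_retract _ _ hretract
      refine (hML.of_retract _ _ hretract).projective_of_countable ?_
      obtain ⟨s, hs, hspan⟩ := hcount i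
      refine ⟨Subtype.val ⁻¹' s, hs.preimage Subtype.val_injective, ?_⟩
      rw [← hspan]
      exact Submodule.span_span_coe_preimage
    exact Module.Projective.of_equiv e
end

section
/- If P is a projective R-module, then P is a direct sum of countably generated projective R-modules, i.e., there is a family (P_i)_{i∈I} of countably generated projective R-modules with P ≅ ⊕_{i∈I} P_i. -/
universe u

/-- If every element `a` comes with a countable set `f a`, then each element lies in a countable
set which is closed under `f`. -/
theorem Set.exists_countable_forall_subset {α : Type*} (f : α → Set α)
    (hf : ∀ a, (f a).Countable) (a : α) :
    ∃ C : Set α, C.Countable ∧ a ∈ C ∧ ∀ x ∈ C, f x ⊆ C := by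
  let g : Set α → Set α := fun T ↦ ⋃ x ∈ T, f x
  refine ⟨⋃ n : ℕ, g^[n] {a}, Set.countable_iUnion fun n ↦ ?_,
    Set.mem_iUnion.2 ⟨0, rfl⟩, fun x hx y hy ↦ ?_⟩
  · induction n with
    | zero => exact Set.countable_singleton a
    | succ n ih =>
      rw [Function.iterate_succ_apply']
      exact ih.biUnion fun x _ ↦ hf x
  · obtain ⟨n, hn⟩ := Set.mem_iUnion.1 hx
    refine Set.mem_iUnion.2 ⟨n + 1, ?_⟩
    rw [Function.iterate_succ_apply']
    exact Set.mem_biUnion hn hy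

section

variable {R M : Type*} [Ring R] [AddCommGroup M] [Module R M]

/-- If `s` is a section of `Finsupp.linearCombination R id` and the supports of `s x`, for `x ∈ S`,
are contained in `S`, then the span of `S` is the image of a projection. -/
theorem Submodule.exists_isProj_span (s : M →ₗ[R] M →₀ R)
    (hs : Function.LeftInverse (Finsupp.linearCombination R id) s) {S : Set M}
    (hS : ∀ x ∈ S, ((s x).support : Set M) ⊆ S) :
    ∃ r : M →ₗ[R] M, LinearMap.IsProj (Submodule.span R S) r := by
  classical
  let r : M →ₗ[R] M := Finsupp.linearCombination R id ∘ₗ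
    (Finsupp.supported R R S).subtype ∘ₗ Finsupp.restrictDom R R S ∘ₗ s
  refine ⟨r, fun x ↦ ?_, fun x hx ↦ ?_⟩
  · have := Finsupp.mem_span_image_iff_linearCombination R (v := (id : M → M)) (s := S)
      (x := r x)
    rw [Set.image_id] at this
    exact this.2 ⟨_, (Finsupp.restrictDom R R S (s x)).2, rfl⟩
  · refine LinearMap.eqOn_span (f := r) (g := LinearMap.id) (fun y hy ↦ ?_) hx
    have h : Finsupp.filter (· ∈ S) (s y) = s y :=
      Finsupp.filter_eq_self_iff _ _ |>.2 fun z hz ↦ hS y hy (by simpa using hz)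
    simp only [r, LinearMap.comp_apply, Submodule.subtype_apply, Finsupp.restrictDom_apply, h,
      LinearMap.id_apply, hs y]

/-- A direct summand of a projective module is projective. -/
theorem LinearMap.IsProj.projective [Module.Projective R M] {N : Submodule R M} {r : M →ₗ[R] M}
    (hr : LinearMap.IsProj N r) : Module.Projective R N :=
  .of_split N.subtype hr.codRestrict (LinearMap.ext hr.codRestrict_apply_cod)

section WellOrderedFiltration

variable {ι : Type*} [LinearOrder ι] {Q : ι → Submodule R M} {r : ι → M →ₗ[R] M}

theorem LinearMap.IsProj.map_id_sub_le_biSup_Iic {i : ι} {r : M →ₗ[R] M}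
    (hr : LinearMap.IsProj (⨆ j ∈ Set.Iio i, Q j) r) :
    (Q i).map (LinearMap.id - r) ≤ ⨆ j ∈ Set.Iic i, Q j := by
  rintro _ ⟨y, hy, rfl⟩
  exact sub_mem (Submodule.mem_iSup_of_mem i (Submodule.mem_iSup_of_mem Set.self_mem_Iic hy))
    (SetLike.le_def.1 (biSup_mono fun j hj ↦ Set.Iio_subset_Iic_self hj) (hr.map_mem y))

theorem LinearMap.IsProj.map_eq_zero_of_mem_map_id_sub {N Q : Submodule R M} {r : M →ₗ[R] M}
    (hr : LinearMap.IsProj N r) {x : M} (hx : x ∈ Q.map (LinearMap.id - r)) : r x = 0 := by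
  obtain ⟨y, -, rfl⟩ := hx
  simp [hr.map_id _ (hr.map_mem y)]

theorem LinearMap.IsProj.iSupIndep_map_id_sub
    (hr : ∀ i, LinearMap.IsProj (⨆ j ∈ Set.Iio i, Q j) (r i)) :
    iSupIndep fun i ↦ (Q i).map (LinearMap.id - r i) := by
  classical
  rw [iSupIndep_iff_finsetSum_eq_zero_imp_eq_zero]
  intro s v hv hsum
  by_contra! hne
  have hne' : (s.filter (v · ≠ 0)).Nonempty := by
    obtain ⟨i, hi, hi0⟩ := hne
    exact ⟨i, Finset.mem_filter.2 ⟨hi, hi0⟩⟩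
  set m := (s.filter (v · ≠ 0)).max' hne'
  obtain ⟨hms, hm0⟩ := Finset.mem_filter.1 ((s.filter (v · ≠ 0)).max'_mem hne')
  have hlow : ∑ i ∈ s.erase m, v i ∈ ⨆ j ∈ Set.Iio m, Q j := by
    refine sum_mem fun i hi ↦ ?_
    obtain ⟨him, his⟩ := Finset.mem_erase.1 hi
    by_cases hi0 : v i = 0
    · exact hi0 ▸ zero_mem _
    have hlt : i < m :=
      lt_of_le_of_ne (Finset.le_max' _ _ (Finset.mem_filter.2 ⟨his, hi0⟩)) him
    exact SetLike.le_def.1 (biSup_mono fun j hj ↦ lt_of_le_of_lt hj hlt)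
      ((hr i).map_id_sub_le_biSup_Iic (hv i his))
  have hvm : v m ∈ ⨆ j ∈ Set.Iio m, Q j := by
    rw [← Finset.add_sum_erase s v hms] at hsum
    rw [eq_neg_of_add_eq_zero_left hsum]
    exact neg_mem hlow
  exact hm0 (((hr m).map_id _ hvm).symm.trans
    ((hr m).map_eq_zero_of_mem_map_id_sub (hv m hms)))

theorem LinearMap.IsProj.iSup_map_id_sub [WellFoundedLT ι]
    (hr : ∀ i, LinearMap.IsProj (⨆ j ∈ Set.Iio i, Q j) (r i)) :
    ⨆ i, (Q i).map (LinearMap.id - r i) = ⨆ i, Q i := by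
  refine le_antisymm (iSup_le fun i ↦ (hr i).map_id_sub_le_biSup_Iic.trans
    (iSup₂_le fun j _ ↦ le_iSup Q j)) (iSup_le fun i ↦ ?_)
  induction i using WellFoundedLT.induction with
  | ind i ih =>
    intro x hx
    rw [← sub_add_cancel x (r i x)]
    exact add_mem (Submodule.mem_iSup_of_mem i ⟨x, hx, rfl⟩)
      (iSup₂_le (fun j hj ↦ ih j hj) ((hr i).map_mem x))

theorem LinearMap.IsProj.isProj_map_id_sub {i : ι} {r r' : M →ₗ[R] M}
    (hr : LinearMap.IsProj (⨆ j ∈ Set.Iio i, Q j) r)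
    (hr' : LinearMap.IsProj (⨆ j ∈ Set.Iic i, Q j) r') :
    LinearMap.IsProj ((Q i).map (LinearMap.id - r)) ((LinearMap.id - r) ∘ₗ r') := by
  refine ⟨fun x ↦ ?_, fun x hx ↦ ?_⟩
  · have hx := hr'.map_mem x
    rw [← Set.Iio_insert, iSup_insert] at hx
    obtain ⟨y, hy, z, hz, hyz⟩ := Submodule.mem_sup.1 hx
    refine ⟨y, hy, ?_⟩
    simp [← hyz, hr.map_id z hz]
  · have hx0 := hr.map_eq_zero_of_mem_map_id_sub hx
    have hxr : r' x = x := hr'.map_id x (hr.map_id_sub_le_biSup_Iic hx)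
    simp [hxr, hx0]

end WellOrderedFiltration

end

/-- **Kaplansky's theorem for projective modules.** If `P` is a projective `R`-module, then `P`
is an (internal) direct sum of countably generated projective `R`-modules. -/
theorem projective_eq_directSum_countablyGenerated_projective
    (R P : Type u) [CommRing R] [AddCommGroup P] [Module R P] (h : Module.Projective R P) :
    ∃ (ι : Type u) (_ : DecidableEq ι) (N : ι → Submodule R P),
      DirectSum.IsInternal N ∧
      (∀ i, ∃ s : Set P, s.Countable ∧ Submodule.span R s = N i) ∧
      ∀ i, Module.Projective R (N i) := by
  obtain ⟨s, hs⟩ := h.out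
  choose C hC_countable hC_self hC_closed using Set.exists_countable_forall_subset
    (fun x ↦ ((s x).support : Set P)) fun x ↦ (s x).support.countable_toSet
  let Q : P → Submodule R P := fun p ↦ Submodule.span R (C p)
  have hproj (J : Set P) : ∃ r : P →ₗ[R] P, LinearMap.IsProj (⨆ p ∈ J, Q p) r := by
    have hJ : ⨆ p ∈ J, Q p = Submodule.span R (⋃ p ∈ J, C p) :=
      (Submodule.span_iUnion₂ fun p (_ : p ∈ J) ↦ C p).symm
    rw [hJ]
    refine Submodule.exists_isProj_span s hs fun x hx ↦ ?_
    obtain ⟨p, hp, hxp⟩ := Set.mem_iUnion₂.1 hx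
    exact (hC_closed p x hxp).trans (Set.subset_biUnion_of_mem hp)
  choose r hr using hproj
  obtain ⟨_, _⟩ := exists_wellFoundedLT P
  have hIio (p : P) := hr (Set.Iio p)
  refine ⟨P, inferInstance, fun p ↦ (Q p).map (LinearMap.id - r (Set.Iio p)), ?_, fun p ↦ ?_,
    fun p ↦ ((hIio p).isProj_map_id_sub (hr (Set.Iic p))).projective⟩
  · refine DirectSum.isInternal_submodule_of_iSupIndep_of_iSup_eq_top
      (LinearMap.IsProj.iSupIndep_map_id_sub hIio) ?_
    rw [LinearMap.IsProj.iSup_map_id_sub hIio, eq_top_iff]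
    exact fun p _ ↦ Submodule.mem_iSup_of_mem p (Submodule.subset_span (hC_self p))
  · exact ⟨_, (hC_countable p).image _, Submodule.span_image _⟩
end

section
/- Suppose an R-module M is a direct sum of countably generated R-modules, i.e., M ≅ ⊕_{i∈I} N_i with each N_i countably generated. If P is a direct summand of M (i.e., M ≅ P ⊕ Q for some R-module Q), then P is also a direct sum of countably generated R-modules. -/
universe u

namespace CountablyGeneratedSummand

open DirectSum

/-- A family of submodules indexed by a linear order is independent as soon as each member is
killed by an endomorphism fixing all the earlier members. -/
theorem iSupIndep_of_fixes_lt {R P κ : Type*} [Ring R] [AddCommGroup P] [Module R P]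
    [LinearOrder κ] (T : κ → Submodule R P) (q : κ → P →ₗ[R] P)
    (hker : ∀ j, ∀ x ∈ T j, q j x = 0) (hfix : ∀ j, ∀ k < j, ∀ x ∈ T k, q j x = x) :
    iSupIndep T := by
  rw [iSupIndep_iff_finsetSum_eq_zero_imp_eq_zero]
  intro s
  induction s using Finset.induction_on_max with
  | empty => simp
  | insert a s hlt ih =>
    intro v hv hsum
    have ha : a ∉ s := fun h => lt_irrefl a (hlt a h)
    rw [Finset.sum_insert ha] at hsum
    have hs : ∑ i ∈ s, v i = 0 := by
      have h := congrArg (q a) hsum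
      rw [map_add, map_zero, hker a _ (hv a (Finset.mem_insert_self a s)), zero_add, map_sum] at h
      rw [← h]
      exact Finset.sum_congr rfl fun i hi =>
        (hfix a i (hlt i hi) _ (hv i (Finset.mem_insert_of_mem hi))).symm
    rw [hs, add_zero] at hsum
    intro i hi
    rcases Finset.mem_insert.1 hi with rfl | hi
    · exact hsum
    · exact ih v (fun i hi => hv i (Finset.mem_insert_of_mem hi)) hs i hi

/-- If `c` assigns countable sets to points, then every point lies in a countable set closed
under `c`. -/
theorem exists_countable_closed {ι : Type*} (c : ι → Set ι) (hc : ∀ j, (c j).Countable) (j : ι) :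
    ∃ S : Set ι, S.Countable ∧ j ∈ S ∧ ∀ a ∈ S, c a ⊆ S := by
  let A : ℕ → Set ι := fun n => Nat.rec {j} (fun _ B => ⋃ a ∈ B, c a) n
  have hA : ∀ n, (A n).Countable := by
    intro n
    induction n with
    | zero => exact Set.countable_singleton j
    | succ n ih => exact ih.biUnion fun a _ => hc a
  refine ⟨⋃ n, A n, Set.countable_iUnion hA, Set.mem_iUnion.2 ⟨0, rfl⟩, fun a ha => ?_⟩
  obtain ⟨n, hn⟩ := Set.mem_iUnion.1 ha
  exact (Set.subset_biUnion_of_mem (u := c) hn).trans (Set.subset_iUnion A (n + 1))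

section Supported

variable (R : Type*) [Ring R] {ι : Type*} [DecidableEq ι] (N : ι → Type*)
  [∀ i, AddCommGroup (N i)] [∀ i, Module R (N i)]

/-- The submodule of a direct sum generated by the summands with index in `S`. -/
def supported (S : Set ι) : Submodule R (⨁ i, N i) :=
  ⨆ j ∈ S, LinearMap.range (lof R ι N j)

open Classical in
/-- The projection of a direct sum onto the summands with index in `S`. -/
noncomputable def proj (S : Set ι) : (⨁ i, N i) →ₗ[R] ⨁ i, N i :=
  DFinsupp.filterLinearMap R N (· ∈ S)

variable {R N}

theorem lof_mem_supported {S : Set ι} {j : ι} (hj : j ∈ S) (x : N j) :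
    lof R ι N j x ∈ supported R N S :=
  Submodule.mem_iSup_of_mem j (Submodule.mem_iSup_of_mem hj ⟨x, rfl⟩)

theorem supported_le {S : Set ι} {K : Submodule R (⨁ i, N i)}
    (h : ∀ j ∈ S, ∀ x, lof R ι N j x ∈ K) : supported R N S ≤ K := by
  refine iSup₂_le fun j hj => ?_
  rintro _ ⟨x, rfl⟩
  exact h j hj x

theorem supported_mono {S S' : Set ι} (h : S ⊆ S') : supported R N S ≤ supported R N S' :=
  supported_le fun _ hj => lof_mem_supported (h hj)

theorem proj_lof_of_mem {S : Set ι} {j : ι} (hj : j ∈ S) (x : N j) :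
    proj R N S (lof R ι N j x) = lof R ι N j x :=
  open Classical in DFinsupp.filter_single_pos (p := (· ∈ S)) j x hj

theorem proj_lof_of_notMem {S : Set ι} {j : ι} (hj : j ∉ S) (x : N j) :
    proj R N S (lof R ι N j x) = 0 :=
  open Classical in DFinsupp.filter_single_neg (p := (· ∈ S)) j x hj

theorem proj_mem_supported (S : Set ι) (x : ⨁ i, N i) : proj R N S x ∈ supported R N S := by
  induction x using DirectSum.induction_on with
  | zero => simp
  | of j x =>
    rw [← lof_eq_of R]
    by_cases hj : j ∈ S
    · rw [proj_lof_of_mem hj]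
      exact lof_mem_supported hj x
    · rw [proj_lof_of_notMem hj]
      exact zero_mem _
  | add x y hx hy =>
    rw [map_add]
    exact add_mem hx hy

theorem proj_eq_self {S : Set ι} {x : ⨁ i, N i} (hx : x ∈ supported R N S) :
    proj R N S x = x :=
  supported_le (K := LinearMap.eqLocus (proj R N S) LinearMap.id)
    (fun _ hj x => proj_lof_of_mem hj x) hx

theorem exists_finite_mem_supported (x : ⨁ i, N i) :
    ∃ S : Set ι, S.Finite ∧ x ∈ supported R N S := by
  induction x using DirectSum.induction_on with
  | zero => exact ⟨∅, Set.finite_empty, zero_mem _⟩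
  | of j x => exact ⟨{j}, Set.finite_singleton j, lof_mem_supported (Set.mem_singleton j) x⟩
  | add x y hx hy =>
    obtain ⟨S, hS, hx⟩ := hx
    obtain ⟨S', hS', hy⟩ := hy
    exact ⟨S ∪ S', hS.union hS', add_mem (supported_mono Set.subset_union_left hx)
      (supported_mono Set.subset_union_right hy)⟩

theorem exists_countable_span_eq_supported
    (hcg : ∀ i, ∃ s : Set (N i), s.Countable ∧ Submodule.span R s = ⊤)
    {S : Set ι} (hS : S.Countable) :
    ∃ s : Set (⨁ i, N i), s.Countable ∧ Submodule.span R s = supported R N S := by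
  choose s hs hspan using hcg
  refine ⟨⋃ j ∈ S, lof R ι N j '' s j, hS.biUnion fun j _ => (hs j).image _, ?_⟩
  simp only [Submodule.span_iUnion, Submodule.span_image, hspan, Submodule.map_top, supported]

/-- An endomorphism of a direct sum of countably generated modules maps each summand into the
part supported on some countable set of indices. -/
theorem exists_countable_map_mem_supported
    (hcg : ∀ i, ∃ s : Set (N i), s.Countable ∧ Submodule.span R s = ⊤)
    (θ : (⨁ i, N i) →ₗ[R] ⨁ i, N i) (j : ι) :
    ∃ c : Set ι, c.Countable ∧ ∀ x, θ (lof R ι N j x) ∈ supported R N c := by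
  obtain ⟨s, hs, hspan⟩ := hcg j
  choose F hF hmem using exists_finite_mem_supported (R := R) (N := N)
  refine ⟨⋃ x ∈ s, F (θ (lof R ι N j x)), hs.biUnion fun x _ => (hF _).countable, fun x => ?_⟩
  have hle : Submodule.span R s ≤ (supported R N (⋃ x ∈ s, F (θ (lof R ι N j x)))).comap
      (θ ∘ₗ lof R ι N j) :=
    Submodule.span_le.2 fun x hx => supported_mono
      (Set.subset_biUnion_of_mem (u := fun x => F (θ (lof R ι N j x))) hx) (hmem _)
  exact hle (hspan ▸ Submodule.mem_top)

/-- Kaplansky's theorem for a retract `P` of a direct sum of countably generated modules. -/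
theorem exists_isInternal_of_retract {P : Type*} [AddCommGroup P] [Module R P]
    (hcg : ∀ i, ∃ s : Set (N i), s.Countable ∧ Submodule.span R s = ⊤)
    (f : P →ₗ[R] ⨁ i, N i) (p : (⨁ i, N i) →ₗ[R] P) (hpf : ∀ x, p (f x) = x) :
    ∃ T : ι → Submodule R P, DirectSum.IsInternal T ∧
      ∀ k, ∃ s : Set P, s.Countable ∧ Submodule.span R s = T k := by
  choose c hc hcmem using exists_countable_map_mem_supported hcg (f ∘ₗ p)
  choose C hC hjC hCc using exists_countable_closed c hc
  classical
  let _ : LinearOrder ι := linearOrderOfSTO WellOrderingRel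
  have hwf : WellFounded ((· < ·) : ι → ι → Prop) := WellOrderingRel.isWellOrder.wf
  let S : ι → Set ι := fun j => ⋃ k < j, C k
  have hCS {j k : ι} (h : k < j) : C k ⊆ S j := Set.subset_biUnion_of_mem (u := C) h
  have hS {j k : ι} (h : k < j) : S k ⊆ S j := Set.iUnion₂_subset fun l hl => hCS (hl.trans h)
  have hSc (j a : ι) (ha : a ∈ S j) : c a ⊆ S j := by
    obtain ⟨k, hk, hak⟩ := Set.mem_iUnion₂.1 ha
    exact (hCc k a hak).trans (hCS hk)
  have hθ (j : ι) : supported R N (S j) ≤ (supported R N (S j)).comap (f ∘ₗ p) :=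
    supported_le fun a ha x => supported_mono (hSc j a ha) (hcmem a x)
  let q : ι → P →ₗ[R] P := fun j => p ∘ₗ proj R N (S j) ∘ₗ f
  have hqmem (j : ι) (y : P) : q j y ∈ (supported R N (S j)).map p :=
    ⟨_, proj_mem_supported _ _, rfl⟩
  have hqfix (j : ι) (y : P) (hy : y ∈ (supported R N (S j)).map p) : q j y = y := by
    obtain ⟨d, hd, rfl⟩ := hy
    change p (proj R N (S j) (f (p d))) = p d
    rw [proj_eq_self (show f (p d) ∈ _ from hθ j hd), hpf]
  let T : ι → Submodule R P := fun j =>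
    (supported R N (C j)).map ((LinearMap.id - q j) ∘ₗ p)
  refine ⟨T, isInternal_submodule_of_iSupIndep_of_iSup_eq_top
    (iSupIndep_of_fixes_lt T q ?_ ?_) ?_, fun j => ?_⟩
  · rintro j _ ⟨d, -, rfl⟩
    simp [hqfix j _ (hqmem j (p d))]
  · rintro j k hk _ ⟨d, hd, rfl⟩
    refine hqfix j _ (sub_mem ?_ ?_)
    · exact Submodule.mem_map_of_mem (supported_mono (hCS hk) hd)
    · exact Submodule.map_mono (supported_mono (hS hk)) (hqmem k (p d))
  · have hle (j : ι) : (supported R N (C j)).map p ≤ ⨆ k, T k := by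
      induction j using hwf.induction with
      | _ j ih =>
        have hSle : supported R N (S j) ≤ (⨆ k, T k).comap p := by
          refine supported_le fun a ha x => ?_
          obtain ⟨k, hk, hak⟩ := Set.mem_iUnion₂.1 ha
          exact ih k hk (Submodule.mem_map_of_mem (lof_mem_supported hak x))
        rintro _ ⟨d, hd, rfl⟩
        rw [← sub_add_cancel (p d) (q j (p d))]
        exact add_mem (Submodule.mem_iSup_of_mem j ⟨d, hd, rfl⟩)
          (Submodule.map_le_iff_le_comap.2 hSle (hqmem j (p d)))
    rw [eq_top_iff]
    intro y _
    rw [← hpf y]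
    have hall : supported R N Set.univ ≤ (⨆ k, T k).comap p :=
      supported_le fun a _ x => hle a (Submodule.mem_map_of_mem (lof_mem_supported (hjC a) x))
    obtain ⟨F, -, hF⟩ := exists_finite_mem_supported (R := R) (f y)
    exact hall (supported_mono (Set.subset_univ F) hF)
  · obtain ⟨s, hs, hspan⟩ := exists_countable_span_eq_supported hcg (hC j)
    exact ⟨((LinearMap.id - q j) ∘ₗ p) '' s, hs.image _, by rw [Submodule.span_image, hspan]⟩

end Supported

end CountablyGeneratedSummand

/-- **Kaplansky's theorem.** Suppose an `R`-module `M` is a direct sum of countably generated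
`R`-modules, i.e. `M ≅ ⊕ᵢ Nᵢ` with each `Nᵢ` countably generated.  If `P` is a direct summand
of `M` (i.e. `M ≅ P ⊕ Q` for some `R`-module `Q`), then `P` is also a direct sum of countably
generated `R`-modules. -/
theorem directSummand_of_directSum_countablyGenerated
    (R : Type u) [CommRing R] (M : Type u) [AddCommGroup M] [Module R M]
    (ι : Type u) [DecidableEq ι] (N : ι → Type u)
    [∀ i, AddCommGroup (N i)] [∀ i, Module R (N i)]
    (hcg : ∀ i, ∃ s : Set (N i), s.Countable ∧ Submodule.span R s = ⊤)
    (e : M ≃ₗ[R] DirectSum ι N)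
    (P Q : Type u) [AddCommGroup P] [Module R P] [AddCommGroup Q] [Module R Q]
    (f : M ≃ₗ[R] P × Q) :
    ∃ (κ : Type u) (_ : DecidableEq κ) (T : κ → Submodule R P),
      DirectSum.IsInternal T ∧
      ∀ k, ∃ s : Set P, s.Countable ∧ Submodule.span R s = T k := by
  obtain ⟨T, hT, hcgT⟩ := CountablyGeneratedSummand.exists_isInternal_of_retract hcg
    (e.toLinearMap ∘ₗ f.symm.toLinearMap ∘ₗ LinearMap.inl R P Q)
    (LinearMap.fst R P Q ∘ₗ f.toLinearMap ∘ₗ e.symm.toLinearMap) (fun x => by simp)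
  exact ⟨ι, inferInstance, T, hT, hcgT⟩
end

section
/- If P is a projective module over a local ring R, then P is a free R-module. -/
universe u

open Submodule

/-- Minimality of a presentation `x = ∑ fᵢ(x) yᵢ` forces every relation among the coefficients
`fᵢ(x)` to have its coefficients in the maximal ideal. -/
theorem Module.Projective.exists_minimal_dual_presentation
    {R M : Type*} [CommRing R] [AddCommGroup M] [Module R M] [Module.Projective R M] (x : M) :
    ∃ (n : ℕ) (f : Fin n → M →ₗ[R] R) (y : Fin n → M), ∑ i, f i x • y i = x ∧
      ∀ r : Fin n → R, ∑ i, r i * f i x = 0 → ∀ i, ¬ IsUnit (r i) := by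
  classical
  have hex : ∃ (n : ℕ) (f : Fin n → M →ₗ[R] R) (y : Fin n → M), ∑ i, f i x • y i = x := by
    obtain ⟨s, hs⟩ := Module.projective_def.1 (inferInstance : Module.Projective R M)
    let e := (s x).support.equivFin
    refine ⟨_, fun i ↦ Finsupp.lapply (e.symm i : M) ∘ₗ s, fun i ↦ e.symm i, ?_⟩
    rw [e.symm.sum_comp fun a : (s x).support ↦ (Finsupp.lapply (a : M) ∘ₗ s) x • (a : M)]
    conv_rhs => rw [← hs x, Finsupp.linearCombination_apply, Finsupp.sum, ← Finset.sum_coe_sort]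
    rfl
  obtain ⟨f, y, hfy⟩ := Nat.find_spec hex
  refine ⟨_, f, y, hfy, fun r hr i hi ↦ ?_⟩
  obtain ⟨u, hu⟩ := hi.exists_left_inv
  have key : ∑ j, f j x • (y j - (u * r j) • y i) = x := by
    simp only [smul_sub, Finset.sum_sub_distrib, hfy, smul_smul, ← Finset.sum_smul]
    have : ∑ j, f j x * (u * r j) = u * ∑ j, r j * f j x := by
      rw [Finset.mul_sum]
      exact Finset.sum_congr rfl fun j _ ↦ by ring
    rw [this, hr, mul_zero, zero_smul, sub_zero]
  have hmin : ∀ m < Nat.find hex, ¬ _ := fun m hm ↦ Nat.find_min hex hm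
  revert f y r i key hmin
  generalize Nat.find hex = n
  intro f y _ r _ i _ hu key hmin
  obtain _ | m := n
  · exact i.elim0
  refine hmin m m.lt_succ_self ⟨fun j ↦ f (i.succAbove j),
    fun j ↦ y (i.succAbove j) - (u * r (i.succAbove j)) • y i, ?_⟩
  rw [Fin.sum_univ_succAbove _ i, hu] at key
  simpa using key

/-- Every element of a projective module over a local ring lies in a direct summand which is free
of finite rank. -/
theorem Module.Projective.exists_linearIndepOn_isCompl_mem_span
    {R M : Type*} [CommRing R] [IsLocalRing R] [AddCommGroup M] [Module R M]
    [Module.Projective R M] (x : M) :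
    ∃ D : Set M, D.Finite ∧ LinearIndepOn R id D ∧ (∃ C, IsCompl (span R D) C) ∧
      x ∈ span R D := by
  classical
  obtain ⟨n, f, y, hx, hmin⟩ := Module.Projective.exists_minimal_dual_presentation (R := R) x
  let G : Matrix (Fin n) (Fin n) R := .of fun i j ↦ f i (y j)
  have hG : IsUnit G := by
    rw [Matrix.isUnit_iff_isUnit_det]
    refine isUnit_of_map_unit (IsLocalRing.residue R) _ ?_
    have h1 : (IsLocalRing.residue R).mapMatrix G = 1 := by
      ext i j
      have hrel : ∑ k, ((1 : Matrix (Fin n) (Fin n) R) i k - G i k) * f k x = 0 := by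
        have := congrArg (f i) hx
        simp only [map_sum, map_smul, smul_eq_mul] at this
        simp only [sub_mul, Finset.sum_sub_distrib, Matrix.one_apply, ite_mul, one_mul, zero_mul,
          Finset.sum_ite_eq, Finset.mem_univ, if_true, G, Matrix.of_apply, sub_eq_zero]
        rw [← this]
        exact Finset.sum_congr rfl fun k _ ↦ mul_comm _ _
      have h0 := (IsLocalRing.residue_eq_zero_iff _).2
        ((IsLocalRing.mem_maximalIdeal _).2 (hmin _ hrel j))
      rw [map_sub, sub_eq_zero] at h0
      rw [RingHom.mapMatrix_apply, Matrix.map_apply, ← h0, Matrix.one_apply, Matrix.one_apply]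
      split_ifs <;> simp
    rw [RingHom.map_det, h1, Matrix.det_one]
    exact isUnit_one
  let L : (Fin n → R) →ₗ[R] M := Fintype.linearCombination R y
  let ψ : M →ₗ[R] (Fin n → R) := G⁻¹.mulVecLin ∘ₗ LinearMap.pi f
  have hψ (c : Fin n → R) : ψ (L c) = c := by
    have h2 : LinearMap.pi f (L c) = G.mulVec c := by
      ext i
      simp [L, Fintype.linearCombination_apply, Matrix.mulVec, dotProduct, G, mul_comm]
    simp only [ψ, LinearMap.comp_apply, h2, Matrix.mulVecLin_apply, Matrix.mulVec_mulVec]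
    rw [Matrix.nonsing_inv_mul _ ((Matrix.isUnit_iff_isUnit_det G).1 hG), Matrix.one_mulVec]
  have hrange : LinearMap.range L = span R (Set.range y) := Fintype.range_linearCombination R y
  have hproj : LinearMap.IsProj (span R (Set.range y)) (L ∘ₗ ψ) := by
    rw [← hrange]
    refine ⟨fun z ↦ ⟨_, rfl⟩, ?_⟩
    rintro _ ⟨c, rfl⟩
    simp [hψ]
  refine ⟨Set.range y, Set.finite_range y, LinearIndependent.linearIndepOn_id ?_,
    ⟨_, hproj.isCompl⟩, ?_⟩
  · exact linearIndependent_iff_injective_fintypeLinearCombination.2 (Function.LeftInverse.injective hψ)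
  · rw [← hx]
    exact sum_mem fun i _ ↦ smul_mem _ _ (subset_span ⟨i, rfl⟩)

/-- A direct summand of a projective module is projective. -/
theorem Module.Projective.of_isCompl {R M : Type*} [Ring R] [AddCommGroup M] [Module R M]
    [Module.Projective R M] {N C : Submodule R M} (h : IsCompl N C) : Module.Projective R C :=
  .of_split C.subtype (C.projectionOnto N h.symm) <| by ext; simp

/-- A basis of a direct summand of a projective module over a local ring can be extended by
finitely many elements to a basis of a direct summand containing a prescribed finite set. -/
theorem Module.Projective.exists_finite_linearIndepOn_union
    {R M : Type*} [CommRing R] [IsLocalRing R] [AddCommGroup M] [Module R M]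
    [Module.Projective R M] {S : Set M} (hS : LinearIndepOn R id S)
    (hSC : ∃ C, IsCompl (span R S) C) {T : Set M} (hT : T.Finite) :
    ∃ D : Set M, D.Finite ∧ LinearIndepOn R id (S ∪ D) ∧ (∃ C, IsCompl (span R (S ∪ D)) C) ∧
      T ⊆ span R (S ∪ D) := by
  induction T, hT using Set.Finite.induction_on with
  | empty => exact ⟨∅, Set.finite_empty, by simpa using hS, by simpa using hSC, by simp⟩
  | @insert x T _ _ ih =>
    obtain ⟨D, hD, hli, ⟨C, hC⟩, hTD⟩ := ih
    have := Module.Projective.of_isCompl hC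
    obtain ⟨E, hE, hEli, ⟨C', hC'⟩, hxE⟩ :=
      Module.Projective.exists_linearIndepOn_isCompl_mem_span (R := R)
        (C.projectionOnto _ hC.symm x)
    have hspan : span R (S ∪ (D ∪ C.subtype '' E)) =
        span R (S ∪ D) ⊔ (span R E).map C.subtype := by
      rw [← Set.union_assoc, span_union, map_span]
    have hsup : (span R E).map C.subtype ⊔ C'.map C.subtype = C := by
      rw [← Submodule.map_sup, hC'.sup_eq_top, Submodule.map_top, range_subtype]
    have hdisj : Disjoint ((span R E).map C.subtype) (C'.map C.subtype) :=
      Submodule.disjoint_map C.injective_subtype hC'.disjoint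
    refine ⟨D ∪ C.subtype '' E, hD.union (hE.image _), ?_, ⟨C'.map C.subtype, ?_, ?_⟩, ?_⟩
    · rw [← Set.union_assoc]
      refine hli.id_union (hEli.image (by simp)) ?_
      rw [← map_span]
      exact hC.disjoint.mono_right (map_subtype_le _ _)
    · rw [hspan]
      exact hdisj.disjoint_sup_left_of_disjoint_sup_right (hC.disjoint.mono_right hsup.le)
    · rw [hspan, codisjoint_iff, sup_assoc, hsup, hC.sup_eq_top]
    · rw [hspan]
      refine Set.insert_subset ?_ (hTD.trans (SetLike.coe_subset_coe.2 le_sup_left))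
      rw [← Submodule.projection_add_projection_eq_self hC x]
      exact add_mem (mem_sup_left (coe_mem _)) (mem_sup_right (mem_map_of_mem hxE))

/-- Given a section `s` of `Finsupp.linearCombination R id`, a submodule containing the support of
`s p` for each of its elements `p` is a direct summand. -/
theorem Submodule.exists_isCompl_of_support_subset {R M : Type*} [Ring R] [AddCommGroup M]
    [Module R M] {s : M →ₗ[R] M →₀ R} (hs : ∀ p, Finsupp.linearCombination R id (s p) = p)
    {N : Submodule R M} (hN : ∀ p ∈ N, ((s p).support : Set M) ⊆ N) : ∃ C, IsCompl N C := by
  classical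
  let ρ : M →ₗ[R] M :=
    Finsupp.linearCombination R id ∘ₗ Submodule.subtype _ ∘ₗ
      Finsupp.restrictDom R R (N : Set M) ∘ₗ s
  refine ⟨_, LinearMap.IsProj.isCompl (f := ρ) ⟨fun p ↦ ?_, fun p hp ↦ ?_⟩⟩
  · have := (Finsupp.restrictDom R R (N : Set M) (s p)).2
    rw [Finsupp.mem_supported] at this
    exact sum_mem fun a ha ↦ smul_mem _ _ (this ha)
  · simp only [ρ, LinearMap.comp_apply, Submodule.subtype_apply, Finsupp.restrictDom_apply]
    rw [Finsupp.filter_eq_self_iff _ _ |>.2, hs]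
    exact fun a ha ↦ hN p hp (by simpa using ha)

/-- If the support of `s b` lies in a submodule `N` for all `b ∈ B`, then so does the support of
`s p` for all `p` in the span of `B`. -/
theorem Submodule.support_subset_of_mem_span {R M : Type*} [Ring R] [AddCommGroup M]
    [Module R M] (s : M →ₗ[R] M →₀ R) {B : Set M} {N : Submodule R M}
    (hB : ∀ b ∈ B, ((s b).support : Set M) ⊆ N) {p : M} (hp : p ∈ span R B) :
    ((s p).support : Set M) ⊆ N := by
  have : span R B ≤ (Finsupp.supported R R (N : Set M)).comap s := span_le.2 fun b hb ↦ by
    simpa [Finsupp.mem_supported] using hB b hb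
  exact (Finsupp.mem_supported R _).1 (this hp)

/-- **Kaplansky's theorem on projective modules over local rings.** If `P` is a projective
module over a (commutative) local ring `R`, then `P` is a free `R`-module. -/
theorem free_of_projective_of_isLocalRing
    (R P : Type u) [CommRing R] [IsLocalRing R] [AddCommGroup P] [Module R P]
    (h : Module.Projective R P) : Module.Free R P := by
  obtain ⟨s, hs⟩ := Module.projective_def.1 h
  obtain ⟨B, hB⟩ := zorn_subset
      {B : Set P | LinearIndepOn R id B ∧ ∀ b ∈ B, ((s b).support : Set P) ⊆ span R B} <| by
    refine fun c hc hchain ↦ ⟨⋃₀ c, ⟨?_, ?_⟩, fun _ ↦ Set.subset_sUnion_of_mem⟩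
    · exact linearIndepOn_sUnion_of_directed hchain.directedOn fun a ha ↦ (hc ha).1
    · rintro b ⟨A, hA, hbA⟩
      exact ((hc hA).2 b hbA).trans (span_mono (Set.subset_sUnion_of_mem hA))
  have hcompl : ∃ C, IsCompl (span R B) C :=
    exists_isCompl_of_support_subset hs fun p hp ↦ support_subset_of_mem_span s hB.prop.2 hp
  suffices htop : ⊤ ≤ span R B from
    .of_basis (Module.Basis.mk (v := ((↑) : B → P)) hB.prop.1 (by simpa using htop))
  rintro x -
  let Good : Type _ := {D : Set P // D.Finite ∧ LinearIndepOn R id (B ∪ D) ∧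
    ∃ C, IsCompl (span R (B ∪ D)) C}
  have hstep (D : Good) : ∃ E : Good, D.1 ⊆ E.1 ∧ x ∈ span R (B ∪ E.1) ∧
      ∀ d ∈ D.1, ((s d).support : Set P) ⊆ span R (B ∪ E.1) := by
    obtain ⟨D, hD, hli, hDC⟩ := D
    obtain ⟨E, hE, hEli, hEC, hsub⟩ := Module.Projective.exists_finite_linearIndepOn_union hli hDC
      ((hD.biUnion fun d _ ↦ (s d).support.finite_toSet).insert x)
    rw [Set.union_assoc] at hEli hEC hsub
    exact ⟨⟨D ∪ E, hD.union hE, hEli, hEC⟩, Set.subset_union_left, hsub (Set.mem_insert _ _),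
      fun d hd ↦ (Set.subset_biUnion_of_mem (u := fun d ↦ ((s d).support : Set P)) hd).trans
        ((Set.subset_insert _ _).trans hsub)⟩
  choose next hnext hx hsupp using hstep
  let D : ℕ → Good := Nat.rec ⟨∅, Set.finite_empty, by simpa using hB.prop.1, by simpa using hcompl⟩
    fun _ ↦ next
  have hmono : Monotone fun n ↦ B ∪ (D n).1 :=
    monotone_nat_of_le_succ fun n ↦ Set.union_subset_union_right _ (hnext (D n))
  have hle (n : ℕ) : span R (B ∪ (D n).1) ≤ span R (⋃ n, B ∪ (D n).1) :=
    span_mono (Set.subset_iUnion (fun n ↦ B ∪ (D n).1) n)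
  have hBU : B ⊆ ⋃ n, B ∪ (D n).1 :=
    Set.subset_union_left.trans (Set.subset_iUnion (fun n ↦ B ∪ (D n).1) 0)
  have hU : ⋃ n, B ∪ (D n).1 ⊆ B := by
    refine hB.le_of_ge ⟨?_, fun b hb ↦ ?_⟩ hBU
    · exact linearIndepOn_iUnion_of_directed hmono.directed_le fun n ↦ (D n).2.2.1
    · obtain ⟨n, hb | hb⟩ := Set.mem_iUnion.1 hb
      · exact (hB.prop.2 b hb).trans (span_mono hBU)
      · exact (hsupp (D n) b hb).trans (hle (n + 1))
  exact span_mono hU (hle 1 (hx (D 0)))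
end

section
/- Let P be a projective module over a local ring R. Then every element x ∈ P is contained in a free direct summand of P, i.e., there exist submodules N and N' of P with P = N ⊕ N', N free as an R-module, and x ∈ N. -/
open Module in
/-- A projective module satisfies the dual basis property at each of its elements. -/
theorem Module.Projective.exists_sum_dual_smul_eq {R P : Type*} [CommRing R] [AddCommGroup P]
    [Module R P] [Projective R P] (x : P) :
    ∃ (s : Finset P) (f : P → Dual R P) (y : P → P), ∑ i ∈ s, f i x • y i = x := by
  obtain ⟨σ, hσ⟩ := projective_def.mp ‹Projective R P›
  refine ⟨(σ x).support, fun p ↦ Finsupp.lapply p ∘ₗ σ, id, ?_⟩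
  simpa [Finsupp.linearCombination_apply, Finsupp.sum] using hσ x

open Module in
/-- If one coefficient of a finite expansion `x = ∑ i ∈ s, f i x • y i` is a combination of the
others, then `x` has such an expansion with one term fewer. -/
theorem Module.exists_sum_erase_dual_smul_eq {R P ι : Type*} [CommRing R] [AddCommGroup P]
    [Module R P] [DecidableEq ι] {s : Finset ι} {f : ι → Dual R P} {y : ι → P} {x : P}
    (hx : ∑ i ∈ s, f i x • y i = x) {i : ι} (hi : i ∈ s) {d : ι → R} (hd : IsUnit (d i))
    (hsum : ∑ k ∈ s, d k * f k x = 0) :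
    ∃ z : ι → P, ∑ k ∈ s.erase i, f k x • z k = x := by
  obtain ⟨u, hu⟩ := hd.exists_left_inv
  have hfi : f i x = ∑ k ∈ s.erase i, f k x * (-(u * d k)) := by
    rw [← Finset.add_sum_erase s _ hi] at hsum
    calc f i x = u * (d i * f i x) := by rw [← mul_assoc, hu, one_mul]
      _ = -u * ∑ k ∈ s.erase i, d k * f k x := by linear_combination u * hsum
      _ = _ := by rw [Finset.mul_sum]; exact Finset.sum_congr rfl fun k _ ↦ by ring
  refine ⟨fun k ↦ y k + (-(u * d k)) • y i, ?_⟩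
  simp_rw [smul_add, smul_smul]
  rw [Finset.sum_add_distrib, ← Finset.sum_smul, ← hfi, add_comm,
    Finset.add_sum_erase s (fun k ↦ f k x • y k) hi, hx]

/-- A square matrix over a local ring that is congruent to the identity modulo the maximal ideal
has invertible determinant. -/
theorem Matrix.isUnit_det_of_sub_one_mem_maximalIdeal {R n : Type*} [CommRing R] [IsLocalRing R]
    [Fintype n] [DecidableEq n] {A : Matrix n n R}
    (hA : ∀ i j, (A - 1) i j ∈ IsLocalRing.maximalIdeal R) : IsUnit A.det := by
  have h : (IsLocalRing.residue R).mapMatrix A = 1 := by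
    rw [← sub_eq_zero, ← map_one (IsLocalRing.residue R).mapMatrix, ← map_sub]
    ext i j
    exact (IsLocalRing.residue_eq_zero_iff _).mpr (hA i j)
  rw [← IsLocalRing.residue_ne_zero_iff_isUnit, RingHom.map_det, h, Matrix.det_one]
  exact one_ne_zero

/-- The range of a split injection is complemented by the kernel of the composite projection. -/
theorem LinearMap.isCompl_range_ker_of_leftInverse {R M P : Type*} [CommRing R] [AddCommGroup M]
    [Module R M] [AddCommGroup P] [Module R P] {Y : M →ₗ[R] P} {G : P →ₗ[R] M}
    (h : Function.LeftInverse G Y) : IsCompl (range Y) (ker (Y.rangeRestrict ∘ₗ G)) := by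
  refine isCompl_of_proj ?_
  rintro ⟨_, m, rfl⟩
  ext
  simp [h m]

universe u

/-- Let `P` be a projective module over a (commutative) local ring `R`.  Then every element
`x ∈ P` is contained in a free direct summand of `P`: there are submodules `N`, `N'` of `P`
with `P = N ⊕ N'` (internally), `N` free as an `R`-module, and `x ∈ N`. -/
theorem mem_free_direct_summand_of_projective_of_isLocalRing
    (R P : Type u) [CommRing R] [IsLocalRing R] [AddCommGroup P] [Module R P]
    (h : Module.Projective R P) (x : P) :
    ∃ (N N' : Submodule R P), IsCompl N N' ∧ Module.Free R N ∧ x ∈ N := by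
  classical
  obtain ⟨s, ⟨f, y, hx⟩, hmin⟩ := exists_minimal_of_wellFoundedLT _
    (Module.Projective.exists_sum_dual_smul_eq (R := R) x)
  let A : Matrix s s R := Matrix.of fun j k ↦ f j (y k)
  have hA : IsUnit A.det := by
    refine Matrix.isUnit_det_of_sub_one_mem_maximalIdeal fun j i ↦ ?_
    by_contra hji
    rw [IsLocalRing.mem_maximalIdeal, mem_nonunits_iff, not_not] at hji
    let d : P → R := fun k ↦ f j (y k) - if (j : P) = k then 1 else 0
    have hd : IsUnit (d i) := by
      simpa only [A, d, Matrix.sub_apply, Matrix.of_apply, Matrix.one_apply,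
        Subtype.ext_iff] using hji
    have hsum : ∑ k ∈ s, d k * f k x = 0 := by
      have hj := congrArg (f j) hx
      simp only [map_sum, map_smul, smul_eq_mul] at hj
      simp [d, sub_mul, ← hj, mul_comm (f j (y _))]
    obtain ⟨z, hz⟩ := Module.exists_sum_erase_dual_smul_eq hx i.2 hd hsum
    exact Finset.notMem_erase (i : P) s (hmin ⟨f, z, hz⟩ (Finset.erase_subset _ _) i.2)
  let Y : (s → R) →ₗ[R] P := Fintype.linearCombination R fun i : s ↦ y i
  let F : P →ₗ[R] s → R := LinearMap.pi fun i : s ↦ f i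
  have hFY (v : s → R) : F (Y v) = A.mulVec v := by
    ext j
    simp [F, Y, A, Fintype.linearCombination_apply, Matrix.mulVec, dotProduct, mul_comm]
  have hGY : Function.LeftInverse (A⁻¹.mulVecLin ∘ₗ F) Y := fun v ↦ by
    simp [hFY, Matrix.nonsing_inv_mul A hA]
  refine ⟨LinearMap.range Y, _, LinearMap.isCompl_range_ker_of_leftInverse hGY,
    Module.Free.of_equiv (LinearEquiv.ofInjective Y hGY.injective), F x, ?_⟩
  conv_rhs => rw [← hx]
  simp only [Y, F, Fintype.linearCombination_apply, LinearMap.pi_apply]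
  exact Finset.sum_coe_sort s fun i ↦ f i x • y i
end

section
/- Let 0 → M₁ → M₂ → M₃ → 0 be a short exact sequence of R-modules. Then the sequence is universally exact (i.e., M₁ → M₂ is universally injective) if and only if for every finitely presented R-module P, the induced map Hom_R(P, M₂) → Hom_R(P, M₃) is surjective. -/
universe u

namespace LinearMap

open scoped TensorProduct

variable {R : Type*} [CommRing R] {M N : Type*} [AddCommGroup M] [Module R M]
  [AddCommGroup N] [Module R N]

/-- A linear map `f : M → N` reflects solvability of finite linear systems if every finite system
of linear equations with constants in `M` which is solvable in `N` is solvable in `M`. -/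
def ReflectsSystems (f : M →ₗ[R] N) : Prop :=
  ∀ (n k : ℕ) (a : Fin n → Fin k → R) (x : Fin n → M) (y : Fin k → N),
    (∀ i, f (x i) = ∑ j, a i j • y j) → ∃ z : Fin k → M, ∀ i, x i = ∑ j, a i j • z j

/-- Every element of `Q ⊗ M` is a combination of pure tensors whose first factors run over a given
finite generating family of `Q`. -/
theorem _root_.TensorProduct.exists_eq_sum_tmul_of_span_eq_top {Q : Type*} [AddCommGroup Q]
    [Module R Q] {ι : Type*} [Fintype ι] {s : ι → Q}
    (hs : Submodule.span R (Set.range s) = ⊤) (t : Q ⊗[R] M) :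
    ∃ x : ι → M, t = ∑ i, s i ⊗ₜ x i := by
  induction t with
  | zero => exact ⟨0, by simp⟩
  | tmul q m =>
    obtain ⟨c, rfl⟩ := (Submodule.mem_span_range_iff_exists_fun R).mp
      (hs ▸ Submodule.mem_top : q ∈ Submodule.span R (Set.range s))
    exact ⟨fun i => c i • m, by simp [TensorProduct.sum_tmul, TensorProduct.smul_tmul]⟩
  | add t u ht hu =>
    obtain ⟨x, rfl⟩ := ht
    obtain ⟨y, rfl⟩ := hu
    exact ⟨x + y, by simp [TensorProduct.tmul_add, Finset.sum_add_distrib]⟩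

/-- A map which stays injective after tensoring with every module reflects solvability of
finite linear systems. -/
theorem ReflectsSystems.of_forall_lTensor_injective {R : Type u} [CommRing R] {M N : Type*}
    [AddCommGroup M] [Module R M] [AddCommGroup N] [Module R N] {f : M →ₗ[R] N}
    (h : ∀ (Q : Type u) [AddCommGroup Q] [Module R Q], Function.Injective (f.lTensor Q)) :
    f.ReflectsSystems := by
  intro n k a x y hxy
  let col : Fin k → Fin n → R := fun j i => a i j
  let K : Submodule R (Fin n → R) := Submodule.span R (Set.range col)
  let s : Fin n → (Fin n → R) ⧸ K := fun i => K.mkQ (Pi.single i 1)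
  have sum_s (c : Fin n → R) : ∑ i, c i • s i = K.mkQ c := by
    simp only [s, ← map_smul, ← map_sum]
    congr 1
    exact (pi_eq_sum_univ' c).symm
  have hs : Submodule.span R (Set.range s) = ⊤ := by
    refine top_unique fun q _ => ?_
    obtain ⟨c, rfl⟩ := K.mkQ_surjective q
    exact (Submodule.mem_span_range_iff_exists_fun R).mpr ⟨c, sum_s c⟩
  have hx : ∑ i, s i ⊗ₜ[R] x i = 0 := by
    apply h
    simp only [map_sum, lTensor_tmul, map_zero]
    refine TensorProduct.sum_tmul_eq_zero_of_vanishesTrivially R ⟨k, a, y, hxy, fun j => ?_⟩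
    exact (sum_s (col j)).trans
      ((Submodule.Quotient.mk_eq_zero K).mpr (Submodule.subset_span ⟨j, rfl⟩))
  obtain ⟨l, b, w, hxw, hbs⟩ := TensorProduct.vanishesTrivially_of_sum_tmul_eq_zero R hs hx
  have hb (p : Fin l) : ∃ c : Fin k → R, ∑ j, c j • col j = fun i => b i p := by
    refine (Submodule.mem_span_range_iff_exists_fun R).mp ?_
    exact (Submodule.Quotient.mk_eq_zero K).mp ((sum_s fun i => b i p).symm.trans (hbs p))
  choose c hc using hb
  refine ⟨fun j => ∑ p, c p j • w p, fun i => ?_⟩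
  rw [hxw]
  simp only [← congrFun (hc _) i, Finset.sum_apply, Pi.smul_apply, smul_eq_mul, Finset.sum_smul,
    Finset.smul_sum, col]
  rw [Finset.sum_comm]
  simp only [smul_smul, mul_comm]

/-- A map reflecting solvability of finite linear systems stays injective after tensoring with
any module. -/
theorem ReflectsSystems.lTensor_injective {f : M →ₗ[R] N} (hf : f.ReflectsSystems)
    (Q : Type*) [AddCommGroup Q] [Module R Q] : Function.Injective (f.lTensor Q) := by
  refine (injective_iff_map_eq_zero _).mpr fun t ht => ?_
  obtain ⟨Q₀, hQ₀, hsub⟩ := Submodule.exists_fg_le_subset_range_rTensor_subtype {t} (by simp)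
  obtain ⟨t, rfl⟩ := hsub rfl
  have ht₀ : Q₀.subtype.rTensor N (f.lTensor Q₀ t) = Q₀.subtype.rTensor N 0 := by
    rw [map_zero, ← ht, ← comp_apply, ← comp_apply, rTensor_comp_lTensor, lTensor_comp_rTensor]
  obtain ⟨Q₁, hQ₁, hle, ht₁⟩ := hQ₀.exists_rTensor_fg_inclusion_eq ht₀
  rw [map_zero, ← comp_apply, rTensor_comp_lTensor, ← lTensor_comp_rTensor, comp_apply] at ht₁
  rw [← Submodule.subtype_comp_inclusion _ _ hle, rTensor_comp, comp_apply]
  have : Module.Finite R Q₁ := Module.Finite.iff_fg.mpr hQ₁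
  obtain ⟨n, s, hs⟩ := Module.Finite.exists_fin (R := R) (M := Q₁)
  obtain ⟨x, hx⟩ := TensorProduct.exists_eq_sum_tmul_of_span_eq_top hs
    ((Submodule.inclusion hle).rTensor M t)
  rw [hx] at ht₁ ⊢
  simp only [map_sum, lTensor_tmul] at ht₁
  obtain ⟨k, a, y, hxy, has⟩ := TensorProduct.vanishesTrivially_of_sum_tmul_eq_zero R hs ht₁
  obtain ⟨z, hz⟩ := hf n k a x y hxy
  rw [TensorProduct.sum_tmul_eq_zero_of_vanishesTrivially R ⟨k, a, z, hz, has⟩, map_zero]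

/-- If the kernel inclusion of a surjection `g` reflects solvability of finite linear systems, then
maps from finitely presented modules lift along `g`. -/
theorem ReflectsSystems.exists_lift {L : Type*} [AddCommGroup L] [Module R L]
    {f : M →ₗ[R] N} {g : N →ₗ[R] L} (hf : f.ReflectsSystems) (hg : Function.Surjective g)
    (hfg : Function.Exact f g) {P : Type*} [AddCommGroup P] [Module R P]
    [Module.FinitePresentation R P] (φ : P →ₗ[R] L) : ∃ ψ : P →ₗ[R] N, g ∘ₗ ψ = φ := by
  obtain ⟨k, n, π, α, hπ, hα⟩ := Module.FinitePresentation.exists_fin' R P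
  obtain ⟨ψ, hψ⟩ := Module.projective_lifting_property g (φ ∘ₗ π) hg
  have apply_eq (c : Fin k → R) : ψ c = ∑ j, c j • ψ (Pi.single j 1) := by
    conv_lhs => rw [pi_eq_sum_univ' c]
    simp
  have hx (i : Fin n) : ∃ x, f x = ψ (α (Pi.single i 1)) := by
    refine (hfg _).mp ?_
    rw [← comp_apply, hψ, comp_apply, hα.apply_apply_eq_zero, map_zero]
  choose x hx using hx
  obtain ⟨z, hz⟩ := hf n k (fun i => α (Pi.single i 1)) x (fun j => ψ (Pi.single j 1))
    fun i => (hx i).trans (apply_eq _)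
  let ζ : (Fin k → R) →ₗ[R] M := Fintype.linearCombination R z
  have hker : ker π ≤ ker (ψ - f ∘ₗ ζ) := by
    rw [hα.linearMap_ker_eq, range_le_ker_iff]
    refine pi_ext' fun i => ext_ring ?_
    simp [ζ, Fintype.linearCombination_apply, ← hx, hz]
  let e := π.quotKerEquivOfSurjective hπ
  refine ⟨(ker π).liftQ _ hker ∘ₗ e.symm.toLinearMap, ?_⟩
  ext p
  obtain ⟨c, rfl⟩ := hπ p
  have he : e.symm (π c) = (ker π).mkQ c := by
    rw [LinearEquiv.symm_apply_eq]
    rfl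
  change g ((ker π).liftQ _ hker (e.symm (π c))) = φ (π c)
  rw [he, Submodule.mkQ_apply, Submodule.liftQ_apply, sub_apply, map_sub, comp_apply,
    hfg.apply_apply_eq_zero, sub_zero, ← comp_apply, hψ, comp_apply]

/-- If maps from finitely presented modules lift along `g`, then the inclusion of the kernel of `g`
reflects solvability of finite linear systems. -/
theorem ReflectsSystems.of_forall_exists_lift {R : Type u} [CommRing R] {M N L : Type*}
    [AddCommGroup M] [Module R M] [AddCommGroup N] [Module R N] [AddCommGroup L] [Module R L]
    {f : M →ₗ[R] N} {g : N →ₗ[R] L} (hf : Function.Injective f) (hfg : Function.Exact f g)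
    (h : ∀ (P : Type u) [AddCommGroup P] [Module R P], Module.FinitePresentation R P →
      ∀ φ : P →ₗ[R] L, ∃ ψ : P →ₗ[R] N, g ∘ₗ ψ = φ) :
    f.ReflectsSystems := by
  intro n k a x y hxy
  let K : Submodule R (Fin k → R) := Submodule.span R (Set.range a)
  have hK : K ≤ ker (g ∘ₗ Fintype.linearCombination R y) := by
    rw [Submodule.span_le]
    rintro _ ⟨i, rfl⟩
    simp only [SetLike.mem_coe, mem_ker, comp_apply, Fintype.linearCombination_apply, ← hxy]
    exact hfg.apply_apply_eq_zero _
  have hP : Module.FinitePresentation R ((Fin k → R) ⧸ K) :=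
    Module.finitePresentation_of_surjective K.mkQ K.mkQ_surjective
      (by rw [K.ker_mkQ]; exact Submodule.fg_span (Set.finite_range a))
  obtain ⟨ψ, hψ⟩ := h _ hP (K.liftQ _ hK)
  have hz (j : Fin k) : ∃ z, f z = y j - ψ (K.mkQ (Pi.single j 1)) := by
    refine (hfg _).mp ?_
    rw [map_sub, ← comp_apply g ψ, hψ]
    simp
  choose z hz using hz
  refine ⟨z, fun i => hf ?_⟩
  have hψa : ∑ j, a i j • ψ (K.mkQ (Pi.single j 1)) = 0 := by
    simp only [← map_smul, ← map_sum]
    rw [← pi_eq_sum_univ' (a i), Submodule.mkQ_apply,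
      (Submodule.Quotient.mk_eq_zero K).mpr (Submodule.subset_span ⟨i, rfl⟩), map_zero]
  simp [hz, smul_sub, Finset.sum_sub_distrib, hxy, -Submodule.mkQ_apply, hψa]

end LinearMap

/-- Let `0 → M₁ → M₂ → M₃ → 0` be a short exact sequence of `R`-modules.  Then the sequence is
universally exact (i.e. `M₁ → M₂` is universally injective) if and only if for every finitely
presented `R`-module `P` the induced map `Hom_R(P, M₂) → Hom_R(P, M₃)` is surjective. -/
theorem universally_exact_iff_hom_surjective
    (R : Type u) [CommRing R]
    (M₁ M₂ M₃ : Type u) [AddCommGroup M₁] [Module R M₁] [AddCommGroup M₂] [Module R M₂]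
    [AddCommGroup M₃] [Module R M₃]
    (f : M₁ →ₗ[R] M₂) (g : M₂ →ₗ[R] M₃)
    (hf : Function.Injective f) (hg : Function.Surjective g) (hfg : Function.Exact f g) :
    (∀ (Q : Type u) [AddCommGroup Q] [Module R Q],
        Function.Injective (LinearMap.rTensor Q f)) ↔
      ∀ (P : Type u) [AddCommGroup P] [Module R P], Module.FinitePresentation R P →
        Function.Surjective fun φ : P →ₗ[R] M₂ => g ∘ₗ φ := by
  constructor
  · intro h P _ _ hP φ
    refine LinearMap.ReflectsSystems.exists_lift
      (LinearMap.ReflectsSystems.of_forall_lTensor_injective fun Q _ _ => ?_) hg hfg φ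
    exact LinearMap.lTensor_inj_iff_rTensor_inj Q f |>.mpr (h Q)
  · intro h Q _ _
    exact LinearMap.lTensor_inj_iff_rTensor_inj Q f |>.mp
      ((LinearMap.ReflectsSystems.of_forall_exists_lift hf hfg h).lTensor_injective Q)
end

section
/- Let 0 → M₁ → M₂ → M₃ → 0 be a short exact sequence of R-modules with M₃ finitely presented. Then the sequence is universally exact if and only if it is split, i.e., the map M₂ → M₃ admits an R-linear section. -/
universe u

open TensorProduct in
/-- If `f` is universally injective, then a finite linear system over `M` that becomes solvable
in `N` is already solvable in `M`. -/
theorem exists_solution_of_rTensor_injective {R M N : Type u} [CommRing R] [AddCommGroup M]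
    [Module R M] [AddCommGroup N] [Module R N] {f : M →ₗ[R] N}
    (hf : ∀ (Q : Type u) [AddCommGroup Q] [Module R Q], Function.Injective (f.rTensor Q))
    {ι κ : Type} [Fintype ι] [Fintype κ] (a : Matrix κ ι R) (x : κ → M) (y : ι → N)
    (h : ∀ j, ∑ i, a j i • y i = f (x j)) :
    ∃ z : ι → M, ∀ j, ∑ i, a j i • z i = x j := by
  classical
  let A : (ι → R) →ₗ[R] (κ → R) := a.mulVecLin
  let q : (κ → R) →ₗ[R] (κ → R) ⧸ A.range := A.range.mkQ
  have hq (i : ι) : ∑ j, a j i • q (Pi.single j 1) = 0 := by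
    have : ∑ j, a j i • (Pi.single j 1 : κ → R) = A (Pi.single i 1) := by
      ext k
      simp [A, Finset.sum_apply, Pi.single_apply]
    simp_rw [← map_smul, ← map_sum, this]
    simp [q]
  let t : M ⊗[R] (κ → R) := ∑ j, x j ⊗ₜ Pi.single j 1
  have ht : q.lTensor M t = 0 := by
    apply hf
    simp only [t, map_sum, LinearMap.lTensor_tmul, LinearMap.rTensor_tmul, ← h, map_zero,
      sum_tmul, smul_tmul]
    rw [Finset.sum_comm]
    simp_rw [← tmul_sum, hq, tmul_zero, Finset.sum_const_zero]
  have hex : Function.Exact A q := by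
    rw [LinearMap.exact_iff, Submodule.ker_mkQ]
  obtain ⟨w, hw⟩ := (lTensor_exact M hex (Submodule.mkQ_surjective _) t).1 ht
  refine ⟨fun i ↦ TensorProduct.rid R M ((LinearMap.proj i).lTensor M w), fun j ↦ ?_⟩
  have key (w : M ⊗[R] (ι → R)) :
      ∑ i, a j i • TensorProduct.rid R M ((LinearMap.proj i).lTensor M w) =
        TensorProduct.rid R M ((LinearMap.proj j).lTensor M (A.lTensor M w)) := by
    induction w with
    | zero => simp
    | add u v hu hv => simp only [map_add, smul_add, Finset.sum_add_distrib, hu, hv]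
    | tmul m v => simp [A, Matrix.mulVec, dotProduct, Finset.sum_smul, mul_smul]
  rw [key, hw]
  simp [t, Pi.single_apply]

/-- Let `0 → M₁ → M₂ → M₃ → 0` be a short exact sequence of `R`-modules with `M₃` finitely
presented.  Then the sequence is universally exact if and only if it is split, i.e. the map
`M₂ → M₃` admits an `R`-linear section. -/
theorem universally_exact_iff_split_of_finitePresentation
    (R : Type u) [CommRing R]
    (M₁ M₂ M₃ : Type u) [AddCommGroup M₁] [Module R M₁] [AddCommGroup M₂] [Module R M₂]
    [AddCommGroup M₃] [Module R M₃] [Module.FinitePresentation R M₃]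
    (f : M₁ →ₗ[R] M₂) (g : M₂ →ₗ[R] M₃)
    (hf : Function.Injective f) (hg : Function.Surjective g) (hfg : Function.Exact f g) :
    (∀ (Q : Type u) [AddCommGroup Q] [Module R Q],
        Function.Injective (LinearMap.rTensor Q f)) ↔
      ∃ s : M₃ →ₗ[R] M₂, g ∘ₗ s = LinearMap.id := by
  constructor
  · intro h
    obtain ⟨n, m, p, B, hp, hB⟩ := Module.FinitePresentation.exists_fin' R M₃
    choose y hy using fun i ↦ hg (p (Pi.single i 1))
    have hgy : g ∘ₗ Fintype.linearCombination R y = p := by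
      ext i
      simp [hy]
    have hker (j : Fin m) : ∃ x, f x = Fintype.linearCombination R y (B (Pi.single j 1)) := by
      refine (hfg _).1 ?_
      rw [← LinearMap.comp_apply, hgy, hB.apply_apply_eq_zero]
    choose x hx using hker
    obtain ⟨z, hz⟩ := exists_solution_of_rTensor_injective h
      (Matrix.of fun j i ↦ B (Pi.single j 1) i) x y fun j ↦ by
        simp [hx, Fintype.linearCombination_apply]
    let L := Fintype.linearCombination R fun i ↦ y i - f (z i)
    have hL : L ∘ₗ B = 0 := by
      ext j
      have hj : ∑ i, B (Pi.single j 1) i • f (z i) = f (x j) := by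
        simpa using congrArg f (hz j)
      simp [L, Fintype.linearCombination_apply, smul_sub, hj, hx]
    have hgL : g ∘ₗ L = p := by
      ext i
      simp [L, hy, hfg.apply_apply_eq_zero]
    have hle : LinearMap.ker p ≤ LinearMap.ker L := by
      rw [hB.linearMap_ker_eq, LinearMap.range_le_ker_iff, hL]
    let e := p.quotKerEquivOfSurjective hp
    refine ⟨(LinearMap.ker p).liftQ L hle ∘ₗ e.symm, ?_⟩
    rw [← LinearMap.cancel_right hp]
    ext i
    have he (v) : e.symm (p v) = Submodule.Quotient.mk v := by
      rw [LinearEquiv.symm_apply_eq]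
      rfl
    simpa [he] using LinearMap.congr_fun hgL (Pi.single i 1)
  · intro hs Q _ _
    obtain ⟨-, r, hr⟩ := ((Function.Exact.split_tfae' hfg).out 0 1 rfl rfl).1 ⟨hf, hs⟩
    refine Function.LeftInverse.injective (g := r.rTensor Q) fun t ↦ ?_
    rw [← LinearMap.rTensor_comp_apply, hr, LinearMap.rTensor_id_apply]
end

section
/- Let f : M₁ → M₂ be a universally injective map of R-modules, and suppose M₂ is flat. Then M₁ is flat. -/
universe u

/-- Let `f : M₁ → M₂` be a universally injective map of `R`-modules, and suppose `M₂` is flat.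
Then `M₁` is flat. -/
theorem flat_of_universally_injective
    (R : Type u) [CommRing R]
    (M₁ M₂ : Type u) [AddCommGroup M₁] [Module R M₁] [AddCommGroup M₂] [Module R M₂]
    (f : M₁ →ₗ[R] M₂)
    (hf : ∀ (Q : Type u) [AddCommGroup Q] [Module R Q],
      Function.Injective (LinearMap.rTensor Q f))
    (h₂ : Module.Flat R M₂) : Module.Flat R M₁ := by
  rw [Module.Flat.iff_lTensor_preserves_injective_linearMap]
  intro N N' _ _ _ _ g hg
  have hcomp : Function.Injective (f.rTensor N' ∘ₗ g.lTensor M₁) := by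
    rw [LinearMap.rTensor_comp_lTensor, ← LinearMap.lTensor_comp_rTensor, LinearMap.coe_comp]
    exact (Module.Flat.lTensor_preserves_injective_linearMap g hg).comp (hf N)
  rw [LinearMap.coe_comp] at hcomp
  exact hcomp.of_comp
end

section
/- Let (A_i, φ_{ji} : A_j → A_i for j ≥ i) be an inverse system of nonempty sets indexed by a countable directed partially ordered set I. If the system is Mittag-Leffler, i.e., for each i ∈ I there exists j ≥ i such that φ_{ki}(A_k) = φ_{ji}(A_j) for all k ≥ j, then the inverse limit lim A_i is nonempty. -/
universe u v

/-- A countable nonempty directed preorder has a monotone cofinal sequence. -/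
theorem exists_monotone_cofinal_seq (I : Type u) [Preorder I] [IsDirected I (· ≤ ·)] [Countable I]
    [Nonempty I] : ∃ s : ℕ → I, Monotone s ∧ ∀ i, ∃ n, i ≤ s n := by
  obtain ⟨_⟩ := nonempty_encodable I
  inhabit I
  have hd : Directed (· ≤ ·) (id : I → I) := directed_id
  exact ⟨hd.sequence id, hd.sequence_mono, fun i ↦ ⟨_, hd.le_sequence i⟩⟩

/-- The elements of `A i` lying in the image of every transition map into `A i`. -/
def stableRange {I : Type u} [Preorder I] {A : I → Type v}
    (φ : ∀ ⦃i j : I⦄, i ≤ j → A j → A i) (i : I) : Set (A i) :=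
  {x | ∀ ⦃k⦄ (h : i ≤ k), x ∈ Set.range (φ h)}

section InverseSystem

variable {I : Type u} [Preorder I] {A : I → Type v} {φ : ∀ ⦃i j : I⦄, i ≤ j → A j → A i}

/-- An image that no later image improves on consists of stable elements. -/
theorem mem_stableRange_of_range_eq [IsDirected I (· ≤ ·)]
    (hcomp : ∀ ⦃i j k : I⦄ (hij : i ≤ j) (hjk : j ≤ k) (a : A k),
      φ hij (φ hjk a) = φ (hij.trans hjk) a)
    {i j : I} {hij : i ≤ j}
    (hj : ∀ k (hjk : j ≤ k), Set.range (φ (hij.trans hjk)) = Set.range (φ hij)) (z : A j) :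
    φ hij z ∈ stableRange φ i := by
  intro k hk
  obtain ⟨m, hjm, hkm⟩ := directed_of (· ≤ ·) j k
  obtain ⟨w, hw⟩ : φ hij z ∈ Set.range (φ (hij.trans hjm)) := hj m hjm ▸ Set.mem_range_self z
  exact ⟨φ hkm w, (hcomp hk hkm w).trans hw⟩

/-- In a Mittag-Leffler system the transition maps are surjective between stable ranges. -/
theorem exists_mem_stableRange_map_eq [IsDirected I (· ≤ ·)]
    (hcomp : ∀ ⦃i j k : I⦄ (hij : i ≤ j) (hjk : j ≤ k) (a : A k),
      φ hij (φ hjk a) = φ (hij.trans hjk) a)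
    (hML : ∀ i : I, ∃ j, ∃ hij : i ≤ j, ∀ k (hjk : j ≤ k),
      Set.range (φ (hij.trans hjk)) = Set.range (φ hij))
    {i j : I} (h : i ≤ j) {x : A i} (hx : x ∈ stableRange φ i) :
    ∃ y ∈ stableRange φ j, φ h y = x := by
  obtain ⟨k, hjk, hk⟩ := hML j
  obtain ⟨z, rfl⟩ := hx (h.trans hjk)
  exact ⟨φ hjk z, mem_stableRange_of_range_eq hcomp hk z, hcomp h hjk z⟩

/-- A family compatible along a monotone cofinal sequence extends to the whole inverse system. -/
theorem nonempty_inverseLimit_of_cofinal_seq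
    (hcomp : ∀ ⦃i j k : I⦄ (hij : i ≤ j) (hjk : j ≤ k) (a : A k),
      φ hij (φ hjk a) = φ (hij.trans hjk) a)
    {s : ℕ → I} (hs : Monotone s) (hcof : ∀ i, ∃ n, i ≤ s n) (b : ∀ n, A (s n))
    (hb : ∀ ⦃m n⦄ (h : m ≤ n), φ (hs h) (b n) = b m) :
    Nonempty { a : ∀ i, A i // ∀ ⦃i j : I⦄ (h : i ≤ j), φ h (a j) = a i } := by
  have hindep : ∀ i m n (hm : i ≤ s m) (hn : i ≤ s n), φ hm (b m) = φ hn (b n) := by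
    intro i m n hm hn
    rw [← hb (le_max_left m n), ← hb (le_max_right m n), hcomp, hcomp]
  choose n hn using hcof
  exact ⟨⟨fun i ↦ φ (hn i) (b (n i)), fun i j h ↦ (hcomp h (hn j) _).trans (hindep _ _ _ _ _)⟩⟩

end InverseSystem

/-- Let `(Aᵢ, φ_{ji} : A_j → A_i` for `j ≥ i)` be an inverse system of nonempty sets indexed by
a countable directed partially ordered set `I`.  If the system is Mittag-Leffler, i.e. for each
`i` there is `j ≥ i` with `φ_{ki}(A_k) = φ_{ji}(A_j)` for all `k ≥ j`, then the inverse limit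
is nonempty. -/
theorem nonempty_inverseLimit_of_mittagLeffler
    (I : Type u) [PartialOrder I] [IsDirected I (· ≤ ·)] [Countable I]
    (A : I → Type v)
    (φ : ∀ ⦃i j : I⦄, i ≤ j → A j → A i)
    (hid : ∀ (i : I) (a : A i), φ (le_refl i) a = a)
    (hcomp : ∀ ⦃i j k : I⦄ (hij : i ≤ j) (hjk : j ≤ k) (a : A k),
      φ hij (φ hjk a) = φ (hij.trans hjk) a)
    (hne : ∀ i, Nonempty (A i))
    (hML : ∀ i : I, ∃ j, ∃ hij : i ≤ j, ∀ k (hjk : j ≤ k),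
      Set.range (φ (hij.trans hjk)) = Set.range (φ hij)) :
    Nonempty { a : ∀ i, A i // ∀ ⦃i j : I⦄ (h : i ≤ j), φ h (a j) = a i } := by
  cases isEmpty_or_nonempty I with
  | inl _ => exact ⟨⟨isEmptyElim, isEmptyElim⟩⟩
  | inr _ =>
    obtain ⟨s, hs, hcof⟩ := exists_monotone_cofinal_seq I
    obtain ⟨j, hj, hstab⟩ := hML (s 0)
    obtain ⟨z⟩ := hne j
    choose g hg hφg using fun n (x : stableRange φ (s n)) ↦
      exists_mem_stableRange_map_eq hcomp hML (hs n.le_succ) x.2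
    let b : ∀ n, stableRange φ (s n) := fun n ↦
      Nat.rec ⟨φ hj z, mem_stableRange_of_range_eq hcomp hstab z⟩ (fun n x ↦ ⟨g n x, hg n x⟩) n
    refine nonempty_inverseLimit_of_cofinal_seq hcomp hs hcof (fun n ↦ (b n).1) fun m n h ↦ ?_
    induction n, h using Nat.le_induction with
    | base => exact hid _ _
    | succ n hmn ih =>
      rw [← hcomp (hs hmn) (hs n.le_succ)]
      exact (congrArg _ (hφg n (b n))).trans ih
end

section
/- Let 0 → A_i → B_i → C_i → 0 be an exact sequence of inverse systems of abelian groups indexed by a countable directed partially ordered set I (i.e., for each i the sequence is exact and the maps commute with the transition maps). If the inverse system (A_i) is Mittag-Leffler, then the sequence of inverse limits 0 → lim A_i → lim B_i → lim C_i → 0 is exact. -/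
universe u v

/-- A Mittag-Leffler inverse system of nonempty sets over a countable directed preorder has a
compatible family. -/
theorem exists_compatible_family_of_mittagLeffler
    {I : Type u} [Preorder I] [IsDirected I (· ≤ ·)] [Countable I]
    {X : I → Type v} [∀ i, Nonempty (X i)] (φ : ∀ ⦃i j : I⦄, i ≤ j → X j → X i)
    (hcomp : ∀ ⦃i j k : I⦄ (hij : i ≤ j) (hjk : j ≤ k) (x : X k),
      φ hij (φ hjk x) = φ (hij.trans hjk) x)
    (hML : ∀ i : I, ∃ j, ∃ hij : i ≤ j, ∀ k (hjk : j ≤ k) (x : X j),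
      ∃ y : X k, φ (hij.trans hjk) y = φ hij x) :
    ∃ x : ∀ i, X i, ∀ ⦃i j : I⦄ (h : i ≤ j), φ h (x j) = x i := by
  rcases isEmpty_or_nonempty I with hI | hI
  · exact ⟨fun i => hI.elim i, fun i => hI.elim i⟩
  let R : ∀ i, X i → Prop := fun i x => ∀ k (h : i ≤ k), ∃ y, φ h y = x
  have R_map : ∀ ⦃i j k : I⦄ (hij : i ≤ j) (hjk : j ≤ k),
      (∀ l (hl : j ≤ l) (x : X j), ∃ y : X l, φ (hij.trans hl) y = φ hij x) →
      ∀ x : X k, R i (φ (hij.trans hjk) x) := by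
    intro i j k hij hjk hj x l hil
    obtain ⟨m, hlm, hjm⟩ := exists_ge_ge l j
    obtain ⟨y, hy⟩ := hj m hjm (φ hjk x)
    exact ⟨φ hlm y, by rw [hcomp, hy, hcomp]⟩
  have R_nonempty : ∀ i, ∃ x, R i x := by
    intro i
    obtain ⟨j, hij, hj⟩ := hML i
    exact ⟨_, R_map hij le_rfl hj (Classical.arbitrary (X j))⟩
  have R_lift : ∀ ⦃i j : I⦄ (hij : i ≤ j) (x : X i), R i x → ∃ y, R j y ∧ φ hij y = x := by
    intro i j hij x hx
    obtain ⟨k, hjk, hk⟩ := hML j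
    obtain ⟨z, hz⟩ := hx k (hij.trans hjk)
    exact ⟨φ hjk z, R_map hjk le_rfl hk z, by rw [hcomp, hz]⟩
  obtain ⟨t, ht, ht_top⟩ := Filter.exists_seq_monotone_tendsto_atTop_atTop I
  choose lift R_lift_mem map_lift using R_lift
  let x : ∀ n, {x : X (t n) // R (t n) x} := fun n =>
    Nat.rec ⟨_, (R_nonempty (t 0)).choose_spec⟩
      (fun n x => ⟨lift (ht n.le_succ) x.1 x.2, R_lift_mem _ _ _⟩) n
  have x_map : ∀ ⦃i : I⦄ ⦃n k : ℕ⦄ (hnk : n ≤ k) (hin : i ≤ t n),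
      φ (hin.trans (ht hnk)) (x k).1 = φ hin (x n).1 := by
    intro i n k hnk hin
    induction k, hnk using Nat.le_induction with
    | base => rfl
    | succ k hnk ih =>
      rw [← ih, ← hcomp (hin.trans (ht hnk)) (ht k.le_succ)]
      exact congrArg _ (map_lift _ _ _)
  choose N hN using fun i => (ht_top.eventually_ge_atTop i).exists
  refine ⟨fun i => φ (hN i) (x (N i)).1, fun i j h => ?_⟩
  exact (hcomp h (hN j) _).trans <|
    (x_map (le_max_right (N i) (N j)) (h.trans (hN j))).symm.trans <|
      x_map (le_max_left (N i) (N j)) (hN i)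

/-- Let `0 → Aᵢ → Bᵢ → Cᵢ → 0` be an exact sequence of inverse systems of abelian groups
indexed by a countable directed partially ordered set `I`.  If the inverse system `(Aᵢ)` is
Mittag-Leffler, then the sequence of inverse limits `0 → lim Aᵢ → lim Bᵢ → lim Cᵢ → 0` is
exact, i.e. the map `lim Aᵢ → lim Bᵢ` is injective with image the kernel of
`lim Bᵢ → lim Cᵢ`, and `lim Bᵢ → lim Cᵢ` is surjective. -/
theorem inverseLimit_exact_of_mittagLeffler
    (I : Type u) [PartialOrder I] [IsDirected I (· ≤ ·)] [Countable I]
    (A B C : I → Type v)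
    [∀ i, AddCommGroup (A i)] [∀ i, AddCommGroup (B i)] [∀ i, AddCommGroup (C i)]
    (φA : ∀ ⦃i j : I⦄, i ≤ j → A j →+ A i)
    (φB : ∀ ⦃i j : I⦄, i ≤ j → B j →+ B i)
    (φC : ∀ ⦃i j : I⦄, i ≤ j → C j →+ C i)
    (hidA : ∀ (i : I) (a : A i), φA (le_refl i) a = a)
    (hidB : ∀ (i : I) (b : B i), φB (le_refl i) b = b)
    (hidC : ∀ (i : I) (c : C i), φC (le_refl i) c = c)
    (hcompA : ∀ ⦃i j k : I⦄ (hij : i ≤ j) (hjk : j ≤ k) (a : A k),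
      φA hij (φA hjk a) = φA (hij.trans hjk) a)
    (hcompB : ∀ ⦃i j k : I⦄ (hij : i ≤ j) (hjk : j ≤ k) (b : B k),
      φB hij (φB hjk b) = φB (hij.trans hjk) b)
    (hcompC : ∀ ⦃i j k : I⦄ (hij : i ≤ j) (hjk : j ≤ k) (c : C k),
      φC hij (φC hjk c) = φC (hij.trans hjk) c)
    (f : ∀ i, A i →+ B i) (g : ∀ i, B i →+ C i)
    (hfcomm : ∀ ⦃i j : I⦄ (h : i ≤ j) (a : A j), f i (φA h a) = φB h (f j a))
    (hgcomm : ∀ ⦃i j : I⦄ (h : i ≤ j) (b : B j), g i (φB h b) = φC h (g j b))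
    (hinj : ∀ i, Function.Injective (f i))
    (hsurj : ∀ i, Function.Surjective (g i))
    (hexact : ∀ i, Function.Exact (f i) (g i))
    (hML : ∀ i : I, ∃ j, ∃ hij : i ≤ j, ∀ k (hjk : j ≤ k),
      Set.range (φA (hij.trans hjk)) = Set.range (φA hij)) :
    -- injectivity of `lim A → lim B`
    (∀ a a' : ∀ i, A i, (∀ ⦃i j : I⦄ (h : i ≤ j), φA h (a j) = a i) →
      (∀ ⦃i j : I⦄ (h : i ≤ j), φA h (a' j) = a' i) →
      (∀ i, f i (a i) = f i (a' i)) → a = a') ∧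
    -- exactness at `lim B`
    (∀ b : ∀ i, B i, (∀ ⦃i j : I⦄ (h : i ≤ j), φB h (b j) = b i) →
      (∀ i, g i (b i) = 0) →
      ∃ a : ∀ i, A i, (∀ ⦃i j : I⦄ (h : i ≤ j), φA h (a j) = a i) ∧ ∀ i, f i (a i) = b i) ∧
    -- surjectivity of `lim B → lim C`
    (∀ c : ∀ i, C i, (∀ ⦃i j : I⦄ (h : i ≤ j), φC h (c j) = c i) →
      ∃ b : ∀ i, B i, (∀ ⦃i j : I⦄ (h : i ≤ j), φB h (b j) = b i) ∧ ∀ i, g i (b i) = c i) := by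
  refine ⟨fun a a' _ _ h => funext fun i => hinj i (h i), fun b hb hgb => ?_, fun c hc => ?_⟩
  · choose a ha using fun i => (hexact i (b i)).1 (hgb i)
    exact ⟨a, fun i j h => hinj i (by rw [hfcomm, ha, ha, hb]), ha⟩
  · have : ∀ i, Nonempty {b : B i // g i b = c i} := fun i =>
      let ⟨b, hb⟩ := hsurj i (c i)
      ⟨⟨b, hb⟩⟩
    obtain ⟨b, hb⟩ := exists_compatible_family_of_mittagLeffler
      (X := fun i => {b : B i // g i b = c i})
      (fun i j h b => ⟨φB h b.1, by rw [hgcomm, b.2, hc]⟩)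
      (fun i j k hij hjk b => Subtype.ext (hcompB hij hjk b.1)) (by
        intro i
        obtain ⟨j, hij, hj⟩ := hML i
        refine ⟨j, hij, fun k hjk b => ?_⟩
        obtain ⟨b₀, hb₀⟩ := hsurj k (c k)
        obtain ⟨a, ha⟩ := (hexact j (b.1 - φB hjk b₀)).1 (by
          rw [map_sub, b.2, hgcomm, hb₀, hc, sub_self])
        obtain ⟨a', ha'⟩ : φA hij a ∈ Set.range (φA (hij.trans hjk)) := by
          rw [hj k hjk]
          exact ⟨a, rfl⟩
        refine ⟨⟨b₀ + f k a', ?_⟩, Subtype.ext ?_⟩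
        · rw [map_add, (hexact k).apply_apply_eq_zero, add_zero, hb₀]
        · change φB _ (b₀ + f k a') = φB hij b.1
          rw [map_add, ← hfcomm, ha', hfcomm, ha, map_sub, hcompB, add_sub_cancel])
    exact ⟨fun i => (b i).1, fun i j h => congrArg Subtype.val (hb h), fun i => (b i).2⟩
end

section
/- Let f : M → N and g : M → M' be maps of R-modules, and suppose the cokernel of f is finitely presented. Then g dominates f (i.e., for every R-module Q, ker(f ⊗_R id_Q) ⊆ ker(g ⊗_R id_Q)) if and only if g factors through f, i.e., there exists an R-module map h : N → M' with g = h ∘ f. -/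
open TensorProduct in
/-- If `x` is a system of elements of `M` such that `∑ j, x j ⊗ e j` vanishes in `M ⊗ Q`, where
`Q` is the cokernel of the transpose of the matrix `a`, then the linear system
`∑ i, a j i • y i = x j` has a solution in `M`. -/
lemma exists_sum_smul_eq_of_sum_tmul_mkQ_eq_zero {R M ι κ : Type*} [CommRing R]
    [AddCommGroup M] [Module R M] [Fintype ι] [Fintype κ] [DecidableEq ι] [DecidableEq κ]
    (a : κ → ι → R) (x : κ → M)
    (hx : ∑ j, x j ⊗ₜ[R] (LinearMap.range
      (Fintype.linearCombination R (fun i j => a j i))).mkQ (Pi.single j 1) = 0) :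
    ∃ y : ι → M, ∀ j, ∑ i, a j i • y i = x j := by
  set B : (ι → R) →ₗ[R] (κ → R) := Fintype.linearCombination R (fun i j => a j i) with hB
  have hexact := lTensor_exact M (LinearMap.exact_map_mkQ_range B) (Submodule.mkQ_surjective _)
  obtain ⟨z, hz⟩ := (hexact (∑ j, x j ⊗ₜ[R] Pi.single j 1)).mp (by simpa using hx)
  refine ⟨piScalarRight R R M ι z, fun j => ?_⟩
  have key : ∀ w : M ⊗[R] (ι → R), ∑ i, a j i • piScalarRight R R M ι w i =
      piScalarRight R R M κ (B.lTensor M w) j := by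
    intro w
    induction w with
    | zero => simp
    | add u v hu hv => simp only [map_add, Pi.add_apply, smul_add, Finset.sum_add_distrib, hu, hv]
    | tmul m r =>
      simp [hB, Fintype.linearCombination_apply, Finset.sum_smul, smul_smul, mul_comm]
  rw [key, hz]
  simp [Finset.sum_apply, Pi.single_apply]

/-- A linear map factors through a surjection as soon as it vanishes on its kernel. -/
lemma LinearMap.exists_comp_eq_of_surjective_of_ker_le {R M N P : Type*} [CommRing R]
    [AddCommGroup M] [Module R M] [AddCommGroup N] [Module R N] [AddCommGroup P] [Module R P]
    (p : M →ₗ[R] N) (q : M →ₗ[R] P) (hp : Function.Surjective p)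
    (hpq : LinearMap.ker p ≤ LinearMap.ker q) : ∃ h : N →ₗ[R] P, h ∘ₗ p = q := by
  refine ⟨(LinearMap.ker p).liftQ q hpq ∘ₗ (p.quotKerEquivOfSurjective hp).symm, ?_⟩
  ext m
  have : (p.quotKerEquivOfSurjective hp).symm (p m) = (LinearMap.ker p).mkQ m := by
    rw [LinearEquiv.symm_apply_eq]; rfl
  simp [this]

/-- Let `f : M → N` and `g : M → M'` be maps of `R`-modules, and suppose the cokernel of `f`
is finitely presented.  Then `g` dominates `f` (i.e. for every `R`-module `Q`,
`ker(f ⊗ id_Q) ⊆ ker(g ⊗ id_Q)`) if and only if `g` factors through `f`. -/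
theorem dominates_iff_factors
    (R : Type u) [CommRing R]
    (M N M' : Type u) [AddCommGroup M] [Module R M] [AddCommGroup N] [Module R N]
    [AddCommGroup M'] [Module R M']
    (f : M →ₗ[R] N) (g : M →ₗ[R] M')
    (hcoker : Module.FinitePresentation R (N ⧸ LinearMap.range f)) :
    (∀ (Q : Type u) [AddCommGroup Q] [Module R Q],
        LinearMap.ker (LinearMap.rTensor Q f) ≤ LinearMap.ker (LinearMap.rTensor Q g)) ↔
      ∃ h : N →ₗ[R] M', g = h ∘ₗ f := by
  refine ⟨fun H => ?_, ?_⟩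
  swap
  · rintro ⟨h, rfl⟩ Q _ _ x hx
    rw [LinearMap.mem_ker] at hx ⊢
    rw [LinearMap.rTensor_comp, LinearMap.comp_apply, hx, map_zero]
  have hker : LinearMap.ker f ≤ LinearMap.ker g := by
    intro m hm
    rw [LinearMap.mem_ker] at hm ⊢
    have h1 : LinearMap.rTensor R g (m ⊗ₜ[R] 1) = 0 := H R (by simp [hm])
    simpa using congrArg (TensorProduct.rid R M') h1
  obtain ⟨n, K, e, hK⟩ := Module.FinitePresentation.exists_fin R (N ⧸ LinearMap.range f)
  obtain ⟨k, a, ha⟩ := Submodule.fg_iff_exists_fin_generating_family.mp hK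
  let π : (Fin n → R) →ₗ[R] N ⧸ LinearMap.range f := e.symm.toLinearMap ∘ₗ K.mkQ
  have hπ : Function.Surjective π := e.symm.surjective.comp K.mkQ_surjective
  have hπker : ∀ c, π c = 0 ↔ c ∈ K := fun c => by simp [π]
  obtain ⟨σ, hσ⟩ := Module.projective_lifting_property (LinearMap.range f).mkQ π
    (Submodule.mkQ_surjective _)
  have hσ' : ∀ c, (LinearMap.range f).mkQ (σ c) = π c := fun c => LinearMap.congr_fun hσ c
  have hrel : ∀ j, ∃ m, f m = σ (a j) := fun j => by
    rw [← LinearMap.mem_range, ← Submodule.ker_mkQ (LinearMap.range f), LinearMap.mem_ker, hσ',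
      hπker, ← ha]
    exact Submodule.subset_span ⟨j, rfl⟩
  choose m hm using hrel
  obtain ⟨y, hy⟩ : ∃ y : Fin n → M', ∀ j, ∑ i, a j i • y i = g (m j) := by
    apply exists_sum_smul_eq_of_sum_tmul_mkQ_eq_zero
    set L := LinearMap.range (Fintype.linearCombination R (fun i j => a j i))
    suffices h0 : LinearMap.rTensor _ f (∑ j, m j ⊗ₜ[R] L.mkQ (Pi.single j 1)) = 0 by
      simpa using H _ h0
    have hσa : ∀ j, f (m j) = ∑ i, a j i • σ (Pi.single i 1) := fun j => by
      rw [hm]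
      conv_lhs => rw [pi_eq_sum_univ' (a j)]
      simp [Pi.single]
    have hcol : ∀ i, ∑ j, a j i • L.mkQ (Pi.single j 1) = 0 := fun i => by
      simp_rw [← map_smul, ← map_sum]
      rw [← LinearMap.mem_ker, Submodule.ker_mkQ]
      refine ⟨Pi.single i 1, ?_⟩
      ext j
      simp [Fintype.linearCombination_apply_single, Finset.sum_apply, Pi.single_apply]
    simp_rw [map_sum, LinearMap.rTensor_tmul, hσa, TensorProduct.sum_tmul, TensorProduct.smul_tmul]
    rw [Finset.sum_comm]
    simp_rw [← TensorProduct.tmul_sum, hcol, TensorProduct.tmul_zero, Finset.sum_const_zero]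
  let τ : (Fin n → R) →ₗ[R] M' := Fintype.linearCombination R y
  have hτ : ∀ j, τ (a j) = g (m j) := fun j => by
    rw [← hy]; simp [τ, Fintype.linearCombination_apply]
  have hKlift : ∀ c ∈ K, ∃ x, f x = σ c ∧ g x = τ c := by
    intro c hc
    rw [← ha] at hc
    induction hc using Submodule.span_induction with
    | mem x hx =>
      obtain ⟨j, rfl⟩ := hx
      exact ⟨m j, hm j, (hτ j).symm⟩
    | zero => exact ⟨0, by simp⟩
    | add u v _ _ hu hv =>
      obtain ⟨x, hx⟩ := hu
      obtain ⟨x', hx'⟩ := hv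
      exact ⟨x + x', by simp [hx, hx']⟩
    | smul r u _ hu =>
      obtain ⟨x, hx⟩ := hu
      exact ⟨r • x, by simp [hx]⟩
  obtain ⟨h, hh⟩ := LinearMap.exists_comp_eq_of_surjective_of_ker_le (f.coprod σ) (g.coprod τ)
    (by
      intro z
      obtain ⟨c, hc⟩ := hπ ((LinearMap.range f).mkQ z)
      have : z - σ c ∈ LinearMap.range f := by
        rw [← Submodule.ker_mkQ (LinearMap.range f), LinearMap.mem_ker, map_sub, hσ', hc, sub_self]
      obtain ⟨x, hx⟩ := this
      exact ⟨(x, c), by simp [hx]⟩)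
    (by
      rintro ⟨x, c⟩ hxc
      simp only [LinearMap.mem_ker, LinearMap.coprod_apply] at hxc ⊢
      have hc : c ∈ K := by
        rw [← hπker, ← hσ', ← LinearMap.mem_ker, Submodule.ker_mkQ]
        exact ⟨-x, by rw [map_neg, neg_eq_of_add_eq_zero_right hxc]⟩
      obtain ⟨x', hx', hgx'⟩ := hKlift c hc
      have : x + x' ∈ LinearMap.ker g := hker (by simpa [hx'] using hxc)
      simpa [hgx'] using this)
  refine ⟨h, ?_⟩
  ext x
  simpa using (LinearMap.congr_fun hh (x, 0)).symm
end

section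
/- Let M be an R-module. Then M is finitely generated if and only if for every family (Q_α)_{α∈A} of R-modules, the canonical map M ⊗_R (∏_α Q_α) → ∏_α (M ⊗_R Q_α), given on pure tensors by x ⊗ (q_α) ↦ (x ⊗ q_α), is surjective. -/
open TensorProduct

universe u

theorem TensorProduct.exists_eq_sum_tmul_of_span_eq_top_s13 {R M N ι : Type*} [CommRing R]
    [AddCommGroup M] [Module R M] [AddCommGroup N] [Module R N] [Fintype ι]
    {g : ι → M} (hg : Submodule.span R (Set.range g) = ⊤) (t : M ⊗[R] N) :
    ∃ q : ι → N, t = ∑ i, g i ⊗ₜ[R] q i := by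
  induction t with
  | zero => exact ⟨0, by simp⟩
  | add x y hx hy =>
    obtain ⟨p, rfl⟩ := hx
    obtain ⟨q, rfl⟩ := hy
    exact ⟨p + q, by simp [TensorProduct.tmul_add, Finset.sum_add_distrib]⟩
  | tmul x n =>
    have hx : x ∈ Submodule.span R (Set.range g) := hg ▸ Submodule.mem_top
    obtain ⟨c, rfl⟩ := (Submodule.mem_span_range_iff_exists_fun R).mp hx
    exact ⟨fun i ↦ c i • n, by simp [TensorProduct.sum_tmul, TensorProduct.smul_tmul]⟩

theorem TensorProduct.exists_fg_forall_rid_piRightHom_mem {R M A : Type*} [CommRing R]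
    [AddCommGroup M] [Module R M] (z : M ⊗[R] (A → R)) :
    ∃ P : Submodule R M, P.FG ∧
      ∀ a, TensorProduct.rid R M (TensorProduct.piRightHom R R M (fun _ : A ↦ R) z a) ∈ P := by
  induction z with
  | zero => exact ⟨⊥, Submodule.fg_bot, by simp⟩
  | add x y hx hy =>
    obtain ⟨P, hP, hxP⟩ := hx
    obtain ⟨P', hP', hyP⟩ := hy
    refine ⟨P ⊔ P', hP.sup hP', fun a ↦ ?_⟩
    rw [map_add, Pi.add_apply, map_add]
    exact Submodule.add_mem_sup (hxP a) (hyP a)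
  | tmul x f =>
    refine ⟨R ∙ x, Submodule.fg_span_singleton x, fun a ↦ ?_⟩
    simpa using Submodule.smul_mem _ (f a) (Submodule.mem_span_singleton_self x)

/-- An `R`-module `M` is finitely generated if and only if for every family `(Q a)` of
`R`-modules the canonical map `M ⊗[R] (∏ a, Q a) → ∏ a, (M ⊗[R] Q a)` is surjective. -/
theorem finite_iff_piRightHom_surjective
    (R M : Type u) [CommRing R] [AddCommGroup M] [Module R M] :
    Module.Finite R M ↔
      ∀ (A : Type u) (Q : A → Type u) [∀ a, AddCommGroup (Q a)] [∀ a, Module R (Q a)],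
        Function.Surjective (TensorProduct.piRightHom R R M Q) := by
  constructor
  · intro _ A Q _ _ t
    obtain ⟨n, g, hg⟩ := Module.Finite.exists_fin (R := R) (M := M)
    choose q hq using fun a ↦ TensorProduct.exists_eq_sum_tmul_of_span_eq_top_s13 hg (t a)
    refine ⟨∑ i, g i ⊗ₜ[R] fun a ↦ q a i, ?_⟩
    ext a
    simp [hq a]
  · intro h
    obtain ⟨z, hz⟩ := h M (fun _ ↦ R) fun m ↦ m ⊗ₜ[R] 1
    obtain ⟨P, hP, hzP⟩ := TensorProduct.exists_fg_forall_rid_piRightHom_mem z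
    have hP_top : P = ⊤ := eq_top_iff.mpr fun m _ ↦ by simpa [hz] using hzP m
    exact ⟨hP_top ▸ hP⟩
end

section
/- Let M be an R-module. Then M is finitely presented if and only if for every family (Q_α)_{α∈A} of R-modules, the canonical map M ⊗_R (∏_α Q_α) → ∏_α (M ⊗_R Q_α), given on pure tensors by x ⊗ (q_α) ↦ (x ⊗ q_α), is bijective. -/
open TensorProduct

universe u

namespace TensorProduct

variable {R M N A : Type*} [CommRing R] [AddCommGroup M] [Module R M] [AddCommGroup N] [Module R N]
  {Q : A → Type*} [∀ a, AddCommGroup (Q a)] [∀ a, Module R (Q a)]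

lemma piRightHom_rTensor_apply (f : M →ₗ[R] N) (z : M ⊗[R] (∀ a, Q a)) (a : A) :
    piRightHom R R N Q (f.rTensor _ z) a = f.rTensor _ (piRightHom R R M Q z a) := by
  induction z with
  | zero => simp
  | tmul x q => simp
  | add x y hx hy => simp only [map_add, Pi.add_apply, hx, hy]

lemma piScalarRight_comm_piRightHom_apply {n : Type*} [Fintype n] [DecidableEq n]
    (z : (n → R) ⊗[R] (∀ a, Q a)) (a : A) (i : n) :
    piScalarRight R R (Q a) n (TensorProduct.comm R _ _ (piRightHom R R (n → R) Q z a)) i =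
      piScalarRight R R (∀ a, Q a) n (TensorProduct.comm R _ _ z) i a := by
  induction z with
  | zero => simp
  | tmul x q => simp
  | add x y hx hy => simp only [map_add, Pi.add_apply, hx, hy]

lemma piRightHom_bijective_of_finite_pi (n : Type*) [Finite n] :
    Function.Bijective (piRightHom R R (n → R) Q) := by
  classical
  have := Fintype.ofFinite n
  let e (P : Type _) [AddCommGroup P] [Module R P] : (n → R) ⊗[R] P ≃ₗ[R] (n → P) :=
    TensorProduct.comm R _ _ ≪≫ₗ piScalarRight R R P n
  let e' (a : A) : (n → R) ⊗[R] Q a ≃ₗ[R] (n → Q a) :=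
    TensorProduct.comm R _ _ ≪≫ₗ piScalarRight R R (Q a) n
  have he (z : (n → R) ⊗[R] (∀ a, Q a)) (a : A) (i : n) :
      e' a (piRightHom R R (n → R) Q z a) i = e (∀ a, Q a) z i a :=
    piScalarRight_comm_piRightHom_apply z a i
  refine ⟨fun x y hxy ↦ (e _).injective ?_, fun y ↦ ⟨(e _).symm fun i a ↦ e' a (y a) i, ?_⟩⟩
  · ext i a
    rw [← he, ← he, hxy]
  · ext a
    apply (e' a).injective
    ext i
    rw [he, LinearEquiv.apply_symm_apply]

lemma piRightHom_bijective [Module.FinitePresentation R M] :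
    Function.Bijective (piRightHom R R M Q) := by
  obtain ⟨n, m, f, g, hf, hfg⟩ := Module.FinitePresentation.exists_fin' R M
  constructor
  · rw [injective_iff_map_eq_zero]
    intro t ht
    obtain ⟨s, rfl⟩ := LinearMap.rTensor_surjective _ hf t
    have hs (a : A) : ∃ k, g.rTensor (Q a) k = piRightHom R R _ Q s a := by
      refine (rTensor_exact (Q a) hfg hf _).mp ?_
      rw [← piRightHom_rTensor_apply, ht, Pi.zero_apply]
    choose k hk using hs
    obtain ⟨w, rfl⟩ := (piRightHom_bijective_of_finite_pi (Fin m)).surjective k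
    have hw : g.rTensor _ w = s := by
      apply (piRightHom_bijective_of_finite_pi (Fin n)).injective
      ext a
      rw [piRightHom_rTensor_apply, hk]
    exact (rTensor_exact _ hfg hf _).mpr ⟨w, hw⟩
  · intro y
    choose k hk using fun a ↦ LinearMap.rTensor_surjective (Q a) hf (y a)
    obtain ⟨w, rfl⟩ := (piRightHom_bijective_of_finite_pi (Fin n)).surjective k
    refine ⟨f.rTensor _ w, ?_⟩
    ext a
    rw [piRightHom_rTensor_apply, hk]

lemma exists_fg_forall_rid_piRightHom_mem_s14 (z : M ⊗[R] (A → R)) :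
    ∃ K : Submodule R M, K.FG ∧
      ∀ a, TensorProduct.rid R M (piRightHom R R M (fun _ : A ↦ R) z a) ∈ K := by
  induction z with
  | zero => exact ⟨⊥, Submodule.fg_bot, by simp⟩
  | tmul x q =>
    exact ⟨_, Submodule.fg_span_singleton x, fun a ↦ by
      simpa using Submodule.smul_mem _ _ (Submodule.mem_span_singleton_self x)⟩
  | add x y hx hy =>
    obtain ⟨K, hK, hx⟩ := hx
    obtain ⟨L, hL, hy⟩ := hy
    refine ⟨K ⊔ L, hK.sup hL, fun a ↦ ?_⟩
    simpa only [map_add, Pi.add_apply] using Submodule.add_mem_sup (hx a) (hy a)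

end TensorProduct

lemma Module.Finite.of_piRightHom_surjective {R M : Type*} [CommRing R] [AddCommGroup M]
    [Module R M] (h : Function.Surjective (TensorProduct.piRightHom R R M (fun _ : M ↦ R))) :
    Module.Finite R M := by
  obtain ⟨z, hz⟩ := h fun m ↦ m ⊗ₜ 1
  obtain ⟨K, hK, hzK⟩ := TensorProduct.exists_fg_forall_rid_piRightHom_mem_s14 z
  obtain rfl : K = ⊤ := eq_top_iff.mpr fun m _ ↦ by simpa [hz] using hzK m
  exact ⟨hK⟩

lemma LinearMap.fg_ker_of_piRightHom_injective {R M ι : Type*} [CommRing R] [AddCommGroup M]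
    [Module R M] [Fintype ι] (s : ι → M) (hs : Submodule.span R (Set.range s) = ⊤)
    (h : Function.Injective (TensorProduct.piRightHom R R M
      (fun _ : LinearMap.ker (Fintype.linearCombination R s) ↦ R))) :
    (LinearMap.ker (Fintype.linearCombination R s)).FG := by
  set K := LinearMap.ker (Fintype.linearCombination R s)
  have hzero : ∑ i, s i ⊗ₜ[R] (fun k : K ↦ k.1 i) = 0 := by
    apply h
    ext k
    apply (TensorProduct.rid R M).injective
    have hk : Fintype.linearCombination R s k.1 = 0 := k.2
    rw [Fintype.linearCombination_apply] at hk
    simpa using hk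
  obtain ⟨κ, c, y, hy, hc⟩ := TensorProduct.vanishesTrivially_of_sum_tmul_eq_zero R hs hzero
  rw [Submodule.fg_def]
  refine ⟨Set.range fun j i ↦ c i j, Set.finite_range _, le_antisymm ?_ fun k hk ↦ ?_⟩
  · rw [Submodule.span_le]
    rintro _ ⟨j, rfl⟩
    simpa [K, Fintype.linearCombination_apply] using hc j
  · have hsum : k = ∑ j, y j ⟨k, hk⟩ • fun i ↦ c i j := by
      ext i
      simpa [mul_comm] using congrFun (hy i) ⟨k, hk⟩
    rw [hsum]
    exact Submodule.sum_mem _ fun j _ ↦ Submodule.smul_mem _ _ (Submodule.subset_span ⟨j, rfl⟩)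

/-- An `R`-module `M` is finitely presented if and only if for every family `(Q a)` of
`R`-modules the canonical map `M ⊗[R] (∏ a, Q a) → ∏ a, (M ⊗[R] Q a)` is bijective. -/
theorem finitePresentation_iff_piRightHom_bijective
    (R M : Type u) [CommRing R] [AddCommGroup M] [Module R M] :
    Module.FinitePresentation R M ↔
      ∀ (A : Type u) (Q : A → Type u) [∀ a, AddCommGroup (Q a)] [∀ a, Module R (Q a)],
        Function.Bijective (TensorProduct.piRightHom R R M Q) := by
  refine ⟨fun _ _ _ _ _ ↦ TensorProduct.piRightHom_bijective, fun h ↦ ?_⟩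
  have := Module.Finite.of_piRightHom_surjective (h M fun _ ↦ R).surjective
  obtain ⟨n, s, hs⟩ := Module.Finite.exists_fin (R := R) (M := M)
  refine Module.finitePresentation_of_surjective (Fintype.linearCombination R s) ?_
    (LinearMap.fg_ker_of_piRightHom_injective s hs (h _ fun _ ↦ R).injective)
  rw [← LinearMap.range_eq_top, Fintype.range_linearCombination, hs]
end

section
/- Let 0 → M₁ → M₂ → M₃ → 0 be a universally exact sequence of R-modules. Then: (1) if M₂ is Mittag-Leffler, then M₁ is Mittag-Leffler; (2) if M₁ and M₃ are both Mittag-Leffler, then M₂ is Mittag-Leffler. -/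
open TensorProduct

universe u

/-- The canonical map `M ⊗[R] (∀ a, Q a) → ∀ a, M ⊗[R] Q a` is natural in `M`. -/
theorem TensorProduct.piRightHom_rTensor {R M N A : Type*} [CommRing R] [AddCommGroup M]
    [Module R M] [AddCommGroup N] [Module R N] (f : M →ₗ[R] N) (Q : A → Type*)
    [∀ a, AddCommGroup (Q a)] [∀ a, Module R (Q a)] (x : M ⊗[R] (∀ a, Q a)) (a : A) :
    piRightHom R R N Q (f.rTensor (∀ a, Q a) x) a =
      f.rTensor (Q a) (piRightHom R R M Q x a) := by
  induction x with
  | zero => simp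
  | tmul m q => simp
  | add x y hx hy => simp [hx, hy]

/-- Let `0 → M₁ → M₂ → M₃ → 0` be a universally exact sequence of `R`-modules.  Then:
(1) if `M₂` is Mittag-Leffler, then `M₁` is Mittag-Leffler;
(2) if `M₁` and `M₃` are both Mittag-Leffler, then `M₂` is Mittag-Leffler. -/
theorem mittagLeffler_of_universally_exact
    (R : Type u) [CommRing R]
    (M₁ M₂ M₃ : Type u) [AddCommGroup M₁] [Module R M₁] [AddCommGroup M₂] [Module R M₂]
    [AddCommGroup M₃] [Module R M₃]
    (f : M₁ →ₗ[R] M₂) (g : M₂ →ₗ[R] M₃)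
    (hf : Function.Injective f) (hg : Function.Surjective g) (hfg : Function.Exact f g)
    (huniv : ∀ (Q : Type u) [AddCommGroup Q] [Module R Q],
      Function.Injective (LinearMap.rTensor Q f)) :
    (Module.IsMittagLeffler R M₂ → Module.IsMittagLeffler R M₁) ∧
    (Module.IsMittagLeffler R M₁ → Module.IsMittagLeffler R M₃ →
      Module.IsMittagLeffler R M₂) := by
  refine ⟨fun h₂ A Q _ _ => ?_, fun h₁ h₃ A Q _ _ => ?_⟩ <;>
    refine (injective_iff_map_eq_zero _).2 fun x hx => ?_
  · refine (injective_iff_map_eq_zero _).1 (huniv (∀ a, Q a)) x ?_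
    refine (injective_iff_map_eq_zero _).1 (h₂ A Q) _ (funext fun a => ?_)
    simp [TensorProduct.piRightHom_rTensor, hx]
  · have hgx : g.rTensor (∀ a, Q a) x = 0 :=
      (injective_iff_map_eq_zero _).1 (h₃ A Q) _ <| funext fun a => by
        simp [TensorProduct.piRightHom_rTensor, hx]
    obtain ⟨y, rfl⟩ := (rTensor_exact (∀ a, Q a) hfg hg x).1 hgx
    have hy : y = 0 := (injective_iff_map_eq_zero _).1 (h₁ A Q) y <| funext fun a =>
      (injective_iff_map_eq_zero _).1 (huniv (Q a)) _ <| by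
        rw [← TensorProduct.piRightHom_rTensor, hx, Pi.zero_apply]
    rw [hy, map_zero]
end

section
/- Let M = ⊕_{i∈I} M_i be a direct sum of R-modules. Then M is Mittag-Leffler if and only if each M_i is Mittag-Leffler. -/
open TensorProduct

universe u

theorem TensorProduct.piRightHom_rTensor_apply_s16 {R M N A : Type*} [CommRing R]
    [AddCommGroup M] [Module R M] [AddCommGroup N] [Module R N] (f : M →ₗ[R] N)
    (Q : A → Type*) [∀ a, AddCommGroup (Q a)] [∀ a, Module R (Q a)]
    (x : M ⊗[R] (∀ a, Q a)) (a : A) :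
    piRightHom R R N Q (f.rTensor _ x) a = f.rTensor (Q a) (piRightHom R R M Q x a) := by
  induction x with
  | zero => simp
  | add x y hx hy => simp [hx, hy]
  | tmul m q => simp

theorem TensorProduct.piRightHom_rTensor_eq_zero {R M N A : Type*} [CommRing R]
    [AddCommGroup M] [Module R M] [AddCommGroup N] [Module R N] (f : M →ₗ[R] N)
    (Q : A → Type*) [∀ a, AddCommGroup (Q a)] [∀ a, Module R (Q a)]
    {x : M ⊗[R] (∀ a, Q a)} (hx : piRightHom R R M Q x = 0) :
    piRightHom R R N Q (f.rTensor _ x) = 0 := by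
  ext a
  rw [piRightHom_rTensor_apply_s16, hx]
  simp

theorem TensorProduct.directSumLeft_apply {R ι P : Type*} [CommRing R] [DecidableEq ι]
    {M : ι → Type*} [∀ i, AddCommGroup (M i)] [∀ i, Module R (M i)]
    [AddCommGroup P] [Module R P] (x : DirectSum ι M ⊗[R] P) (i : ι) :
    directSumLeft R R M P x i = (DirectSum.component R ι M i).rTensor P x := by
  induction x with
  | zero => simp
  | add x y hx hy => simp [hx, hy]
  | tmul m p => exact directSumLeft_tmul R R m p i

/-- A retract of a Mittag-Leffler module is Mittag-Leffler. -/
theorem Module.IsMittagLeffler.of_retract_s16 {R M N : Type u} [CommRing R]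
    [AddCommGroup M] [Module R M] [AddCommGroup N] [Module R N]
    (h : Module.IsMittagLeffler R M) (i : N →ₗ[R] M) (p : M →ₗ[R] N)
    (hpi : p ∘ₗ i = LinearMap.id) : Module.IsMittagLeffler R N := by
  intro A Q _ _
  rw [injective_iff_map_eq_zero]
  intro x hx
  have hix : i.rTensor _ x = 0 :=
    (injective_iff_map_eq_zero _).1 (h A Q) _ (piRightHom_rTensor_eq_zero i Q hx)
  rw [← LinearMap.rTensor_id_apply (R := R) (∀ a, Q a) N x, ← hpi, LinearMap.rTensor_comp_apply,
    hix, map_zero]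

/-- A direct sum `⊕ᵢ Mᵢ` of `R`-modules is Mittag-Leffler if and only if each `Mᵢ` is
Mittag-Leffler. -/
theorem directSum_mittagLeffler_iff
    (R : Type u) [CommRing R] (ι : Type u) [DecidableEq ι] (M : ι → Type u)
    [∀ i, AddCommGroup (M i)] [∀ i, Module R (M i)] :
    Module.IsMittagLeffler R (DirectSum ι M) ↔ ∀ i, Module.IsMittagLeffler R (M i) := by
  refine ⟨fun h i ↦ h.of_retract_s16 (DirectSum.lof R ι M i) (DirectSum.component R ι M i) ?_,
    fun h A Q _ _ ↦ ?_⟩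
  · ext m
    simp
  · rw [injective_iff_map_eq_zero]
    intro x hx
    apply (directSumLeft R R M (∀ a, Q a)).injective
    rw [map_zero]
    ext i
    rw [directSumLeft_apply, DirectSum.zero_apply]
    exact (injective_iff_map_eq_zero _).1 (h i A Q) _ (piRightHom_rTensor_eq_zero _ Q hx)
end

section
/- Let R be a Noetherian ring and n a positive integer. Then the formal power series ring M = R[[t₁, …, t_n]] is flat and Mittag-Leffler as an R-module. -/
open TensorProduct

universe u

namespace TensorProduct

variable {R : Type*} [CommRing R] {ι : Type*}

/-- The map `(ι → R) ⊗ Q → Q` applying the `i`-th coordinate to the first factor. -/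
noncomputable def coordHom (R : Type*) [CommRing R] {ι : Type*} (Q : Type*) [AddCommGroup Q]
    [Module R Q] (i : ι) : (ι → R) ⊗[R] Q →ₗ[R] Q :=
  (TensorProduct.lid R Q).toLinearMap ∘ₗ (LinearMap.proj i).rTensor Q

@[simp]
theorem coordHom_tmul {Q : Type*} [AddCommGroup Q] [Module R Q] (i : ι) (f : ι → R) (q : Q) :
    coordHom R Q i (f ⊗ₜ q) = f i • q := by
  simp [coordHom]

theorem coordHom_lTensor {Q Q' : Type*} [AddCommGroup Q] [Module R Q] [AddCommGroup Q']
    [Module R Q'] (g : Q →ₗ[R] Q') (i : ι) (x : (ι → R) ⊗[R] Q) :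
    coordHom R Q' i (g.lTensor (ι → R) x) = g (coordHom R Q i x) := by
  induction x with
  | zero => simp
  | tmul f q => simp
  | add x y hx hy => simp [hx, hy]

theorem coordHom_piRightHom {A : Type*} (Q : A → Type*) [∀ a, AddCommGroup (Q a)]
    [∀ a, Module R (Q a)] (i : ι) (a : A) (x : (ι → R) ⊗[R] (∀ a, Q a)) :
    coordHom R (Q a) i (piRightHom R R (ι → R) Q x a) = coordHom R (∀ a, Q a) i x a := by
  induction x with
  | zero => simp
  | tmul f q => simp
  | add x y hx hy => simp [hx, hy]

/-- Over a Noetherian ring, an element of `(ι → R) ⊗ Q` is zero if all its coordinates are. -/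
theorem eq_zero_of_coordHom_eq_zero [IsNoetherianRing R] {Q : Type*} [AddCommGroup Q]
    [Module R Q] {x : (ι → R) ⊗[R] Q} (hx : ∀ i, coordHom R Q i x = 0) : x = 0 := by
  obtain ⟨k, f, q, rfl⟩ := exists_sum_tmul_eq x
  obtain ⟨r, s, hs⟩ := Submodule.fg_iff_exists_fin_generating_family.mp
    (IsNoetherian.noetherian (LinearMap.ker (Fintype.linearCombination R q)))
  have hmem (i : ι) : (fun j ↦ f j i) ∈ Submodule.span R (Set.range s) := by
    rw [hs, LinearMap.mem_ker, Fintype.linearCombination_apply]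
    simpa using hx i
  choose c hc using fun i ↦ (Submodule.mem_span_range_iff_exists_fun R).mp (hmem i)
  have hvanish : VanishesTrivially R q f := by
    refine ⟨r, fun j l ↦ s l j, fun l i ↦ c i l, fun j ↦ ?_, fun l ↦ ?_⟩
    · ext i
      simpa [mul_comm] using (congrFun (hc i) j).symm
    · have hl : s l ∈ LinearMap.ker (Fintype.linearCombination R q) :=
        hs ▸ Submodule.subset_span ⟨l, rfl⟩
      simpa [Fintype.linearCombination_apply] using hl
  simpa using congrArg (TensorProduct.comm R Q (ι → R))
    (sum_tmul_eq_zero_of_vanishesTrivially R hvanish)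

end TensorProduct

/-- Over a Noetherian ring, an arbitrary power of the ring is flat. -/
theorem Module.Flat.pi_self_of_isNoetherianRing (R : Type*) [CommRing R] [IsNoetherianRing R]
    (ι : Type*) : Module.Flat R (ι → R) := by
  rw [Module.Flat.iff_lTensor_preserves_injective_linearMap]
  intro N N' _ _ _ _ g hg
  rw [injective_iff_map_eq_zero]
  intro x hx
  refine eq_zero_of_coordHom_eq_zero fun i ↦ hg ?_
  rw [← coordHom_lTensor, hx, map_zero, map_zero]

/-- Over a Noetherian ring, an arbitrary power of the ring is Mittag-Leffler. -/
theorem TensorProduct.piRightHom_pi_self_injective (R : Type*) [CommRing R] [IsNoetherianRing R]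
    (ι : Type*) {A : Type*} (Q : A → Type*) [∀ a, AddCommGroup (Q a)] [∀ a, Module R (Q a)] :
    Function.Injective (piRightHom R R (ι → R) Q) := by
  rw [injective_iff_map_eq_zero]
  intro x hx
  refine eq_zero_of_coordHom_eq_zero fun i ↦ funext fun a ↦ ?_
  rw [← coordHom_piRightHom, hx, Pi.zero_apply, map_zero, Pi.zero_apply]

/-- Let `R` be a Noetherian (commutative) ring and `n` a positive integer.  Then the formal
power series ring `R[[t₁, …, t_n]]` is flat and Mittag-Leffler as an `R`-module. -/
theorem powerSeries_flat_and_mittagLeffler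
    (R : Type u) [CommRing R] [IsNoetherianRing R] (n : ℕ) (hn : 0 < n) :
    Module.Flat R (MvPowerSeries (Fin n) R) ∧
      Module.IsMittagLeffler R (MvPowerSeries (Fin n) R) := by
  exact ⟨Module.Flat.pi_self_of_isNoetherianRing R (Fin n →₀ ℕ),
    fun _ Q _ _ ↦ TensorProduct.piRightHom_pi_self_injective R (Fin n →₀ ℕ) Q⟩
end

section
/- Let M be an R-module. If M is flat, Mittag-Leffler, and countably generated, then M is projective. -/
open TensorProduct

universe u

namespace Module.IsMittagLeffler

variable {R M Q : Type u} [CommRing R] [AddCommGroup M] [Module R M] [AddCommGroup Q] [Module R Q]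

/-- For a flat Mittag-Leffler module `M`, every `x : M ⊗[R] Q` has a content: a smallest
submodule `N` of `Q` such that `x` comes from `M ⊗[R] N`. -/
theorem exists_isLeast_mem_range_lTensor [Module.Flat R M] (hML : Module.IsMittagLeffler R M)
    (x : M ⊗[R] Q) :
    ∃ N : Submodule R Q,
      IsLeast {N : Submodule R Q | x ∈ LinearMap.range (N.subtype.lTensor M)} N := by
  let A := {N : Submodule R Q // x ∈ LinearMap.range (N.subtype.lTensor M)}
  refine ⟨⨅ a : A, a.1, ?_, fun N hN => iInf_le (fun a : A => a.1) ⟨N, hN⟩⟩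
  let f : Q →ₗ[R] ∀ a : A, Q ⧸ a.1 := LinearMap.pi fun a => a.1.mkQ
  have hker : LinearMap.ker f = ⨅ a : A, a.1 := by
    simp [f, LinearMap.ker_pi]
  have hcoord (a : A) : LinearMap.proj a ∘ₗ TensorProduct.piRightHom R R M (fun a : A => Q ⧸ a.1)
      ∘ₗ f.lTensor M = a.1.mkQ.lTensor M := by
    ext
    simp [f]
  have hfx : f.lTensor M x = 0 := by
    refine hML A _ ?_
    rw [map_zero]
    funext a
    have h : x ∈ LinearMap.ker (a.1.mkQ.lTensor M) := (lTensor_mkQ M a.1).symm ▸ a.2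
    exact (LinearMap.congr_fun (hcoord a) x).trans h
  have hexact : Function.Exact (LinearMap.ker f).subtype f := f.exact_subtype_ker_map
  rw [← hker]
  exact (Module.Flat.lTensor_exact M hexact x).mp hfx

/-- A map `φ` from a finite free module to a flat Mittag-Leffler module `M` factors through a map
`g` of finite free modules that factors through every other such factorization of `φ`; moreover
the second factor can be chosen to hit any given element `e` of `M`. -/
theorem exists_dominating_factorization [Module.Flat R M] (hML : Module.IsMittagLeffler R M)
    {n : ℕ} (φ : (Fin n → R) →ₗ[R] M) (e : M) :
    ∃ (m : ℕ) (ψ : (Fin m → R) →ₗ[R] M) (g : (Fin n → R) →ₗ[R] (Fin m → R)),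
      φ = ψ ∘ₗ g ∧ e ∈ LinearMap.range ψ ∧
      ∀ (k : ℕ) (g' : (Fin n → R) →ₗ[R] (Fin k → R)) (ψ' : (Fin k → R) →ₗ[R] M),
        φ = ψ' ∘ₗ g' → ∃ h : (Fin k → R) →ₗ[R] (Fin m → R), g = h ∘ₗ g' := by
  obtain ⟨N, ⟨t, ht⟩, hmin⟩ := hML.exists_isLeast_mem_range_lTensor
    (∑ i, φ (Pi.single i 1) ⊗ₜ[R] (Pi.single i 1 : Fin n → R))
  obtain ⟨m, y, c, rfl⟩ := TensorProduct.exists_sum_tmul_eq t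
  simp only [map_sum, LinearMap.lTensor_tmul, Submodule.subtype_apply] at ht
  let y' : Fin (m + 1) → M := Fin.cons e y
  let c' : Fin (m + 1) → N := Fin.cons 0 c
  let C : Matrix (Fin (m + 1)) (Fin n) R := Matrix.of fun j => (c' j : Fin n → R)
  refine ⟨m + 1, Fintype.linearCombination R y', C.mulVecLin, ?_, ?_, ?_⟩
  · refine LinearMap.pi_ext' fun i => LinearMap.ext_ring ?_
    have h := congrArg (fun z => TensorProduct.rid R M
      ((LinearMap.proj i : (Fin n → R) →ₗ[R] R).lTensor M z)) ht
    simp only [map_sum, LinearMap.lTensor_tmul, LinearMap.proj_apply, TensorProduct.rid_tmul,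
      Pi.single_apply, ite_smul, one_smul, zero_smul, Finset.sum_ite_eq, Finset.mem_univ,
      if_true] at h
    have hC (j : Fin (m + 1)) : C.mulVecLin (Pi.single i 1) j = (c' j : Fin n → R) i := by
      simp [C]
    simp only [LinearMap.comp_apply, LinearMap.single_apply, Fintype.linearCombination_apply, hC]
    simp [Fin.sum_univ_succ, y', c', h]
  · exact ⟨Pi.single 0 1, by simp [y']⟩
  · intro k g' ψ' hφ
    let G := LinearMap.toMatrix' g'
    have hG : g' = G.mulVecLin := (Matrix.toLin'_toMatrix' g').symm
    have hN : N ≤ Submodule.span R (Set.range G) := by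
      refine hmin ⟨∑ l, ψ' (Pi.single l 1) ⊗ₜ[R]
        (⟨G l, Submodule.subset_span ⟨l, rfl⟩⟩ : Submodule.span R (Set.range G)), ?_⟩
      have hφe (i : Fin n) : φ (Pi.single i 1) = ∑ l, G l i • ψ' (Pi.single l 1) := by
        rw [hφ, LinearMap.comp_apply, pi_eq_sum_univ' (g' (Pi.single i 1)), map_sum]
        simp [G, LinearMap.toMatrix'_apply]
      have hGe (l : Fin k) : G l = ∑ i, G l i • (Pi.single i 1 : Fin n → R) :=
        pi_eq_sum_univ' (G l)
      simp only [map_sum, LinearMap.lTensor_tmul, Submodule.subtype_apply, hφe,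
        TensorProduct.sum_tmul, TensorProduct.smul_tmul]
      rw [Finset.sum_comm]
      refine Finset.sum_congr rfl fun l _ => ?_
      rw [← TensorProduct.tmul_sum, ← hGe]
    choose H hH using fun j => (Submodule.mem_span_range_iff_exists_fun R).mp (hN (c' j).2)
    refine ⟨(Matrix.of H).mulVecLin, ?_⟩
    rw [hG, ← Matrix.mulVecLin_mul]
    congr 1
    ext j i
    rw [Matrix.mul_apply, show C j i = (c' j : Fin n → R) i from rfl, ← hH j]
    simp

end Module.IsMittagLeffler

section Chain

variable {R M : Type*} [CommRing R] [AddCommGroup M] [Module R M] {F : ℕ → Type*}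
  [∀ n, AddCommGroup (F n)] [∀ n, Module R (F n)]

/-- A compatible family of maps out of a chain with colimit `M` descends to `M`. -/
theorem LinearMap.exists_extend_of_chain {P : Type*} [AddCommGroup P] [Module R P]
    (φ : ∀ n, F n →ₗ[R] M) (g : ∀ n, F n →ₗ[R] F (n + 1)) (s : ∀ n, F n →ₗ[R] P)
    (hφ : ∀ n, φ n = φ (n + 1) ∘ₗ g n) (hs : ∀ n, s n = s (n + 1) ∘ₗ g n)
    (hker : ∀ n, LinearMap.ker (φ n) ≤ LinearMap.ker (s n)) (hsurj : ∀ x, ∃ n v, φ n v = x) :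
    ∃ f : M →ₗ[R] P, ∀ n, f ∘ₗ φ n = s n := by
  have lift {n k : ℕ} (hnk : n ≤ k) (v : F n) : ∃ w : F k, φ k w = φ n v ∧ s k w = s n v := by
    induction k, hnk using Nat.le_induction with
    | base => exact ⟨v, rfl, rfl⟩
    | succ k _ ih =>
      obtain ⟨w, hw, hw'⟩ := ih
      exact ⟨g k w, by rw [← hw, hφ k]; rfl, by rw [← hw', hs k]; rfl⟩
  have wd (n k : ℕ) (v : F n) (w : F k) (h : φ n v = φ k w) : s n v = s k w := by
    obtain ⟨v', hv, hv'⟩ := lift (le_max_left n k) v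
    obtain ⟨w', hw, hw'⟩ := lift (le_max_right n k) w
    have : s _ (v' - w') = 0 := hker _ (by simp [hv, hw, h])
    rwa [map_sub, sub_eq_zero, hv', hw'] at this
  choose N V hV using hsurj
  refine ⟨{ toFun := fun x => s (N x) (V x), map_add' := fun x y => ?_, map_smul' := fun r x => ?_ },
    fun n => LinearMap.ext fun v => wd _ _ _ _ (hV _)⟩
  · obtain ⟨v', hv, hv'⟩ := lift (le_max_left (N x) (N y)) (V x)
    obtain ⟨w', hw, hw'⟩ := lift (le_max_right (N x) (N y)) (V y)
    rw [← hv', ← hw', ← map_add]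
    exact wd _ _ _ _ (by simp [hV, hv, hw])
  · rw [RingHom.id_apply, ← map_smul]
    exact wd _ _ _ _ (by simp [hV])

/-- A colimit `M` of a chain of projective modules is projective as soon as the transition maps
have the same kernels as the maps to `M` and satisfy a dual Mittag-Leffler condition: each
transition map factors through the next composite transition map. -/
theorem Module.Projective.of_chain [∀ n, Module.Projective R (F n)]
    (φ : ∀ n, F n →ₗ[R] M) (g : ∀ n, F n →ₗ[R] F (n + 1))
    (h : ∀ n, F (n + 1 + 1) →ₗ[R] F (n + 1))
    (hφ : ∀ n, φ n = φ (n + 1) ∘ₗ g n) (hg : ∀ n, g n = h n ∘ₗ g (n + 1) ∘ₗ g n)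
    (hker : ∀ n, LinearMap.ker (φ n) ≤ LinearMap.ker (g n)) (hsurj : ∀ x, ∃ n v, φ n v = x) :
    Module.Projective R M := by
  let p : (M →₀ R) →ₗ[R] M := Finsupp.linearCombination R id
  have hp : Function.Surjective p := Finsupp.linearCombination_id_surjective R M
  choose t ht using fun n => Module.projective_lifting_property p (φ n) hp
  let u : ∀ n, F (n + 1) →ₗ[R] (M →₀ R) := fun n =>
    Nat.rec (motive := fun n => F (n + 1) →ₗ[R] (M →₀ R)) (t 1)
      (fun n un => t (n + 1 + 1) + (un - t (n + 1 + 1) ∘ₗ g (n + 1)) ∘ₗ h n) n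
  have hu (n : ℕ) : u (n + 1) = t (n + 1 + 1) + (u n - t (n + 1 + 1) ∘ₗ g (n + 1)) ∘ₗ h n := rfl
  have hpu (n : ℕ) : p ∘ₗ u n = φ (n + 1) := by
    induction n with
    | zero => exact ht 1
    | succ n ih =>
      rw [hu, LinearMap.comp_add, ht, ← LinearMap.comp_assoc, LinearMap.comp_sub, ih,
        ← LinearMap.comp_assoc, ht, ← hφ, sub_self, LinearMap.zero_comp, add_zero]
  have hcompat (n : ℕ) : u n ∘ₗ g n = (u (n + 1) ∘ₗ g (n + 1)) ∘ₗ g n := by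
    have key (v : F n) : h n (g (n + 1) (g n v)) = g n v := (LinearMap.congr_fun (hg n) v).symm
    ext1 v
    simp [hu, key]
  obtain ⟨f, hf⟩ := LinearMap.exists_extend_of_chain φ g (fun n => u n ∘ₗ g n) hφ hcompat
    (fun n => (hker n).trans (LinearMap.ker_le_ker_comp _ _)) hsurj
  refine Module.Projective.of_split f p (LinearMap.ext fun x => ?_)
  obtain ⟨n, v, rfl⟩ := hsurj x
  calc p (f (φ n v)) = p (u n (g n v)) := congrArg p (LinearMap.congr_fun (hf n) v)
    _ = φ (n + 1) (g n v) := LinearMap.congr_fun (hpu n) _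
    _ = φ n v := (LinearMap.congr_fun (hφ n) v).symm

end Chain

/-- If an `R`-module `M` is flat, Mittag-Leffler, and countably generated, then `M` is
projective. -/
theorem projective_of_flat_mittagLeffler_countablyGenerated
    (R M : Type u) [CommRing R] [AddCommGroup M] [Module R M]
    (hflat : Module.Flat R M) (hML : Module.IsMittagLeffler R M)
    (hcg : ∃ s : Set M, s.Countable ∧ Submodule.span R s = ⊤) :
    Module.Projective R M := by
  obtain ⟨S, hS, hspan⟩ := hcg
  obtain ⟨e, he⟩ := (hS.insert 0).exists_eq_range (Set.insert_nonempty 0 S)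
  choose m ψ g₀ hfac he₀ hdom using
    fun (a : Σ n : ℕ, (Fin n → R) →ₗ[R] M) => hML.exists_dominating_factorization a.2
  let σ : ℕ → Σ n : ℕ, (Fin n → R) →ₗ[R] M := fun n =>
    Nat.rec ⟨0, 0⟩ (fun n a => ⟨m a (e n), ψ a (e n)⟩) n
  let F : ℕ → Type u := fun n => Fin (σ n).1 → R
  let φ : ∀ n, F n →ₗ[R] M := fun n => (σ n).2
  let g : ∀ n, F n →ₗ[R] F (n + 1) := fun n => g₀ (σ n) (e n)
  have hφ (n : ℕ) : φ n = φ (n + 1) ∘ₗ g n := hfac (σ n) (e n)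
  have heφ (n : ℕ) : e n ∈ LinearMap.range (φ (n + 1)) := he₀ (σ n) (e n)
  have hex (n : ℕ) : ∃ h : F (n + 1 + 1) →ₗ[R] F (n + 1), g n = h ∘ₗ g (n + 1) ∘ₗ g n :=
    hdom (σ n) (e n) _ (g (n + 1) ∘ₗ g n) (φ (n + 1 + 1))
      ((hφ n).trans (by rw [hφ (n + 1), LinearMap.comp_assoc]))
  choose h hg using hex
  refine Module.Projective.of_chain φ g h hφ hg (fun n v hv => ?_) ?_
  · obtain ⟨k, a, y, hay, hav⟩ := Module.Flat.exists_factorization_of_apply_eq_zero_of_free hv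
    let E := Finsupp.linearEquivFunOnFinite R R (Fin k)
    obtain ⟨q, hq⟩ := hdom (σ n) (e n) k (E.toLinearMap ∘ₗ a) (y ∘ₗ E.symm.toLinearMap)
      (LinearMap.ext fun w => by simpa using LinearMap.congr_fun hay w)
    exact (LinearMap.congr_fun hq v).trans (by simp [hav])
  · have hmono : Monotone fun n => LinearMap.range (φ n) := monotone_nat_of_le_succ fun n => by
      rw [hφ n]
      exact LinearMap.range_comp_le_range _ _
    have htop : ⨆ n, LinearMap.range (φ n) = ⊤ := by
      rw [eq_top_iff, ← hspan, Submodule.span_le]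
      intro x hx
      obtain ⟨n, rfl⟩ : x ∈ Set.range e := he ▸ Set.mem_insert_of_mem 0 hx
      exact Submodule.mem_iSup_of_mem (n + 1) (heφ n)
    intro x
    have hx : x ∈ ⨆ n, LinearMap.range (φ n) := htop ▸ Submodule.mem_top
    exact (Submodule.mem_iSup_of_directed _ hmono.directed_le).mp hx
end
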